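/- Let k be an algebraically closed field of prime characteristic p ≥ 3. Then Ext^l_{Λ_k(p,2p)}(V^{⊗2p}, V^{⊗2p}) = 0 for all l with 1 ≤ l ≤ 4(p−1)−2, where V^{⊗2p} (with V = k^p) is regarded as a right Λ_k(p, 2p)-module. -/

import Mathlib

universe u

/-- The representation of the symmetric group `S_d` on the `d`-th tensor power of `V = k^n`
by place permutations; the tensor power `V^{⊗ d}` is realised as the free `k`-module on the
set of multi-indices `Fin d → Fin n`, i.e. as the functions `(Fin d → Fin n) → k`. -/
def placePerm (k : Type u) [Field k] (n d : ℕ) :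
    Representation k (Equiv.Perm (Fin d)) ((Fin d → Fin n) → k) where
  toFun σ :=
    { toFun := fun f v => f (v ∘ σ)
      map_add' := fun _ _ => rfl
      map_smul' := fun _ _ => rfl }
  map_one' := by ext f v; rfl
  map_mul' := fun σ τ => by ext f v; rfl

/-- The group algebra of the symmetric group on `d` letters over `k`. -/
abbrev SymGroupAlgebra (k : Type u) [Field k] (d : ℕ) : Type u :=
  MonoidAlgebra k (Equiv.Perm (Fin d))

/-- The tensor space `V^{⊗ d}`, `V = k^n`, as a module over the group algebra of `S_d`
(the symmetric group acting by place permutations). -/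
def TensorSpace (k : Type u) [Field k] (n d : ℕ) : Type u := (Fin d → Fin n) → k

instance (k : Type u) [Field k] (n d : ℕ) : AddCommGroup (TensorSpace k n d) :=
  inferInstanceAs (AddCommGroup ((Fin d → Fin n) → k))

instance (k : Type u) [Field k] (n d : ℕ) : Module k (TensorSpace k n d) :=
  inferInstanceAs (Module k ((Fin d → Fin n) → k))

noncomputable instance (k : Type u) [Field k] (n d : ℕ) :
    Module (SymGroupAlgebra k d) (TensorSpace k n d) where
  smul r t := (placePerm k n d).asAlgebraHom r t
  one_smul t := by show (placePerm k n d).asAlgebraHom 1 t = t; rw [map_one]; rfl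
  mul_smul r s t := by
    show (placePerm k n d).asAlgebraHom (r * s) t
      = (placePerm k n d).asAlgebraHom r ((placePerm k n d).asAlgebraHom s t)
    rw [map_mul]; rfl
  smul_zero r := map_zero ((placePerm k n d).asAlgebraHom r)
  smul_add r t₁ t₂ := map_add ((placePerm k n d).asAlgebraHom r) t₁ t₂
  add_smul r s t := by
    show (placePerm k n d).asAlgebraHom (r + s) t
      = (placePerm k n d).asAlgebraHom r t + (placePerm k n d).asAlgebraHom s t
    rw [map_add]; rfl
  zero_smul t := by show (placePerm k n d).asAlgebraHom 0 t = 0; rw [map_zero]; rfl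

lemma tensorSpace_smul_def (k : Type u) [Field k] {n d : ℕ} (r : SymGroupAlgebra k d)
    (t : TensorSpace k n d) : r • t = (placePerm k n d).asAlgebraHom r t := rfl

/-- The Schur algebra `S_k(n, d)`: the endomorphism algebra of the tensor space
`(k^n)^{⊗ d}` as a module over the group algebra of the symmetric group `S_d`.
The tensor space is a left module over it by evaluation. -/
noncomputable abbrev SchurAlgebra (k : Type u) [Field k] (n d : ℕ) : Type u :=
  Module.End (SymGroupAlgebra k d) (TensorSpace k n d)

/-- The congruence relation on the group algebra `k S_d` corresponding to the two-sided
ideal `Ann_{k S_d}((k^n)^{⊗ d})`, the annihilator of the tensor space. -/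
noncomputable def annihilatorCon (k : Type u) [Field k] (n d : ℕ) :
    RingCon (SymGroupAlgebra k d) where
  r a b := ∀ t : TensorSpace k n d, a • t = b • t
  iseqv :=
    ⟨fun _ _ => rfl, fun h t => (h t).symm, fun h₁ h₂ t => (h₁ t).trans (h₂ t)⟩
  mul' := fun {a b c d'} h₁ h₂ t => by
    show (a * c) • t = (b * d') • t
    rw [mul_smul, mul_smul, h₂ t, h₁ (d' • t)]
  add' := fun {a b c d'} h₁ h₂ t => by
    show (a + c) • t = (b + d') • t
    rw [add_smul, add_smul, h₁ t, h₂ t]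

/-- The algebra `Λ_k(n, d)`: the quotient of the group algebra of the symmetric group `S_d`
by the annihilator of the tensor space `(k^n)^{⊗ d}`. -/
noncomputable def LambdaAlgebra (k : Type u) [Field k] (n d : ℕ) : Type u :=
  (annihilatorCon k n d).Quotient

noncomputable instance (k : Type u) [Field k] (n d : ℕ) : Ring (LambdaAlgebra k n d) :=
  inferInstanceAs (Ring (annihilatorCon k n d).Quotient)

/-- The tensor space is a module over `Λ_k(n, d)`. -/
noncomputable instance (k : Type u) [Field k] (n d : ℕ) :
    Module (LambdaAlgebra k n d) (TensorSpace k n d) where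
  smul a t := Quotient.liftOn a (fun r => r • t) (fun _ _ h => h t)
  one_smul t := one_smul (SymGroupAlgebra k d) t
  mul_smul a b t := Quotient.inductionOn₂ a b (fun r s => mul_smul r s t)
  smul_zero a := Quotient.inductionOn a (fun r => smul_zero r)
  smul_add a t₁ t₂ := Quotient.inductionOn a (fun r => smul_add r t₁ t₂)
  add_smul a b t := Quotient.inductionOn₂ a b (fun r s => add_smul r s t)
  zero_smul t := zero_smul (SymGroupAlgebra k d) t

/-- `Λ_k(n, d)` is a `k`-algebra. -/
noncomputable instance (k : Type u) [Field k] (n d : ℕ) : Algebra k (LambdaAlgebra k n d) :=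
  RingHom.toAlgebra'
    ((RingCon.mk' (annihilatorCon k n d)).comp (algebraMap k (SymGroupAlgebra k d)))
    (fun c x => by
      refine Quotient.inductionOn x (fun r => ?_)
      show ((algebraMap k (SymGroupAlgebra k d) c * r : SymGroupAlgebra k d) :
          (annihilatorCon k n d).Quotient)
        = ((r * algebraMap k (SymGroupAlgebra k d) c : SymGroupAlgebra k d) :
          (annihilatorCon k n d).Quotient)
      exact congrArg _ (Algebra.commutes c r))

open CategoryTheory in
/-- `Ext^i_A(M, N) = 0`, where `A` is an algebra over the field `k` and `Ext` is computed
in the category of `A`-modules. -/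
def ExtIsZero (k : Type u) [Field k] (A : Type u) [Ring A] [Algebra k A]
    (M : Type u) [AddCommGroup M] [Module A M]
    (N : Type u) [AddCommGroup N] [Module A N] (i : ℕ) : Prop :=
  Subsingleton
    (((_root_.Ext k (ModuleCat.{u} A) i).obj (Opposite.op (ModuleCat.of A M))).obj
      (ModuleCat.of A N))


/-! ### Ext-vanishing: basic lemmas -/

open CategoryTheory in
theorem extIsZero_of_abelianExt (k : Type u) [Field k] (A : Type u) [Ring A] [Algebra k A]
    (M : Type u) [AddCommGroup M] [Module A M]
    (N : Type u) [AddCommGroup N] [Module A N] (m : ℕ) (hm : 1 ≤ m)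
    (h : Subsingleton (Abelian.Ext.{u} (ModuleCat.of A M) (ModuleCat.of A N) m)) :
    ExtIsZero k A M N m := by
  obtain ⟨i, rfl⟩ : ∃ i, m = i + 1 := ⟨m - 1, by omega⟩
  unfold ExtIsZero
  let P := projectiveResolution (ModuleCat.of A M)
  refine ModuleCat.subsingleton_of_isZero ?_
  refine Limits.IsZero.of_iso ?_ (P.isoExt (i+1) (ModuleCat.of A N))
  rw [← HomologicalComplex.exactAt_iff_isZero_homology,
    HomologicalComplex.exactAt_iff' _ i (i+1) (i+2) (by simp) (by simp),
    ShortComplex.moduleCat_exact_iff]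
  intro x hx
  change P.complex.X (i+1) ⟶ ModuleCat.of A N at x
  have hx' : P.complex.d (i+2) (i+1) ≫ x = 0 := hx
  have := (P.extMk_eq_zero_iff x (i+2) rfl hx' i rfl).1 (Subsingleton.elim _ _)
  obtain ⟨g, hg⟩ := this
  exact ⟨g, hg⟩

/-- Ext-vanishing predicate. -/
def EV (A : Type u) [Ring A] (m : ℕ) (X : Type u) [AddCommGroup X] [Module A X]
    (Y : Type u) [AddCommGroup Y] [Module A Y] : Prop :=
  Subsingleton (CategoryTheory.Abelian.Ext.{u} (ModuleCat.of A X) (ModuleCat.of A Y) m)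

section EVbasic

variable {A : Type u} [Ring A] {X : Type u} [AddCommGroup X] [Module A X]
  {Y : Type u} [AddCommGroup Y] [Module A Y]

open CategoryTheory Abelian

theorem EV.of_projective (h : Module.Projective A X) {m : ℕ} (hm : 1 ≤ m) : EV A m X Y := by
  obtain ⟨i, rfl⟩ : ∃ i, m = i + 1 := ⟨m - 1, by omega⟩
  have : Projective (ModuleCat.of A X) := (IsProjective.iff_projective (R := A) X).1 h
  exact ⟨fun a b => by rw [Ext.eq_zero_of_projective a, Ext.eq_zero_of_projective b]⟩

theorem EV.of_injective (h : Module.Injective A Y) {m : ℕ} (hm : 1 ≤ m) : EV A m X Y := by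
  obtain ⟨i, rfl⟩ : ∃ i, m = i + 1 := ⟨m - 1, by omega⟩
  have : Injective (ModuleCat.of A Y) := Module.injective_object_of_injective_module A Y
  exact ⟨fun a b => by rw [Ext.eq_zero_of_injective a, Ext.eq_zero_of_injective b]⟩

theorem EV.of_sum {ι : Type*} [Fintype ι] (C : ι → Type u) [∀ i, AddCommGroup (C i)]
    [∀ i, Module A (C i)] (a : ∀ i, X →ₗ[A] C i) (b : ∀ i, C i →ₗ[A] X)
    (hab : ∀ x, ∑ i, b i (a i x) = x) {m : ℕ} (h : ∀ i, EV A m (C i) Y) : EV A m X Y := by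
  have key : ∀ x : Ext.{u} (ModuleCat.of A X) (ModuleCat.of A Y) m, x = 0 := by
    intro x
    have h1 : 𝟙 (ModuleCat.of A X) = ∑ i, (ModuleCat.ofHom (a i) ≫ ModuleCat.ofHom (b i)) := by
      ext y
      have := hab y
      simp only [ModuleCat.hom_sum, LinearMap.sum_apply]
      simpa using this.symm
    have h2 := Ext.mk₀_id_comp x
    rw [h1, Ext.mk₀_sum, Ext.sum_comp] at h2
    rw [← h2]
    refine Finset.sum_eq_zero fun i _ => ?_
    rw [← Ext.mk₀_comp_mk₀_assoc]
    have := h i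
    have : (Ext.mk₀ (ModuleCat.ofHom (b i))).comp x (zero_add m) = 0 := by
      have hi : Subsingleton (Ext.{u} (ModuleCat.of A (C i)) (ModuleCat.of A Y) m) := h i
      exact Subsingleton.elim _ _
    rw [this, Ext.comp_zero]
  exact ⟨fun a b => by rw [key a, key b]⟩

theorem EV.of_retract {Z : Type u} [AddCommGroup Z] [Module A Z] (a : X →ₗ[A] Z)
    (b : Z →ₗ[A] X) (hab : ∀ x, b (a x) = x) {m : ℕ} (h : EV A m Z Y) : EV A m X Y :=
  EV.of_sum (ι := Unit) (fun _ => Z) (fun _ => a) (fun _ => b) (by simpa using hab) (fun _ => h)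

theorem EV.of_equiv {Z : Type u} [AddCommGroup Z] [Module A Z] (e : X ≃ₗ[A] Z)
    {m : ℕ} (h : EV A m Z Y) : EV A m X Y :=
  EV.of_retract e.toLinearMap e.symm.toLinearMap (by simp) h

theorem EV.of_retract_right {Z : Type u} [AddCommGroup Z] [Module A Z] (a : Y →ₗ[A] Z)
    (b : Z →ₗ[A] Y) (hab : ∀ x, b (a x) = x) {m : ℕ} (h : EV A m X Z) : EV A m X Y := by
  have key : ∀ x : Ext.{u} (ModuleCat.of A X) (ModuleCat.of A Y) m, x = 0 := by
    intro x
    have h1 : 𝟙 (ModuleCat.of A Y) = ModuleCat.ofHom a ≫ ModuleCat.ofHom b := by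
      ext y
      simpa using (hab y).symm
    have h2 := Ext.comp_mk₀_id x
    rw [h1, ← Ext.mk₀_comp_mk₀, ← Ext.comp_assoc_of_third_deg_zero] at h2
    have hi : Subsingleton (Ext.{u} (ModuleCat.of A X) (ModuleCat.of A Z) m) := h
    have : x.comp (Ext.mk₀ (ModuleCat.ofHom a)) (add_zero m) = 0 := Subsingleton.elim _ _
    rw [← h2, this, Ext.zero_comp]
  exact ⟨fun a b => by rw [key a, key b]⟩

theorem EV.of_equiv_right {Z : Type u} [AddCommGroup Z] [Module A Z] (e : Y ≃ₗ[A] Z)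
    {m : ℕ} (h : EV A m X Z) : EV A m X Y :=
  EV.of_retract_right e.toLinearMap e.symm.toLinearMap (by simp) h

variable {X₁ X₂ X₃ : Type u} [AddCommGroup X₁] [Module A X₁] [AddCommGroup X₂] [Module A X₂]
  [AddCommGroup X₃] [Module A X₃] {f : X₁ →ₗ[A] X₂} {g : X₂ →ₗ[A] X₃}

theorem ses_shortExact (hf : Function.Injective f) (hg : Function.Surjective g)
    (h : ∀ x, g x = 0 ↔ ∃ y, f y = x) :
    (ShortComplex.mk (ModuleCat.ofHom f) (ModuleCat.ofHom g)
      (by ext x; exact (h _).2 ⟨x, rfl⟩)).ShortExact where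
  exact := by
    rw [ShortComplex.moduleCat_exact_iff]
    intro x hx
    exact (h x).1 hx
  mono_f := (ModuleCat.mono_iff_injective _).2 hf
  epi_g := (ModuleCat.epi_iff_surjective _).2 hg

theorem EV.ses₃ (hf : Function.Injective f) (hg : Function.Surjective g)
    (h : ∀ x, g x = 0 ↔ ∃ y, f y = x) {m : ℕ} (h1 : EV A m X₁ Y) (h2 : EV A (m+1) X₂ Y) :
    EV A (m+1) X₃ Y := by
  have hS := ses_shortExact hf hg h
  have h1' : Subsingleton (Ext.{u} (ModuleCat.of A X₁) (ModuleCat.of A Y) m) := h1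
  have h2' : Subsingleton (Ext.{u} (ModuleCat.of A X₂) (ModuleCat.of A Y) (m+1)) := h2
  have key : ∀ x : Ext.{u} (ModuleCat.of A X₃) (ModuleCat.of A Y) (m+1), x = 0 := by
    intro x
    obtain ⟨y, hy⟩ := Ext.contravariant_sequence_exact₃ hS (ModuleCat.of A Y) x
      (h2'.elim _ _) (n₀ := m) (by omega)
    have : y = 0 := h1'.elim _ _
    rw [← hy, this, Ext.comp_zero]
  exact ⟨fun a b => by rw [key a, key b]⟩

theorem EV.ses₁ (hf : Function.Injective f) (hg : Function.Surjective g)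
    (h : ∀ x, g x = 0 ↔ ∃ y, f y = x) {m : ℕ} (h1 : EV A m X₂ Y) (h2 : EV A (m+1) X₃ Y) :
    EV A m X₁ Y := by
  have hS := ses_shortExact hf hg h
  have h1' : Subsingleton (Ext.{u} (ModuleCat.of A X₂) (ModuleCat.of A Y) m) := h1
  have h2' : Subsingleton (Ext.{u} (ModuleCat.of A X₃) (ModuleCat.of A Y) (m+1)) := h2
  have key : ∀ x : Ext.{u} (ModuleCat.of A X₁) (ModuleCat.of A Y) m, x = 0 := by
    intro x
    obtain ⟨y, hy⟩ := Ext.contravariant_sequence_exact₁ hS (ModuleCat.of A Y) x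
      (n₁ := m + 1) (by omega) (h2'.elim _ _)
    have : y = 0 := h1'.elim _ _
    rw [← hy, this, Ext.comp_zero]
  exact ⟨fun a b => by rw [key a, key b]⟩

theorem EV.ses_one (hf : Function.Injective f) (hg : Function.Surjective g)
    (h : ∀ x, g x = 0 ↔ ∃ y, f y = x) (h1 : ∀ φ : X₁ →ₗ[A] Y, ∃ ψ : X₂ →ₗ[A] Y, ψ ∘ₗ f = φ)
    (h2 : EV A 1 X₂ Y) : EV A 1 X₃ Y := by
  have hS := ses_shortExact hf hg h
  have h2' : Subsingleton (Ext.{u} (ModuleCat.of A X₂) (ModuleCat.of A Y) 1) := h2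
  have key : ∀ x : Ext.{u} (ModuleCat.of A X₃) (ModuleCat.of A Y) 1, x = 0 := by
    intro x
    obtain ⟨y, hy⟩ := Ext.contravariant_sequence_exact₃ hS (ModuleCat.of A Y) x
      (h2'.elim _ _) (n₀ := 0) (by omega)
    obtain ⟨y, rfl⟩ := Ext.addEquiv₀.symm.surjective y
    obtain ⟨ψ, hψ⟩ := h1 y.hom
    have : y = ModuleCat.ofHom f ≫ ModuleCat.ofHom ψ := by
      ext z
      simp [← hψ]
    rw [← hy, this]
    change hS.extClass.comp (Ext.mk₀ _) _ = 0
    rw [← Ext.mk₀_comp_mk₀]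
    exact hS.extClass_comp_assoc _
  exact ⟨fun a b => by rw [key a, key b]⟩

theorem EV.extend_of_one (hf : Function.Injective f) (hg : Function.Surjective g)
    (h : ∀ x, g x = 0 ↔ ∃ y, f y = x) (h1 : EV A 1 X₃ Y) (φ : X₁ →ₗ[A] Y) :
    ∃ ψ : X₂ →ₗ[A] Y, ψ ∘ₗ f = φ := by
  have hS := ses_shortExact hf hg h
  have h1' : Subsingleton (Ext.{u} (ModuleCat.of A X₃) (ModuleCat.of A Y) 1) := h1
  obtain ⟨y, hy⟩ := Ext.contravariant_sequence_exact₁ hS (ModuleCat.of A Y)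
    (Ext.mk₀ (ModuleCat.ofHom φ)) (n₁ := 1) (by omega) (h1'.elim _ _)
  obtain ⟨y, rfl⟩ := Ext.addEquiv₀.symm.surjective y
  refine ⟨y.hom, ?_⟩
  change (Ext.mk₀ _).comp (Ext.mk₀ _) _ = _ at hy
  rw [Ext.mk₀_comp_mk₀] at hy
  have := (Ext.mk₀_bijective _ _).1 hy
  exact congrArg ModuleCat.Hom.hom this

theorem EV.ses_cov (hf : Function.Injective f) (hg : Function.Surjective g)
    (h : ∀ x, g x = 0 ↔ ∃ y, f y = x) {m : ℕ} (h1 : EV A m X X₃) (h2 : EV A (m+1) X X₂) :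
    EV A (m+1) X X₁ := by
  have hS := ses_shortExact hf hg h
  have h1' : Subsingleton (Ext.{u} (ModuleCat.of A X) (ModuleCat.of A X₃) m) := h1
  have h2' : Subsingleton (Ext.{u} (ModuleCat.of A X) (ModuleCat.of A X₂) (m+1)) := h2
  have key : ∀ x : Ext.{u} (ModuleCat.of A X) (ModuleCat.of A X₁) (m+1), x = 0 := by
    intro x
    obtain ⟨y, hy⟩ := Ext.covariant_sequence_exact₁ (ModuleCat.of A X) hS x
      (h2'.elim _ _) (n₀ := m) (by omega)
    have : y = 0 := h1'.elim _ _
    rw [← hy, this, Ext.zero_comp]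
  exact ⟨fun a b => by rw [key a, key b]⟩

theorem EV.ses_cov_one (hf : Function.Injective f) (hg : Function.Surjective g)
    (h : ∀ x, g x = 0 ↔ ∃ y, f y = x) (h1 : ∀ φ : X →ₗ[A] X₃, ∃ ψ : X →ₗ[A] X₂, g ∘ₗ ψ = φ)
    (h2 : EV A 1 X X₂) : EV A 1 X X₁ := by
  have hS := ses_shortExact hf hg h
  have h2' : Subsingleton (Ext.{u} (ModuleCat.of A X) (ModuleCat.of A X₂) 1) := h2
  have key : ∀ x : Ext.{u} (ModuleCat.of A X) (ModuleCat.of A X₁) 1, x = 0 := by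
    intro x
    obtain ⟨y, hy⟩ := Ext.covariant_sequence_exact₁ (ModuleCat.of A X) hS x
      (h2'.elim _ _) (n₀ := 0) (by omega)
    obtain ⟨y, rfl⟩ := Ext.addEquiv₀.symm.surjective y
    obtain ⟨ψ, hψ⟩ := h1 y.hom
    have : y = ModuleCat.ofHom ψ ≫ ModuleCat.ofHom g := by
      ext z
      simp [← hψ]
    rw [← hy, this]
    change (Ext.mk₀ _).comp hS.extClass _ = 0
    rw [← Ext.mk₀_comp_mk₀, Ext.comp_assoc_of_second_deg_zero]
    rw [show (Ext.mk₀ (ModuleCat.ofHom g)).comp hS.extClass (zero_add 1) = 0 from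
      hS.comp_extClass, Ext.comp_zero]
  exact ⟨fun a b => by rw [key a, key b]⟩

end EVbasic


/-! ### Complexes -/

set_option linter.unusedSectionVars false

section Cplx

variable {A : Type u} [Ring A] {Y : Type u} [AddCommGroup Y] [Module A Y]
  (C : ℕ → Type u) [∀ i, AddCommGroup (C i)] [∀ i, Module A (C i)]
  (d : ∀ i, C (i+1) →ₗ[A] C i)

/-- Exactness of `0 → C p → ... → C 0 → 0`. -/
structure IsExC (p : ℕ) : Prop where
  surj : Function.Surjective (d 0)
  ex : ∀ i, i + 1 < p → ∀ x, d i x = 0 ↔ ∃ y, d (i+1) y = x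
  inj : Function.Injective (d (p-1))
  pos : 2 ≤ p

variable {C d} {p : ℕ} (hC : IsExC C d p)
include hC

theorem IsExC.ses (i : ℕ) (hi : i + 1 < p) :
    Function.Injective (LinearMap.range (d (i+1))).subtype ∧
    Function.Surjective (d i).rangeRestrict ∧
    ∀ x, (d i).rangeRestrict x = 0 ↔ ∃ y, (LinearMap.range (d (i+1))).subtype y = x := by
  refine ⟨Subtype.val_injective, (d i).surjective_rangeRestrict, fun x => ?_⟩
  rw [Subtype.ext_iff]
  simp only [LinearMap.codRestrict_apply, ZeroMemClass.coe_zero, LinearMap.rangeRestrict]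
  rw [hC.ex i hi x]
  constructor
  · rintro ⟨y, rfl⟩
    exact ⟨⟨_, y, rfl⟩, rfl⟩
  · rintro ⟨⟨_, y, rfl⟩, rfl⟩
    exact ⟨y, rfl⟩

theorem IsExC.shift (h : ∀ t i, 1 ≤ t → 1 ≤ i → i < p → EV A t (C i) Y) (j : ℕ) (hj : j < p)
    {t : ℕ} (ht : 1 ≤ t) :
    EV A t (LinearMap.range (d j)) Y ↔ EV A (t + j) (LinearMap.range (d 0)) Y := by
  induction j generalizing t with
  | zero => rfl
  | succ j ih =>
    rw [show t + (j+1) = (t+1) + j by omega, ← ih (by omega) (by omega)]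
    obtain ⟨h1, h2, h3⟩ := hC.ses j hj
    constructor
    · intro h4
      exact EV.ses₃ h1 h2 h3 h4 (h _ _ (by omega) (by omega) hj)
    · intro h4
      exact EV.ses₁ h1 h2 h3 (h _ _ (by omega) (by omega) hj) h4

theorem IsExC.zero_equiv {t : ℕ} : EV A t (LinearMap.range (d 0)) Y ↔ EV A t (C 0) Y := by
  have e : LinearMap.range (d 0) ≃ₗ[A] C 0 := LinearEquiv.ofTop _ (LinearMap.range_eq_top.2 hC.surj)
  exact ⟨EV.of_equiv e.symm, EV.of_equiv e⟩

theorem IsExC.lemB (h : ∀ t i, 1 ≤ t → 1 ≤ i → i < p → EV A t (C i) Y) {m : ℕ} (hm : 1 ≤ m) :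
    EV A m (C p) Y ↔ EV A (m + (p - 1)) (C 0) Y := by
  rw [← hC.zero_equiv, ← hC.shift h (p-1) (by have := hC.pos; omega) hm]
  obtain ⟨q, rfl⟩ : ∃ q, p = q + 1 := ⟨p - 1, by have := hC.pos; omega⟩
  have e : C (q+1) ≃ₗ[A] LinearMap.range (d q) := LinearEquiv.ofInjective _ hC.inj
  exact ⟨EV.of_equiv e.symm, EV.of_equiv e⟩

theorem IsExC.lemA (h : ∀ t i, 1 ≤ t → 1 ≤ i → i < p → EV A t (C i) Y) {m : ℕ} (hm : 1 ≤ m)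
    (hmp : m < p)
    (hh : ∀ f : C (m+1) →ₗ[A] Y, (m + 1 < p → f ∘ₗ d (m+1) = 0) → ∃ g : C m →ₗ[A] Y, g ∘ₗ d m = f) :
    EV A m (C 0) Y := by
  obtain ⟨j, rfl⟩ : ∃ j, m = j + 1 := ⟨m - 1, by omega⟩
  rw [← hC.zero_equiv, add_comm, ← hC.shift h j (by omega) le_rfl]
  obtain ⟨h1, h2, h3⟩ := hC.ses j hmp
  refine EV.ses_one h1 h2 h3 (fun φ => ?_) (h _ _ le_rfl (by omega) hmp)
  obtain ⟨g, hg⟩ := hh (φ ∘ₗ (d (j+1)).rangeRestrict) (fun hlt => by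
    ext x
    have : (d (j+1)).rangeRestrict (d (j+1+1) x) = 0 := by
      apply Subtype.ext
      exact (hC.ex (j+1) hlt _).2 ⟨x, rfl⟩
    simp [this])
  refine ⟨g, ?_⟩
  ext ⟨_, y, rfl⟩
  exact LinearMap.congr_fun hg y

end Cplx

/-! ### Duality -/

/-- A `k`-linear anti-involution. -/
class AntiInv (k : Type u) [Field k] (A : Type u) [Ring A] [Algebra k A] where
  s : A →ₗ[k] A
  s_mul : ∀ a b, s (a * b) = s b * s a
  s_one : s 1 = 1
  s_s : ∀ a, s (s a) = a

/-- The contragredient dual. -/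
def Dl (k : Type u) [Field k] (A : Type u) [Ring A] [Algebra k A] (Y : Type u)
    [AddCommGroup Y] [Module A Y] [Module k Y] : Type u := Y →ₗ[k] k

section Dl

variable {k : Type u} [Field k] {A : Type u} [Ring A] [Algebra k A] [AntiInv k A]
  {X : Type u} [AddCommGroup X] [Module A X] [Module k X] [IsScalarTower k A X]
  {Y : Type u} [AddCommGroup Y] [Module A Y] [Module k Y] [IsScalarTower k A Y]

instance : AddCommGroup (Dl k A Y) := inferInstanceAs (AddCommGroup (Y →ₗ[k] k))
instance : Module k (Dl k A Y) := inferInstanceAs (Module k (Y →ₗ[k] k))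

instance : Module A (Dl k A Y) where
  smul a θ := (show Y →ₗ[k] k from θ) ∘ₗ Algebra.lsmul k k Y (AntiInv.s (k := k) a)
  one_smul θ := LinearMap.ext fun y => by
    change θ.toFun (AntiInv.s (k := k) (1 : A) • y) = _
    rw [AntiInv.s_one, one_smul]; rfl
  mul_smul a b θ := LinearMap.ext fun y => by
    change θ.toFun (AntiInv.s (k := k) (a * b) • y) = θ.toFun (AntiInv.s (k := k) b • AntiInv.s (k := k) a • y)
    rw [AntiInv.s_mul, mul_smul]
  smul_zero a := LinearMap.ext fun y => rfl
  smul_add a θ θ' := LinearMap.ext fun y => rfl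
  add_smul a b θ := LinearMap.ext fun y => by
    change θ.toFun (AntiInv.s (k := k) (a + b) • y) =
      θ.toFun (AntiInv.s (k := k) a • y) + θ.toFun (AntiInv.s (k := k) b • y)
    rw [map_add, add_smul]; exact map_add (show Y →ₗ[k] k from θ) _ _
  zero_smul θ := LinearMap.ext fun y => by
    change θ.toFun (AntiInv.s (k := k) (0 : A) • y) = 0
    rw [map_zero, zero_smul]; exact map_zero (show Y →ₗ[k] k from θ)

/-- evaluation -/
def Dl.ev (θ : Dl k A Y) : Y →ₗ[k] k := θ

theorem Dl.ext' {θ θ' : Dl k A Y} (h : ∀ y, θ.ev y = θ'.ev y) : θ = θ' := LinearMap.ext h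

theorem Dl.smul_ev (a : A) (θ : Dl k A Y) (y : Y) :
    (a • θ).ev y = θ.ev (AntiInv.s (k := k) a • y) := rfl

theorem Dl.add_ev (θ θ' : Dl k A Y) (y : Y) : (θ + θ').ev y = θ.ev y + θ'.ev y := rfl

theorem Dl.ksmul_ev (c : k) (θ : Dl k A Y) (y : Y) : (c • θ).ev y = c * θ.ev y := rfl

instance : IsScalarTower k A (Dl k A Y) where
  smul_assoc c a θ := Dl.ext' fun y => by
    rw [Dl.ksmul_ev, Dl.smul_ev, Dl.smul_ev, LinearMap.map_smul, smul_assoc, LinearMap.map_smul, smul_eq_mul]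

theorem linear_k (f : X →ₗ[A] Y) (c : k) (x : X) : f (c • x) = c • f x := by
  rw [← algebraMap_smul A c x, map_smul, algebraMap_smul]

/-- transpose -/
def Dl.map (f : X →ₗ[A] Y) : Dl k A Y →ₗ[A] Dl k A X where
  toFun θ := (θ.ev ∘ₗ ({ f with map_smul' := linear_k f } : X →ₗ[k] Y) : X →ₗ[k] k)
  map_add' _ _ := rfl
  map_smul' a θ := Dl.ext' fun x => by
    change θ.ev (AntiInv.s (k := k) a • f x) = θ.ev (f (AntiInv.s (k := k) a • x))
    rw [LinearMap.map_smul f]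

theorem Dl.map_ev (f : X →ₗ[A] Y) (θ : Dl k A Y) (x : X) : (Dl.map f θ).ev x = θ.ev (f x) := rfl

/-- flip -/
def Dl.flip (f : X →ₗ[A] Dl k A Y) : Y →ₗ[A] Dl k A X where
  toFun y := ({ toFun := fun x => (f x).ev y
                map_add' := fun a b => by rw [map_add]; rfl
                map_smul' := fun c a => by rw [linear_k]; rfl } : X →ₗ[k] k)
  map_add' y y' := Dl.ext' fun x => (f x).ev.map_add y y'
  map_smul' a y := Dl.ext' fun x => by
    change (f x).ev (a • y) = (f (AntiInv.s (k := k) a • x)).ev y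
    rw [LinearMap.map_smul f, Dl.smul_ev, AntiInv.s_s]

theorem Dl.flip_ev (f : X →ₗ[A] Dl k A Y) (y : Y) (x : X) : (Dl.flip f y).ev x = (f x).ev y := rfl

theorem Dl.map_surjective {f : X →ₗ[A] Y} (hf : Function.Injective f) :
    Function.Surjective (Dl.map (k := k) f) := by
  intro θ
  obtain ⟨g, hg⟩ := LinearMap.exists_leftInverse_of_injective
    ({ f with map_smul' := linear_k f } : X →ₗ[k] Y) (LinearMap.ker_eq_bot.2 hf)
  refine ⟨(θ.ev ∘ₗ g : Y →ₗ[k] k), Dl.ext' fun x => ?_⟩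
  exact congrArg θ.ev (LinearMap.congr_fun hg x)

theorem Dl.injective_of_projective (h : Module.Projective A X) : Module.Injective A (Dl k A X) where
  out U V _ _ _ _ f hf g := by
    let : Module k U := Module.compHom U (algebraMap k A)
    let : Module k V := Module.compHom V (algebraMap k A)
    have : IsScalarTower k A U := ⟨fun c a x => by
      rw [Algebra.smul_def, mul_smul]; rfl⟩
    have : IsScalarTower k A V := ⟨fun c a x => by
      rw [Algebra.smul_def, mul_smul]; rfl⟩
    obtain ⟨h1, hh⟩ := Module.projective_lifting_property (Dl.map (k := k) f) (Dl.flip g)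
      (Dl.map_surjective hf)
    refine ⟨Dl.flip h1, fun x => Dl.ext' fun y => ?_⟩
    rw [Dl.flip_ev, ← Dl.map_ev]
    rw [← LinearMap.comp_apply, hh, Dl.flip_ev]

section
variable {X₁ X₂ : Type u} [AddCommGroup X₁] [Module A X₁] [AddCommGroup X₂] [Module A X₂]
  [Module k X₁] [IsScalarTower k A X₁] [Module k X₂] [IsScalarTower k A X₂]
  {f : X₁ →ₗ[A] X₂} {g : X₂ →ₗ[A] X} (hf : Function.Injective f) (hg : Function.Surjective g)
  (hfg : ∀ x, g x = 0 ↔ ∃ y, f y = x)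

include hg in
theorem Dl.map_injective : Function.Injective (Dl.map (k := k) g) := by
  intro θ θ' hh
  refine Dl.ext' fun x => ?_
  obtain ⟨x, rfl⟩ := hg x
  exact congrArg (fun t => Dl.ev t x) hh

include hg hfg in
theorem Dl.map_exact (θ : Dl k A X₂) : Dl.map (k := k) f θ = 0 ↔ ∃ y, Dl.map (k := k) g y = θ := by
  constructor
  · intro hθ
    have h1 : ∀ x, g x = 0 → θ.ev x = 0 := by
      intro x hx
      obtain ⟨y, rfl⟩ := (hfg x).1 hx
      exact congrArg (fun t => Dl.ev t y) hθ
    have h2 : ∀ x y, g x = g y → θ.ev x = θ.ev y := by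
      intro x y hxy
      rw [← sub_eq_zero, ← map_sub]
      exact h1 _ (by rw [map_sub, hxy, sub_self])
    refine ⟨({ toFun := fun x => θ.ev (hg x).choose
               map_add' := fun a b => ?_
               map_smul' := fun c a => ?_ } : X →ₗ[k] k), Dl.ext' fun x => ?_⟩
    · rw [← map_add]
      apply h2
      rw [map_add, (hg a).choose_spec, (hg b).choose_spec, (hg (a+b)).choose_spec]
    · rw [RingHom.id_apply, ← map_smul]
      apply h2
      rw [linear_k, (hg a).choose_spec, (hg (c • a)).choose_spec]
    · exact h2 _ _ (hg (g x)).choose_spec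
  · rintro ⟨η, rfl⟩
    refine Dl.ext' fun x => ?_
    rw [Dl.map_ev, Dl.map_ev, (hfg _).2 ⟨x, rfl⟩, map_zero]
    rfl

include hf hg hfg in
theorem EV.dual_one (hP : Module.Projective A X₂) (h : EV A 1 X (Dl k A Y)) :
    EV A 1 Y (Dl k A X) := by
  refine EV.ses_cov_one (Dl.map_injective (k := k) hg) (Dl.map_surjective (k := k) hf)
    (Dl.map_exact (k := k) hg hfg) ?_ (EV.of_injective (Dl.injective_of_projective hP) le_rfl)
  intro φ
  obtain ⟨ψ, hψ⟩ := EV.extend_of_one hf hg hfg h (Dl.flip φ)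
  refine ⟨Dl.flip ψ, LinearMap.ext fun y => Dl.ext' fun x => ?_⟩
  rw [LinearMap.comp_apply, Dl.map_ev, Dl.flip_ev, ← LinearMap.comp_apply, hψ, Dl.flip_ev]

include hf hg hfg in
theorem EV.dual_succ (hP : Module.Projective A X₂) {i : ℕ}
    (h : EV A i Y (Dl k A X₁)) : EV A (i+1) Y (Dl k A X) :=
  EV.ses_cov (Dl.map_injective (k := k) hg) (Dl.map_surjective (k := k) hf)
    (Dl.map_exact (k := k) hg hfg) h
    (EV.of_injective (Dl.injective_of_projective hP) (by omega))

end

theorem EV.dual {m : ℕ} (hm : 1 ≤ m) (h : EV A m X (Dl k A Y)) : EV A m Y (Dl k A X) := by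
  obtain ⟨i, rfl⟩ : ∃ i, m = i + 1 := ⟨m - 1, by omega⟩
  clear hm
  induction i generalizing X with
  | zero =>
    have hg := Finsupp.linearCombination_id_surjective A X
    have hf : Function.Injective (LinearMap.ker (Finsupp.linearCombination A (id : X → X))).subtype :=
      Subtype.val_injective
    have hfg : ∀ x, (Finsupp.linearCombination A (id : X → X)) x = 0 ↔
      ∃ y, (LinearMap.ker (Finsupp.linearCombination A (id : X → X))).subtype y = x := fun x =>
      ⟨fun h => ⟨⟨x, h⟩, rfl⟩, by rintro ⟨y, rfl⟩; exact y.2⟩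
    exact EV.dual_one (X₁ := LinearMap.ker (Finsupp.linearCombination A (id : X → X))) hf hg hfg inferInstance h
  | succ i ih =>
    have hg := Finsupp.linearCombination_id_surjective A X
    have hf : Function.Injective (LinearMap.ker (Finsupp.linearCombination A (id : X → X))).subtype :=
      Subtype.val_injective
    have hfg : ∀ x, (Finsupp.linearCombination A (id : X → X)) x = 0 ↔
      ∃ y, (LinearMap.ker (Finsupp.linearCombination A (id : X → X))).subtype y = x := fun x =>
      ⟨fun h => ⟨⟨x, h⟩, rfl⟩, by rintro ⟨y, rfl⟩; exact y.2⟩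
    have h1 := EV.ses₁ (X₁ := LinearMap.ker (Finsupp.linearCombination A (id : X → X))) hf hg hfg (EV.of_projective inferInstance (by omega)) h
    exact EV.dual_succ (X₁ := LinearMap.ker (Finsupp.linearCombination A (id : X → X))) hf hg hfg inferInstance (ih h1)

theorem EV.dual_iff {m : ℕ} (hm : 1 ≤ m) : EV A m X (Dl k A Y) ↔ EV A m Y (Dl k A X) :=
  ⟨EV.dual hm, EV.dual hm⟩

end Dl


/-! ### The algebra and cyclic modules -/

set_option linter.unusedSectionVars false
section Lam

variable {k : Type u} [Field k] {n d : ℕ}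

/-- quotient map -/
noncomputable def lmk (k : Type u) [Field k] (n d : ℕ) :
    SymGroupAlgebra k d →ₐ[k] LambdaAlgebra k n d :=
  { RingCon.mk' (annihilatorCon k n d) with
    commutes' := fun _ => rfl }

/-- image of a permutation in the quotient algebra -/
noncomputable def gg (k : Type u) [Field k] (n d : ℕ) :
    Equiv.Perm (Fin d) →* LambdaAlgebra k n d :=
  ((lmk k n d : _ →ₐ[k] _) : _ →* _).comp (MonoidAlgebra.of k (Equiv.Perm (Fin d)))

theorem lmk_surjective : Function.Surjective (lmk k n d) := Quotient.exists_rep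

theorem lmk_smul (r : SymGroupAlgebra k d) (m : TensorSpace k n d) : lmk k n d r • m = r • m := rfl

theorem lmk_single (g : Equiv.Perm (Fin d)) (c : k) :
    lmk k n d (MonoidAlgebra.single g c) = c • gg k n d g := by
  rw [show (MonoidAlgebra.single g c : SymGroupAlgebra k d) = c • MonoidAlgebra.of k _ g by
    simp [MonoidAlgebra.of_apply], map_smul]
  rfl

instance : IsScalarTower k (LambdaAlgebra k n d) (TensorSpace k n d) where
  smul_assoc c a m := by
    obtain ⟨r, rfl⟩ := lmk_surjective a
    rw [← map_smul, lmk_smul, lmk_smul, tensorSpace_smul_def, tensorSpace_smul_def, map_smul]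
    rfl

theorem gg_smul_apply (g : Equiv.Perm (Fin d)) (m : TensorSpace k n d) (v : Fin d → Fin n) :
    (gg k n d g • m) v = m (v ∘ g) := by
  have : gg k n d g • m = (MonoidAlgebra.of k _ g : SymGroupAlgebra k d) • m := rfl
  rw [this, tensorSpace_smul_def, Representation.asAlgebraHom_of]
  rfl

theorem ts_add (m m' : TensorSpace k n d) (v : Fin d → Fin n) : (m + m') v = m v + m' v := rfl
theorem ts_sub (m m' : TensorSpace k n d) (v : Fin d → Fin n) : (m - m') v = m v - m' v := rfl
theorem ts_neg (m : TensorSpace k n d) (v : Fin d → Fin n) : (-m) v = -m v := rfl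
theorem ts_zero (v : Fin d → Fin n) : (0 : TensorSpace k n d) v = 0 := rfl
theorem ts_smul (c : k) (m : TensorSpace k n d) (v : Fin d → Fin n) : (c • m) v = c * m v := rfl
theorem ts_sum {ι : Type*} (s : Finset ι) (f : ι → TensorSpace k n d) (v : Fin d → Fin n) :
    (∑ i ∈ s, f i) v = ∑ i ∈ s, f i v := Finset.sum_apply v s f
theorem ts_ext {m m' : TensorSpace k n d} (h : ∀ v, m v = m' v) : m = m' := funext h

theorem lam_ext {a b : LambdaAlgebra k n d} (h : ∀ m : TensorSpace k n d, a • m = b • m) :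
    a = b := by
  obtain ⟨r, rfl⟩ := lmk_surjective a
  obtain ⟨s, rfl⟩ := lmk_surjective b
  exact Quotient.sound h

theorem lam_span : Submodule.span k (Set.range (gg k n d)) = ⊤ := by
  rw [eq_top_iff]
  rintro a -
  obtain ⟨r, rfl⟩ := lmk_surjective a
  induction r using MonoidAlgebra.induction_linear with
  | zero => rw [map_zero]; exact Submodule.zero_mem _
  | add f g hf hg => rw [map_add]; exact Submodule.add_mem _ hf hg
  | single g c =>
    rw [lmk_single]
    exact Submodule.smul_mem _ _ (Submodule.subset_span ⟨g, rfl⟩)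

theorem lam_induction {P : LambdaAlgebra k n d → Prop} (a : LambdaAlgebra k n d)
    (hg : ∀ g, P (gg k n d g)) (h0 : P 0) (hadd : ∀ a b, P a → P b → P (a + b))
    (hs : ∀ (c : k) a, P a → P (c • a)) : P a := by
  have : a ∈ Submodule.span k (Set.range (gg k n d)) := by rw [lam_span]; trivial
  induction this using Submodule.span_induction with
  | mem x hx => obtain ⟨g, rfl⟩ := hx; exact hg g
  | zero => exact h0
  | add x y _ _ hx hy => exact hadd _ _ hx hy
  | smul c x _ hx => exact hs _ _ hx

/-- the bilinear form -/
def bform (f g : TensorSpace k n d) : k := ∑ v, f v * g v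

theorem bform_add_left (f f' g : TensorSpace k n d) : bform (f + f') g = bform f g + bform f' g := by
  simp [bform, ts_add, add_mul, Finset.sum_add_distrib]
theorem bform_smul_left (c : k) (f g : TensorSpace k n d) : bform (c • f) g = c * bform f g := by
  simp [bform, ts_smul, Finset.mul_sum, mul_assoc]
theorem bform_comm (f g : TensorSpace k n d) : bform f g = bform g f := by
  simp [bform, mul_comm]
theorem bform_add_right (f g g' : TensorSpace k n d) : bform f (g + g') = bform f g + bform f g' := by
  rw [bform_comm, bform_add_left, bform_comm g, bform_comm g']
theorem bform_smul_right (c : k) (f g : TensorSpace k n d) : bform f (c • g) = c * bform f g := by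
  rw [bform_comm, bform_smul_left, bform_comm]
theorem bform_zero_left (g : TensorSpace k n d) : bform 0 g = 0 := by simp [bform, ts_zero]
theorem bform_single (v : Fin d → Fin n) (g : TensorSpace k n d) :
    bform (Pi.single v 1 : (Fin d → Fin n) → k) g = g v := by
  classical
  unfold bform
  rw [Finset.sum_eq_single v]
  · simp
  · intro b _ hb; simp [hb]
  · simp
theorem bform_gg (σ : Equiv.Perm (Fin d)) (f g : TensorSpace k n d) :
    bform (gg k n d σ • f) g = bform f (gg k n d σ⁻¹ • g) := by
  unfold bform
  refine Fintype.sum_equiv (Equiv.arrowCongr σ.symm (Equiv.refl _)) _ _ fun v => ?_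
  have h1 : Equiv.arrowCongr σ.symm (Equiv.refl (Fin n)) v = v ∘ σ := by
    ext x; simp [Equiv.arrowCongr]
  rw [h1, gg_smul_apply, gg_smul_apply]
  congr 2
  ext x; simp

/-- inversion on the group algebra -/
noncomputable def sinv (k : Type u) [Field k] (d : ℕ) : SymGroupAlgebra k d →ₗ[k] SymGroupAlgebra k d :=
  (MulOpposite.opLinearEquiv k).symm.toLinearMap ∘ₗ
    (MonoidAlgebra.lift k (SymGroupAlgebra k d)ᵐᵒᵖ (Equiv.Perm (Fin d))
      { toFun := fun g => MulOpposite.op (MonoidAlgebra.of k _ g⁻¹)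
        map_one' := by simp; rfl
        map_mul' := fun a b => by rw [mul_inv_rev, map_mul, MulOpposite.op_mul] }).toLinearMap

theorem sinv_single (g : Equiv.Perm (Fin d)) (c : k) :
    sinv k d (MonoidAlgebra.single g c) = MonoidAlgebra.single g⁻¹ c :=
  by
  simp [sinv, MonoidAlgebra.lift_single]

theorem bform_sinv (r : SymGroupAlgebra k d) (f g : TensorSpace k n d) :
    bform (lmk k n d r • f) g = bform f (lmk k n d (sinv k d r) • g) := by
  induction r using MonoidAlgebra.induction_linear with
  | zero =>
    rw [map_zero, map_zero, map_zero, zero_smul, zero_smul, bform_zero_left, bform_comm, bform_zero_left]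
  | add x y hx hy =>
    rw [map_add, map_add, map_add, add_smul, add_smul, bform_add_left, bform_add_right, hx, hy]
  | single σ c =>
    rw [sinv_single, lmk_single, lmk_single, smul_assoc, smul_assoc, bform_smul_left,
      bform_smul_right, bform_gg]

theorem bform_ext {f f' : TensorSpace k n d} (h : ∀ g, bform g f = bform g f') : f = f' :=
  ts_ext fun v => by
    have := h (Pi.single v 1 : (Fin d → Fin n) → k)
    rwa [bform_single, bform_single] at this

/-- The anti-involution on `Λ`. -/
noncomputable def lstar (k : Type u) [Field k] (n d : ℕ) : LambdaAlgebra k n d →ₗ[k] LambdaAlgebra k n d where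
  toFun a := Quotient.liftOn a (fun r => lmk k n d (sinv k d r)) (fun r r' h => lam_ext fun m =>
    bform_ext fun f => by
      rw [← bform_sinv, ← bform_sinv]
      exact congrArg (fun t => bform t m) (h f))
  map_add' a b := by
    obtain ⟨r, rfl⟩ := lmk_surjective a
    obtain ⟨s, rfl⟩ := lmk_surjective b
    change lmk k n d (sinv k d (r + s)) = _
    rw [map_add, map_add]; rfl
  map_smul' c a := by
    obtain ⟨r, rfl⟩ := lmk_surjective a
    rw [← map_smul]
    change lmk k n d (sinv k d (c • r)) = c • lmk k n d (sinv k d r)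
    rw [map_smul, map_smul]

theorem bform_lstar (a : LambdaAlgebra k n d) (f g : TensorSpace k n d) :
    bform (a • f) g = bform f (lstar k n d a • g) := by
  obtain ⟨r, rfl⟩ := lmk_surjective a
  exact bform_sinv r f g

theorem lstar_gg (g : Equiv.Perm (Fin d)) : lstar k n d (gg k n d g) = gg k n d g⁻¹ := by
  have : gg k n d g = lmk k n d (MonoidAlgebra.single g 1) := by rw [lmk_single, one_smul]
  rw [this]
  change lmk k n d (sinv k d (MonoidAlgebra.single g 1)) = _
  rw [sinv_single, lmk_single, one_smul]

noncomputable instance : AntiInv k (LambdaAlgebra k n d) where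
  s := lstar k n d
  s_mul a b := lam_ext fun m => bform_ext fun f => by
    rw [← bform_lstar, mul_smul, bform_lstar, bform_lstar, mul_smul]
  s_one := by rw [← map_one (gg k n d), lstar_gg, inv_one]
  s_s a := lam_ext fun m => bform_ext fun f => by
    rw [← bform_lstar, bform_comm, ← bform_lstar, bform_comm]

theorem s_gg (g : Equiv.Perm (Fin d)) :
    (AntiInv.s (k := k) (gg k n d g) : LambdaAlgebra k n d) = gg k n d g⁻¹ := lstar_gg g

/-- The form as a map to the dual. -/
noncomputable def tsDualMap (k : Type u) [Field k] (n d : ℕ) :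
    TensorSpace k n d →ₗ[LambdaAlgebra k n d] Dl k (LambdaAlgebra k n d) (TensorSpace k n d) where
  toFun f := ({ toFun := fun g => bform f g
                map_add' := fun a b => bform_add_right f a b
                map_smul' := fun c a => bform_smul_right c f a } : TensorSpace k n d →ₗ[k] k)
  map_add' f f' := Dl.ext' fun g => bform_add_left f f' g
  map_smul' a f := Dl.ext' fun g => bform_lstar a f g

/-- Self-duality of tensor space. -/
noncomputable def tsDual (k : Type u) [Field k] (n d : ℕ) :
    TensorSpace k n d ≃ₗ[LambdaAlgebra k n d] Dl k (LambdaAlgebra k n d) (TensorSpace k n d) :=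
  LinearEquiv.ofBijective (tsDualMap k n d)
    ⟨fun f f' h => bform_ext fun g => by
      rw [bform_comm, bform_comm g]
      exact congrArg (fun t => Dl.ev t g) h,
    fun θ => by
      classical
      refine ⟨fun v => θ.ev (Pi.single v 1 : (Fin d → Fin n) → k), ?_⟩
      refine LinearMap.pi_ext' (M := k) (R := k) (φ := fun _ : Fin d → Fin n => k) (f := ?_) (g := θ) fun v => LinearMap.ext_ring ?_
      exact (bform_comm _ _).trans (bform_single v _)⟩

/-! cyclic modules -/

/-- The annihilator of a subspace, a left ideal. -/
def annI (X : Submodule k (TensorSpace k n d)) :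
    Submodule (LambdaAlgebra k n d) (LambdaAlgebra k n d) where
  carrier := {a | ∀ m ∈ X, a • m = 0}
  add_mem' ha hb m hm := by rw [add_smul, ha m hm, hb m hm, add_zero]
  zero_mem' m _ := zero_smul _ m
  smul_mem' c a ha m hm := by rw [smul_eq_mul, mul_smul, ha m hm, smul_zero]

/-- The cyclic module attached to a subspace. -/
abbrev CC (X : Submodule k (TensorSpace k n d)) : Type u := LambdaAlgebra k n d ⧸ annI X

variable {X X' X'' : Submodule k (TensorSpace k n d)}

/-- class of an element -/
noncomputable def CC.mk (X : Submodule k (TensorSpace k n d)) : LambdaAlgebra k n d →ₗ[LambdaAlgebra k n d] CC X :=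
  (annI X).mkQ

theorem CC.mk_surj : Function.Surjective (CC.mk X) := Submodule.mkQ_surjective _

theorem CC.mk_eq {a b : LambdaAlgebra k n d} : CC.mk X a = CC.mk X b ↔ ∀ m ∈ X, a • m = b • m := by
  refine (Submodule.Quotient.eq (annI X)).trans ?_
  change (∀ m ∈ X, (a - b) • m = 0) ↔ _
  simp only [sub_smul, sub_eq_zero]

theorem CC.mk_eq_zero {a : LambdaAlgebra k n d} : CC.mk X a = 0 ↔ ∀ m ∈ X, a • m = 0 := by
  rw [← map_zero (CC.mk X), CC.mk_eq]
  simp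

theorem CC.mk_smul_one (a : LambdaAlgebra k n d) : CC.mk X a = a • CC.mk X 1 := by
  rw [← map_smul, smul_eq_mul, mul_one]

theorem CC.mk_ksmul (c : k) (a : LambdaAlgebra k n d) : CC.mk X (c • a) = c • CC.mk X a := rfl

theorem CC.hom_ext {Y : Type*} [AddCommGroup Y] [Module (LambdaAlgebra k n d) Y]
    {f g : CC X →ₗ[LambdaAlgebra k n d] Y} (h : f (CC.mk X 1) = g (CC.mk X 1)) : f = g := by
  refine LinearMap.ext fun x => ?_
  obtain ⟨a, rfl⟩ := CC.mk_surj x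
  rw [CC.mk_smul_one, map_smul, map_smul, h]

/-- right multiplication -/
noncomputable def CC.rmul (q : LambdaAlgebra k n d) (h : ∀ m ∈ X', q • m ∈ X) :
    CC X →ₗ[LambdaAlgebra k n d] CC X' :=
  (annI X).liftQ ((CC.mk X') ∘ₗ LinearMap.toSpanSingleton _ _ q) (fun a ha => by
    rw [LinearMap.mem_ker]
    change CC.mk X' (a * q) = 0
    rw [CC.mk_eq_zero]
    intro m hm
    rw [mul_smul]
    exact ha _ (h m hm))

theorem CC.rmul_mk (q : LambdaAlgebra k n d) (h : ∀ m ∈ X', q • m ∈ X) (a : LambdaAlgebra k n d) :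
    CC.rmul q h (CC.mk X a) = CC.mk X' (a * q) := rfl

/-- maps to tensor space -/
noncomputable def CC.toM (m : TensorSpace k n d) (hm : m ∈ X) :
    CC X →ₗ[LambdaAlgebra k n d] TensorSpace k n d :=
  (annI X).liftQ (LinearMap.toSpanSingleton _ _ m) (fun _ ha => ha m hm)

theorem CC.toM_mk (m : TensorSpace k n d) (hm : m ∈ X) (a : LambdaAlgebra k n d) :
    CC.toM m hm (CC.mk X a) = a • m := rfl

theorem CC.retract (q : LambdaAlgebra k n d) (hX : X ≤ X') (h : ∀ m ∈ X', q • m ∈ X)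
    (h1 : ∀ m ∈ X, q • m = m) (x : CC X) :
    CC.rmul (X := X') (X' := X) 1 (fun m hm => by rw [one_smul]; exact hX hm)
      (CC.rmul (X := X) (X' := X') q h x) = x := by
  obtain ⟨a, rfl⟩ := CC.mk_surj x
  rw [CC.rmul_mk, CC.rmul_mk, CC.mk_eq]
  intro m hm
  rw [mul_one, mul_smul, h1 m hm]

theorem CC.EV_of_retract {Y : Type u} [AddCommGroup Y] [Module (LambdaAlgebra k n d) Y] {t : ℕ}
    (q : LambdaAlgebra k n d) (hX : X ≤ X') (h : ∀ m ∈ X', q • m ∈ X)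
    (h1 : ∀ m ∈ X, q • m = m) (he : EV (LambdaAlgebra k n d) t (CC X') Y) :
    EV (LambdaAlgebra k n d) t (CC X) Y :=
  EV.of_retract _ _ (CC.retract q hX h h1) he

theorem CC.projective_top : Module.Projective (LambdaAlgebra k n d)
    (CC (⊤ : Submodule k (TensorSpace k n d))) := by
  have h : annI (⊤ : Submodule k (TensorSpace k n d)) = ⊥ := by
    rw [eq_bot_iff]
    intro a ha
    rw [Submodule.mem_bot]
    exact lam_ext fun m => by rw [ha m trivial, zero_smul]
  exact Module.Projective.of_equiv (Submodule.quotEquivOfEqBot _ h).symm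

theorem CC.EV_of_proj {Y : Type u} [AddCommGroup Y] [Module (LambdaAlgebra k n d) Y] {t : ℕ}
    (ht : 1 ≤ t) (q : LambdaAlgebra k n d) (h : ∀ m, q • m ∈ X)
    (h1 : ∀ m ∈ X, q • m = m) : EV (LambdaAlgebra k n d) t (CC X) Y :=
  CC.EV_of_retract q le_top (fun m _ => h m) h1 (EV.of_projective CC.projective_top ht)

end Lam


/-! ### Labels -/

set_option linter.unusedSectionVars false
section Labels

variable {k : Type u} [Field k] {n d : ℕ}

/-- odd letters -/
def isOdd (l : ℕ) : Prop := l = 0 ∨ l = 2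

instance (l : ℕ) : Decidable (isOdd l) := inferInstanceAs (Decidable (l = 0 ∨ l = 2))

/-- sign as a scalar -/
def sg (k : Type u) [Field k] : ℤˣ →* k :=
  ((Int.castRingHom k : ℤ →+* k) : ℤ →* k).comp (Units.coeHom ℤ)

theorem sg_neg_one : sg k (-1) = -1 := by simp [sg]
theorem sg_sq (e : ℤˣ) : sg k e * sg k e = 1 := by
  rw [← map_mul, Int.units_mul_self, map_one]
theorem sg_ne (e : ℤˣ) : sg k e ≠ 0 := fun h => by
  have := sg_sq (k := k) e
  rw [h, zero_mul] at this
  exact zero_ne_one this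

/-- character -/
def chi (l : ℕ) : ℤˣ := if isOdd l then -1 else 1

/-- the subspace attached to a label -/
def XL (k : Type u) [Field k] (n : ℕ) {d : ℕ} (L : Fin d → ℕ) : Submodule k (TensorSpace k n d) where
  carrier := {m | ∀ a b, a ≠ b → L a = L b → gg k n d (Equiv.swap a b) • m = sg k (chi (L a)) • m}
  add_mem' h1 h2 a b hab hL := by rw [smul_add, smul_add, h1 a b hab hL, h2 a b hab hL]
  zero_mem' a b _ _ := by rw [smul_zero, smul_zero]
  smul_mem' c m h a b hab hL := by
    rw [smul_comm _ c m, h a b hab hL, smul_comm]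

theorem mem_XL_iff {L : Fin d → ℕ} {m : TensorSpace k n d} : m ∈ XL k n L ↔
    ∀ a b, a ≠ b → L a = L b → gg k n d (Equiv.swap a b) • m = sg k (chi (L a)) • m := Iff.rfl

/-- sign of the odd part -/
noncomputable def eps (L : Fin d → ℕ) (κ : Equiv.Perm (Fin d)) : ℤˣ :=
  if h : ∀ x, isOdd (L (κ x)) ↔ isOdd (L x) then Equiv.Perm.sign (κ.subtypePerm (p := fun x => isOdd (L x)) h) else 1

theorem eps_eq {L : Fin d → ℕ} {κ : Equiv.Perm (Fin d)} (h : ∀ x, isOdd (L (κ x)) ↔ isOdd (L x)) :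
    eps L κ = Equiv.Perm.sign (κ.subtypePerm (p := fun x => isOdd (L x)) h) := dif_pos h

theorem keepL {L : Fin d → ℕ} {κ : Equiv.Perm (Fin d)} (h : L ∘ κ = L) :
    ∀ x, isOdd (L (κ x)) ↔ isOdd (L x) := fun x => by
  rw [show L (κ x) = L x from congrFun h x]

theorem keepL_mul {L : Fin d → ℕ} {κ κ' : Equiv.Perm (Fin d)} (h : L ∘ κ = L) (h' : L ∘ κ' = L) :
    L ∘ ⇑(κ * κ') = L := by
  rw [Equiv.Perm.coe_mul, ← Function.comp_assoc, h, h']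

theorem keepL_inv {L : Fin d → ℕ} {κ : Equiv.Perm (Fin d)} (h : L ∘ κ = L) :
    L ∘ ⇑κ⁻¹ = L := by
  conv_lhs => rw [← h]
  ext x; simp

theorem eps_mul {L : Fin d → ℕ} {κ κ' : Equiv.Perm (Fin d)} (h : L ∘ κ = L) (h' : L ∘ κ' = L) :
    eps L (κ * κ') = eps L κ * eps L κ' := by
  rw [eps_eq (keepL h), eps_eq (keepL h'), eps_eq (keepL (keepL_mul h h')), ← map_mul,
    Equiv.Perm.subtypePerm_mul]

theorem eps_one (L : Fin d → ℕ) : eps L 1 = 1 := by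
  rw [eps_eq (fun x => Iff.rfl)]
  simp

theorem eps_inv {L : Fin d → ℕ} {κ : Equiv.Perm (Fin d)} (h : L ∘ κ = L) :
    eps L κ⁻¹ = eps L κ := by
  have := eps_mul (keepL_inv h) h
  rw [inv_mul_cancel, eps_one] at this
  rw [← mul_one (eps L κ), this, mul_comm, mul_assoc, Int.units_mul_self, mul_one]

theorem eps_of_fix {L : Fin d → ℕ} {κ : Equiv.Perm (Fin d)} (h : L ∘ κ = L)
    (h' : ∀ x, κ x ≠ x → isOdd (L x)) : eps L κ = Equiv.Perm.sign κ := by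
  rw [eps_eq (keepL h), Equiv.Perm.sign_subtypePerm _ _ h']

theorem eps_of_fix_odd {L : Fin d → ℕ} {κ : Equiv.Perm (Fin d)}
    (h' : ∀ x, isOdd (L x) → κ x = x) (h : L ∘ κ = L) : eps L κ = 1 := by
  rw [eps_eq (keepL h)]
  have : κ.subtypePerm (p := fun x => isOdd (L x)) (keepL h) = 1 := by
    ext ⟨x, hx⟩
    simp [h' x hx]
  rw [this, map_one]

theorem keepL_swap {L : Fin d → ℕ} {a b : Fin d} (h : L a = L b) : L ∘ ⇑(Equiv.swap a b) = L := by
  ext x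
  rw [Function.comp_apply, Equiv.swap_apply_def]
  split_ifs with h1 h2
  · rw [h1, h]
  · rw [h2, h]
  · rfl

theorem eps_swap {L : Fin d → ℕ} {a b : Fin d} (hab : a ≠ b) (h : L a = L b) :
    eps L (Equiv.swap a b) = chi (L a) := by
  unfold chi
  split_ifs with ho
  · rw [eps_of_fix (keepL_swap h), Equiv.Perm.sign_swap hab]
    intro x hx
    by_cases h1 : x = a
    · rwa [h1]
    by_cases h2 : x = b
    · rwa [h2, ← h]
    exact absurd (Equiv.swap_apply_of_ne_of_ne h1 h2) hx
  · refine eps_of_fix_odd (fun x hx => Equiv.swap_apply_of_ne_of_ne ?_ ?_) (keepL_swap h)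
    · rintro rfl; exact ho hx
    · rintro rfl; exact ho (h ▸ hx)

theorem lemG {L : Fin d → ℕ} {κ : Equiv.Perm (Fin d)} (h : L ∘ κ = L) {m : TensorSpace k n d}
    (hm : m ∈ XL k n L) : gg k n d κ • m = sg k (eps L κ) • m := by
  let S : Set (Equiv.Perm (Fin d)) := {σ | ∃ a b, a ≠ b ∧ L a = L b ∧ σ = Equiv.swap a b}
  have hS : ∀ f ∈ S, f.IsSwap := by
    rintro f ⟨a, b, hab, -, rfl⟩; exact ⟨a, b, hab, rfl⟩
  have hκ : κ ∈ Subgroup.closure S := by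
    rw [mem_closure_isSwap hS]
    refine ⟨Set.toFinite _, fun x => ?_⟩
    by_cases hx : x = κ x
    · rw [← hx]; exact MulAction.mem_orbit_self x
    · exact ⟨⟨Equiv.swap x (κ x), Subgroup.subset_closure ⟨x, κ x, hx, (congrFun h x).symm, rfl⟩⟩,
        Equiv.swap_apply_left x (κ x)⟩
  have key : ∀ σ ∈ Subgroup.closure S, L ∘ σ = L ∧ gg k n d σ • m = sg k (eps L σ) • m := by
    intro σ hσ
    induction hσ using Subgroup.closure_induction with
    | mem σ hσ =>
      obtain ⟨a, b, hab, hL, rfl⟩ := hσ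
      exact ⟨keepL_swap hL, by rw [eps_swap hab hL]; exact hm a b hab hL⟩
    | one => exact ⟨rfl, by rw [map_one, eps_one, map_one, one_smul, one_smul]⟩
    | mul x y _ _ hx hy =>
      refine ⟨keepL_mul hx.1 hy.1, ?_⟩
      rw [map_mul, mul_smul, hy.2, smul_comm, hx.2, eps_mul hx.1 hy.1, map_mul, smul_smul, mul_comm]
    | inv x _ hx =>
      refine ⟨keepL_inv hx.1, ?_⟩
      have h2 := congrArg (fun t => gg k n d x⁻¹ • t) hx.2
      beta_reduce at h2
      rw [← mul_smul, ← map_mul, inv_mul_cancel, map_one, one_smul, smul_comm] at h2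
      rw [eps_inv hx.1]
      conv_rhs => rw [h2, smul_smul, sg_sq, one_smul]
  exact (key κ hκ).2

theorem mem_XL_of_keep {L : Fin d → ℕ} {m : TensorSpace k n d}
    (h : ∀ κ : Equiv.Perm (Fin d), L ∘ κ = L → gg k n d κ • m = sg k (eps L κ) • m) :
    m ∈ XL k n L := fun a b hab hL => by
  rw [h _ (keepL_swap hL), eps_swap hab hL]

/-- two permutations with the same word agree up to sign -/
theorem same_word {L : Fin d → ℕ} {g g' : Equiv.Perm (Fin d)} (h : L ∘ ⇑g⁻¹ = L ∘ ⇑g'⁻¹)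
    {m : TensorSpace k n d} (hm : m ∈ XL k n L) :
    gg k n d g • m = sg k (eps L (g'⁻¹ * g)) • gg k n d g' • m := by
  have hk : L ∘ ⇑(g'⁻¹ * g) = L := by
    rw [Equiv.Perm.coe_mul, ← Function.comp_assoc, ← h]
    ext x; simp
  rw [smul_comm, ← lemG hk hm, ← mul_smul, ← map_mul, mul_inv_cancel_left]

/-- hom from cyclic module to tensor space -/
theorem CC.hom_mem {L : Fin d → ℕ} (f : CC (XL k n L) →ₗ[LambdaAlgebra k n d] TensorSpace k n d) :
    f (CC.mk _ 1) ∈ XL k n L := by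
  intro a b hab hL
  rw [← map_smul, ← linear_k f, ← CC.mk_smul_one, ← CC.mk_ksmul]
  congr 1
  rw [CC.mk_eq]
  intro m hm
  rw [hm a b hab hL, smul_assoc, one_smul]

/-! standard words -/

/-- compatible pairs of columns with respect to a word -/
def okc (u : Fin d → ℕ) (j j' : Fin d) : Prop := u j < u j' ∨ (u j = u j' ∧ ¬ isOdd (u j))

/-- `c` is a standard coloring -/
def StdC (u : Fin d → ℕ) (c : Fin d → Fin n) : Prop := ∀ j j', j < j' → c j = c j' → okc u j j'

theorem lexcmp {γ : Type*} {u : Fin d → ℕ} {τ : Equiv.Perm (Fin d)} {cls : Fin d → γ}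
    (hc : cls ∘ τ = cls) (j : Fin d) (h1 : ∀ i, i < j → u (τ i) = u i)
    (h2 : ∀ i, cls i = cls j → u i = u (τ j) → i < j) : False := by
  classical
  let N : Finset (Fin d) := Finset.univ.filter fun i => cls i = cls j ∧ u i = u (τ j)
  have hcj : ∀ i, cls (τ i) = cls i := fun i => congrFun hc i
  have hN : N.image τ ⊆ N := by
    intro x hx
    obtain ⟨i, hi, rfl⟩ := Finset.mem_image.1 hx
    simp only [N, Finset.mem_filter, Finset.mem_univ, true_and] at hi ⊢
    exact ⟨(hcj i).trans hi.1, by rw [h1 i (h2 i hi.1 hi.2), hi.2]⟩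
  have hN' : N.image τ = N := Finset.eq_of_subset_of_card_le hN
    (by rw [Finset.card_image_of_injective _ τ.injective])
  have : τ j ∈ N.image τ := by rw [hN']; simp [N, hcj]
  obtain ⟨i, hi, hij⟩ := Finset.mem_image.1 this
  have := τ.injective hij
  subst this
  simp only [N, Finset.mem_filter, Finset.mem_univ, true_and] at hi
  exact lt_irrefl _ (h2 i rfl hi)

theorem lex_le_of_std {u : Fin d → ℕ} {c : Fin d → Fin n} (hu : StdC u c)
    {τ : Equiv.Perm (Fin d)} (hc : c ∘ τ = c) : toLex u ≤ toLex (u ∘ τ) := by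
  by_contra hlt
  rw [not_le] at hlt
  obtain ⟨j, h1, h2⟩ := hlt
  refine lexcmp hc j (fun i hi => h1 i hi) (fun i hi hi' => ?_)
  change u (τ j) < u j at h2
  by_contra hij
  rcases lt_or_eq_of_le (not_lt.1 hij) with h | h
  · rcases hu j i h hi.symm with h3 | h3 <;> omega
  · subst h; omega

/-- test vector -/
noncomputable def testV (k : Type u) [Field k] {n d : ℕ} (L : Fin d → ℕ) (c' : Fin d → Fin n) :
    TensorSpace k n d := fun v =>
  open Classical in
  if h : ∃ κ : Equiv.Perm (Fin d), L ∘ κ = L ∧ v = c' ∘ κ then sg k (eps L h.choose) else 0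

theorem testV_eq {L : Fin d → ℕ} {c' : Fin d → Fin n}
    (hc' : ∀ a b, a ≠ b → L a = L b → c' a = c' b → ¬ isOdd (L a)) {κ : Equiv.Perm (Fin d)}
    (hκ : L ∘ κ = L) : testV k L c' (c' ∘ κ) = sg k (eps L κ) := by
  have hex : ∃ κ' : Equiv.Perm (Fin d), L ∘ κ' = L ∧ c' ∘ κ = c' ∘ κ' := ⟨κ, hκ, rfl⟩
  unfold testV
  rw [dif_pos hex]
  congr 1
  obtain ⟨h1, h2⟩ := hex.choose_spec
  generalize hex.choose = κ' at h1 h2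
  have h3 : eps L (κ' * κ⁻¹) = 1 := by
    refine eps_of_fix_odd (fun x hx => ?_) (keepL_mul h1 (keepL_inv hκ))
    by_contra hne
    have h4 : L ((κ' * κ⁻¹) x) = L x := congrFun (keepL_mul h1 (keepL_inv hκ)) x
    have h5 : c' ((κ' * κ⁻¹) x) = c' x := by
      have := congrFun h2 (κ⁻¹ x)
      rw [Function.comp_apply, Function.comp_apply, show κ (κ⁻¹ x) = x by simp] at this
      exact this.symm
    exact hc' _ _ hne h4 h5 (h4 ▸ hx)
  rw [eps_mul h1 (keepL_inv hκ), eps_inv hκ] at h3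
  rw [← mul_one (eps L κ'), ← Int.units_mul_self (eps L κ), ← mul_assoc, h3, one_mul]

theorem testV_mem {L : Fin d → ℕ} {c' : Fin d → Fin n}
    (hc' : ∀ a b, a ≠ b → L a = L b → c' a = c' b → ¬ isOdd (L a)) : testV k L c' ∈ XL k n L := by
  refine mem_XL_of_keep fun κ hκ => ts_ext fun v => ?_
  rw [gg_smul_apply, ts_smul]
  by_cases h : ∃ κ : Equiv.Perm (Fin d), L ∘ κ = L ∧ v = c' ∘ κ
  · obtain ⟨κ', h1, rfl⟩ := h
    rw [Function.comp_assoc, ← Equiv.Perm.coe_mul, testV_eq hc' (keepL_mul h1 hκ), testV_eq hc' h1,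
      eps_mul h1 hκ, map_mul, mul_comm]
  · have h' : ¬ ∃ κ' : Equiv.Perm (Fin d), L ∘ κ' = L ∧ v ∘ κ = c' ∘ κ' := by
      rintro ⟨κ', h1, h2⟩
      refine h ⟨κ' * κ⁻¹, keepL_mul h1 (keepL_inv hκ), ?_⟩
      rw [Equiv.Perm.coe_mul, ← Function.comp_assoc, ← h2]
      ext x; simp
    unfold testV
    rw [dif_neg h, dif_neg h', mul_zero]

/-- independence of standard words -/
theorem std_indep (L : Fin d → ℕ) (W : Finset (Fin d → ℕ)) (r : (Fin d → ℕ) → Equiv.Perm (Fin d))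
    (hr : ∀ u ∈ W, L ∘ ⇑(r u)⁻¹ = u) (hs : ∀ u ∈ W, ∃ c : Fin d → Fin n, StdC u c)
    (z : (Fin d → ℕ) → k)
    (h : ∀ m ∈ XL k n L, ∑ u ∈ W, z u • gg k n d (r u) • m = 0) : ∀ u ∈ W, z u = 0 := by
  classical
  by_contra hcon
  push Not at hcon
  obtain ⟨u, hu, hmax⟩ := Finset.exists_max_image (W.filter fun u => z u ≠ 0) toLex
    (by obtain ⟨u, h1, h2⟩ := hcon; exact ⟨u, by simp [h1, h2]⟩)
  rw [Finset.mem_filter] at hu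
  obtain ⟨c, hc⟩ := hs u hu.1
  have hLu : u ∘ r u = L := by
    funext x
    have := congrFun (hr u hu.1) (r u x)
    simpa using this.symm
  have hc' : ∀ a b, a ≠ b → L a = L b → (c ∘ r u) a = (c ∘ r u) b → ¬ isOdd (L a) := by
    intro a b hab hL hcab
    rw [← hLu] at hL ⊢
    rcases lt_trichotomy (r u a) (r u b) with h1 | h1 | h1
    · rcases hc _ _ h1 hcab with h2 | h2
      · exact absurd hL h2.ne
      · exact h2.2
    · exact absurd ((r u).injective h1) hab
    · rcases hc _ _ h1 hcab.symm with h2 | h2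
      · exact absurd hL h2.ne'
      · rw [hL]; exact h2.2
  have h0 := congrFun (h _ (testV_mem (k := k) hc')) c
  rw [ts_sum, Finset.sum_eq_single u] at h0
  · rw [ts_smul, gg_smul_apply] at h0
    have h1 := testV_eq (k := k) hc' (κ := 1) rfl
    rw [Equiv.Perm.coe_one, Function.comp_id, eps_one, map_one] at h1
    rw [h1, mul_one] at h0
    exact hu.2 h0
  · intro w hw hwu
    rw [ts_smul, gg_smul_apply]
    by_cases hz : z w = 0
    · rw [hz, zero_mul]
    have : ¬ ∃ κ : Equiv.Perm (Fin d), L ∘ κ = L ∧ c ∘ r w = (c ∘ r u) ∘ κ := by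
      rintro ⟨κ, h1, h2⟩
      have h3 : u ∘ ⇑(r u * κ * (r w)⁻¹) = w := by
        rw [Equiv.Perm.coe_mul, Equiv.Perm.coe_mul, ← Function.comp_assoc, ← Function.comp_assoc,
          hLu, h1, hr w hw]
      have h4 : c ∘ ⇑(r u * κ * (r w)⁻¹) = c := by
        rw [Equiv.Perm.coe_mul, Equiv.Perm.coe_mul, ← Function.comp_assoc, ← Function.comp_assoc,
          ← h2]
        ext x; simp
      have h5 := lex_le_of_std hc h4
      rw [h3] at h5
      exact hwu (toLex.injective (le_antisymm (hmax w (by simp [hw, hz])) h5))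
    unfold testV
    rw [dif_neg this, mul_zero]
  · intro h1; exact absurd hu.1 h1

end Labels


/-! ### Spanning by standard words -/

set_option linter.unusedSectionVars false
section Span

variable {k : Type u} [Field k] {n d : ℕ}

/-- standard words -/
def StdW (n : ℕ) {d : ℕ} (u : Fin d → ℕ) : Prop := ∃ c : Fin d → Fin n, StdC u c

theorem nokc_trans {u : Fin d → ℕ} {a b c : Fin d} (h1 : ¬ okc u a b) (h2 : ¬ okc u b c) :
    ¬ okc u a c := by
  unfold okc at *
  push Not at *
  refine ⟨by omega, fun h => ?_⟩
  exact h1.2 (by omega)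

theorem color_or_chain (u : Fin d → ℕ) (n : ℕ) : ∀ S : Finset (Fin d),
    (∃ c : Fin d → ℕ, ∀ j ∈ S, c j < n ∧ ∀ j' ∈ S, j < j' → c j = c j' → okc u j j') ∨
    ∃ T ⊆ S, T.card = n + 1 ∧ ∀ a ∈ T, ∀ b ∈ T, a < b → ¬ okc u a b := by
  classical
  induction n with
  | zero =>
    intro S
    rcases S.eq_empty_or_nonempty with rfl | ⟨x, hx⟩
    · left; exact ⟨fun _ => 0, by simp⟩
    · right
      refine ⟨{x}, by simpa using hx, by simp, ?_⟩
      intro a ha b hb hab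
      rw [Finset.mem_singleton] at ha hb
      subst ha; subst hb
      exact absurd hab (lt_irrefl _)
  | succ n ih =>
    intro S
    let S' := S.filter fun j => ∃ i ∈ S, i < j ∧ ¬ okc u i j
    rcases ih S' with ⟨c, hc⟩ | ⟨T, hT, hcard, hch⟩
    · left
      refine ⟨fun j => if j ∈ S' then c j else n, fun j hj => ⟨?_, fun j' hj' hlt heq => ?_⟩⟩
      · dsimp only
        split_ifs with h
        · exact (hc j h).1.trans (Nat.lt_succ_self n)
        · exact Nat.lt_succ_self n
      · dsimp only at heq
        by_cases h' : j' ∈ S'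
        · by_cases h : j ∈ S'
          · rw [if_pos h, if_pos h'] at heq
            exact (hc j h).2 j' h' hlt heq
          · rw [if_neg h, if_pos h'] at heq
            have := (hc j' h').1
            omega
        · by_contra hno
          exact h' (Finset.mem_filter.2 ⟨hj', j, hj, hlt, hno⟩)
    · right
      have hne : T.Nonempty := by rw [← Finset.card_pos]; omega
      have ht := T.min'_mem hne
      obtain ⟨-, i, hi, hlt, hno⟩ := Finset.mem_filter.1 (hT ht)
      have hiT : ∀ b ∈ T, i < b := fun b hb => hlt.trans_le (T.min'_le b hb)
      have hiT' : ∀ b ∈ T, ¬ okc u i b := fun b hb => by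
        rcases (T.min'_le b hb).lt_or_eq with h | h
        · exact nokc_trans hno (hch _ ht _ hb h)
        · rwa [← h]
      refine ⟨insert i T, ?_, ?_, ?_⟩
      · intro x hx
        rcases Finset.mem_insert.1 hx with rfl | hx
        · exact hi
        · exact (Finset.mem_filter.1 (hT hx)).1
      · rw [Finset.card_insert_of_notMem fun h => lt_irrefl _ (hiT i h), hcard]
      · intro a ha b hb hab
        rcases Finset.mem_insert.1 ha with rfl | ha'
        · rcases Finset.mem_insert.1 hb with rfl | hb'
          · exact absurd hab (lt_irrefl _)
          · exact hiT' b hb'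
        · rcases Finset.mem_insert.1 hb with rfl | hb'
          · exact absurd (hiT a ha') hab.asymm
          · exact hch a ha' b hb' hab

theorem chain_of_not_std {u : Fin d → ℕ} (h : ¬ StdW n u) :
    ∃ T : Finset (Fin d), T.card = n + 1 ∧ ∀ a ∈ T, ∀ b ∈ T, a < b → ¬ okc u a b := by
  rcases color_or_chain u n Finset.univ with ⟨c, hc⟩ | ⟨T, -, hT⟩
  · exact absurd ⟨fun j => ⟨c j, (hc j (Finset.mem_univ _)).1⟩, fun j j' hlt heq =>
      (hc j (Finset.mem_univ _)).2 j' (Finset.mem_univ _) hlt (Fin.mk.inj_iff.1 heq)⟩ h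
  · exact ⟨T, hT⟩

theorem chain_rel (h2 : (2 : k) ≠ 0) {L : Fin d → ℕ} (g : Equiv.Perm (Fin d))
    {T : Finset (Fin d)} (hT : T.card = n + 1)
    (hch : ∀ a ∈ T, ∀ b ∈ T, a < b → ¬ okc (L ∘ ⇑g⁻¹) a b) :
    ∃ (R : Finset (Fin d → ℕ)) (F : (Fin d → ℕ) → k) (r : (Fin d → ℕ) → Equiv.Perm (Fin d)),
      (∀ w ∈ R, L ∘ ⇑(r w)⁻¹ = w ∧ toLex w < toLex (L ∘ ⇑g⁻¹)) ∧
      ∀ m ∈ XL k n L, gg k n d g • m = ∑ w ∈ R, F w • gg k n d (r w) • m := by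
  classical
  set u := L ∘ ⇑g⁻¹ with hu
  let sup : Equiv.Perm (Fin d) → Prop := fun σ => ∀ x, x ∉ T → σ x = x
  have sup_mul : ∀ {σ τ}, sup σ → sup τ → sup (σ * τ) := fun h1 h2 x hx => by
    rw [Equiv.Perm.mul_apply, h2 x hx, h1 x hx]
  have sup_inv : ∀ {σ}, sup σ → sup σ⁻¹ := fun h1 x hx => by
    rw [Equiv.Perm.inv_eq_iff_eq, h1 x hx]
  have sup_mem : ∀ {σ}, sup σ → ∀ x ∈ T, σ x ∈ T := fun {σ} h1 x hx => by
    by_contra h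
    have := σ.injective (h1 _ h)
    rw [this] at h; exact h hx
  let R0 : Finset (Fin d → ℕ) := (Finset.univ.filter sup).image fun σ : Equiv.Perm (Fin d) => u ∘ ⇑σ⁻¹
  have hR0 : ∀ w, w ∈ R0 ↔ ∃ σ, sup σ ∧ u ∘ ⇑σ⁻¹ = w := fun w => by
    simp [R0]
  let ρ : (Fin d → ℕ) → Equiv.Perm (Fin d) := fun w =>
    if h : ∃ σ, sup σ ∧ u ∘ ⇑σ⁻¹ = w then h.choose else 1
  have hρ : ∀ σ, sup σ → sup (ρ (u ∘ ⇑σ⁻¹)) ∧ u ∘ ⇑(ρ (u ∘ ⇑σ⁻¹))⁻¹ = u ∘ ⇑σ⁻¹ := fun σ hσ => by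
    have hex : ∃ σ', sup σ' ∧ u ∘ ⇑σ'⁻¹ = u ∘ ⇑σ⁻¹ := ⟨σ, hσ, rfl⟩
    simp only [ρ, dif_pos hex]
    exact hex.choose_spec
  have indep : ∀ {σ σ'}, sup σ → sup σ' → u ∘ ⇑σ⁻¹ = u ∘ ⇑σ'⁻¹ → ∀ m ∈ XL k n L,
      sg k (Equiv.Perm.sign σ) • gg k n d (σ * g) • m =
        sg k (Equiv.Perm.sign σ') • gg k n d (σ' * g) • m := by
    intro σ σ' h1 h1' he m hm
    have hw : L ∘ ⇑(σ * g)⁻¹ = L ∘ ⇑(σ' * g)⁻¹ := by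
      rw [mul_inv_rev, mul_inv_rev, Equiv.Perm.coe_mul, Equiv.Perm.coe_mul, ← Function.comp_assoc,
        ← Function.comp_assoc, ← hu, he]
    rw [same_word hw hm]
    have hk : L ∘ ⇑((σ' * g)⁻¹ * (σ * g)) = L := by
      rw [Equiv.Perm.coe_mul, ← Function.comp_assoc, ← hw]
      ext x; simp
    have : eps L ((σ' * g)⁻¹ * (σ * g)) = Equiv.Perm.sign σ' * Equiv.Perm.sign σ := by
      rw [eps_of_fix hk]
      · simp only [map_mul, map_inv, mul_inv_rev, Equiv.Perm.sign_inv]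
        rw [Int.units_inv_eq_self, Int.units_inv_eq_self,
          mul_comm (Equiv.Perm.sign g) (Equiv.Perm.sign σ'), mul_assoc,
          mul_comm (Equiv.Perm.sign g), mul_assoc, Int.units_mul_self, mul_one]
      · intro x hx
        have hx' : (σ'⁻¹ * σ) (g x) ≠ g x := fun h => hx (by
          simp only [Equiv.Perm.mul_apply, mul_inv_rev] at h ⊢
          rw [h]; simp)
        have hs := sup_mul (sup_inv h1') h1
        have hgT : g x ∈ T := by
          by_contra h; exact hx' (hs _ h)
        have hgT' := sup_mem hs _ hgT
        have hue : u ((σ'⁻¹ * σ) (g x)) = u (g x) := by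
          have := congrFun he (σ (g x))
          simp only [Function.comp_apply] at this
          rw [Equiv.Perm.mul_apply, ← this]; simp
        have hux : u (g x) = L x := by simp [hu]
        rcases lt_or_gt_of_ne hx' with h | h
        · have := hch _ hgT' _ hgT h
          unfold okc at this
          push Not at this
          rw [← hux, ← hue]; exact this.2 hue
        · have := hch _ hgT _ hgT' h
          unfold okc at this
          push Not at this
          rw [← hux]; exact this.2 hue.symm
    rw [this, map_mul, smul_smul, mul_comm, mul_assoc, sg_sq, mul_one]
  have hzero : ∀ m ∈ XL k n L, ∑ w ∈ R0,
      sg k (Equiv.Perm.sign (ρ w)) • gg k n d (ρ w * g) • m = 0 := by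
    intro m hm
    refine ts_ext fun v => ?_
    rw [ts_sum, ts_zero]
    obtain ⟨a, ha, b, hb, hab, hv⟩ := Finset.exists_ne_map_eq_of_card_lt_of_maps_to
      (s := T) (t := (Finset.univ : Finset (Fin n))) (by simp [hT]) (f := v)
      (fun _ _ => Finset.mem_univ _)
    have hvs : v ∘ ⇑(Equiv.swap a b) = v := by
      ext x
      rw [Function.comp_apply, Equiv.swap_apply_def]
      split_ifs with h1 h2
      · rw [h1, hv]
      · rw [h2, hv]
      · rfl
    have sup_s : sup (Equiv.swap a b) := fun x hx =>
      Equiv.swap_apply_of_ne_of_ne (fun h => hx (h ▸ ha)) (fun h => hx (h ▸ hb))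
    have hmem : ∀ w ∈ R0, w ∘ ⇑(Equiv.swap a b) ∈ R0 := by
      intro w hw
      obtain ⟨σ, h1, rfl⟩ := (hR0 w).1 hw
      refine (hR0 _).2 ⟨Equiv.swap a b * σ, sup_mul sup_s h1, ?_⟩
      rw [mul_inv_rev, Equiv.swap_inv, Equiv.Perm.coe_mul]
      rfl
    have hadd : ∀ w ∈ R0, (sg k (Equiv.Perm.sign (ρ w)) • gg k n d (ρ w * g) • m) v +
        (sg k (Equiv.Perm.sign (ρ (w ∘ ⇑(Equiv.swap a b)))) •
          gg k n d (ρ (w ∘ ⇑(Equiv.swap a b)) * g) • m) v = 0 := by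
      intro w hw
      obtain ⟨σ, h1, rfl⟩ := (hR0 w).1 hw
      obtain ⟨h3, h4⟩ := hρ σ h1
      set σ' := ρ (u ∘ ⇑σ⁻¹)
      have e1 : (u ∘ ⇑σ⁻¹) ∘ ⇑(Equiv.swap a b) = u ∘ ⇑(Equiv.swap a b * σ')⁻¹ := by
        rw [mul_inv_rev, Equiv.swap_inv, Equiv.Perm.coe_mul, ← Function.comp_assoc, h4]
      rw [e1]
      obtain ⟨h5, h6⟩ := hρ _ (sup_mul sup_s h3)
      rw [indep h5 (sup_mul sup_s h3) h6 m hm, map_mul Equiv.Perm.sign, Equiv.Perm.sign_swap hab,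
        map_mul (sg k), sg_neg_one,
        mul_assoc, map_mul (gg k n d) (Equiv.swap a b), mul_smul, mul_smul, ts_smul, ts_smul, ts_smul,
        gg_smul_apply (Equiv.swap a b), hvs]
      ring
    refine Finset.sum_involution (fun w _ => w ∘ ⇑(Equiv.swap a b)) hadd ?_ hmem ?_
    · intro w hw hne heq
      have := hadd w hw
      rw [heq, ← two_mul] at this
      exact hne ((mul_eq_zero.1 this).resolve_left h2)
    · intro w hw
      ext x; simp
  have huR : u ∈ R0 := (hR0 u).2 ⟨1, fun _ _ => rfl, by ext; simp⟩
  refine ⟨R0.erase u, fun w => - sg k (Equiv.Perm.sign (ρ w)), fun w => ρ w * g, ?_, ?_⟩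
  · intro w hw
    obtain ⟨hne, hw⟩ := Finset.mem_erase.1 hw
    obtain ⟨σ, h1, rfl⟩ := (hR0 w).1 hw
    obtain ⟨h3, h4⟩ := hρ σ h1
    refine ⟨by rw [mul_inv_rev, Equiv.Perm.coe_mul, ← Function.comp_assoc, ← hu, h4], ?_⟩
    rcases lt_trichotomy (toLex (u ∘ ⇑σ⁻¹)) (toLex u) with h | h | h
    · exact h
    · exact absurd (toLex.injective h) hne
    · exfalso
      obtain ⟨j, h5, h6⟩ := h
      change u j < u (σ⁻¹ j) at h6
      have hjT : j ∈ T := by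
        by_contra hj
        rw [sup_inv h1 j hj] at h6; exact lt_irrefl _ h6
      refine lexcmp (u := u) (τ := σ⁻¹) (cls := fun x => x ∈ T) ?_ j (fun i hi => (h5 i hi).symm) ?_
      · ext x
        refine ⟨fun h => ?_, fun h => sup_mem (sup_inv h1) x h⟩
        have := sup_mem h1 _ h
        simpa using this
      · intro i hi hi'
        have hiT : i ∈ T := by rw [hi]; exact hjT
        by_contra hij
        rcases lt_or_eq_of_le (not_lt.1 hij) with h | h
        · have := hch j hjT i hiT h
          unfold okc at this
          push Not at this
          omega
        · subst h; omega
  · intro m hm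
    have h0 := hzero m hm
    rw [← Finset.add_sum_erase _ _ huR] at h0
    have h1 : sg k (Equiv.Perm.sign (ρ u)) • gg k n d (ρ u * g) • m = gg k n d g • m := by
      have hone : sup 1 := fun _ _ => rfl
      obtain ⟨h3, h4⟩ := hρ 1 hone
      have e : u ∘ ⇑(1 : Equiv.Perm (Fin d))⁻¹ = u := by ext; simp
      rw [e] at h3 h4
      rw [indep h3 hone (by rw [h4, e]) m hm, map_one, map_one, one_smul, one_mul]
    rw [h1] at h0
    rw [eq_neg_of_add_eq_zero_left h0, ← Finset.sum_neg_distrib]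
    exact Finset.sum_congr rfl fun w _ => by rw [neg_smul]

theorem std_span (h2 : (2 : k) ≠ 0) (L : Fin d → ℕ) (g : Equiv.Perm (Fin d)) :
    CC.mk (XL k n L) (gg k n d g) ∈ Submodule.span k
      ((fun g' => CC.mk (XL k n L) (gg k n d g')) '' {g' | StdW n (L ∘ ⇑g'⁻¹)}) := by
  have key : ∀ x : Lex (Fin d → ℕ), ∀ g : Equiv.Perm (Fin d), toLex (L ∘ ⇑g⁻¹) = x →
      CC.mk (XL k n L) (gg k n d g) ∈ Submodule.span k
      ((fun g' => CC.mk (XL k n L) (gg k n d g')) '' {g' | StdW n (L ∘ ⇑g'⁻¹)}) := by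
    intro x
    induction x using WellFoundedLT.induction with
    | ind x ih =>
      rintro g rfl
      by_cases hs : StdW n (L ∘ ⇑g⁻¹)
      · exact Submodule.subset_span ⟨g, hs, rfl⟩
      · obtain ⟨T, hT, hch⟩ := chain_of_not_std hs
        obtain ⟨R, F, r, hr, hrel⟩ := chain_rel h2 g hT hch
        have : CC.mk (XL k n L) (gg k n d g) = ∑ w ∈ R, F w • CC.mk (XL k n L) (gg k n d (r w)) := by
          simp only [← CC.mk_ksmul]
          rw [← map_sum, CC.mk_eq]
          intro m hm
          rw [hrel m hm, Finset.sum_smul]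
          exact Finset.sum_congr rfl fun w _ => (smul_assoc _ _ _).symm
        rw [this]
        refine Submodule.sum_mem _ fun w hw => Submodule.smul_mem _ _ (ih _ (hr w hw).2 _ ?_)
        rw [(hr w hw).1]
  exact key _ g rfl

end Span


/-! ### Exactness of the Koszul type complexes -/

set_option linter.unusedSectionVars false
section Exact

variable {k : Type u} [Field k] {n d : ℕ}

/-- the labels of the complex -/
def LL (q : ℕ) {d : ℕ} (s : Fin d → ℕ) (i : ℕ) : Fin d → ℕ :=
  fun t => if t.1 < i then 0 else if t.1 < q then 1 else s t

/-- the differential element -/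
noncomputable def del (k : Type u) [Field k] (n : ℕ) {d : ℕ} (j : Fin d) : LambdaAlgebra k n d :=
  1 - ∑ t ∈ Finset.Iio j, gg k n d (Equiv.swap j t)

theorem del_smul (j : Fin d) (m : TensorSpace k n d) :
    del k n j • m = m - ∑ t ∈ Finset.Iio j, gg k n d (Equiv.swap j t) • m := by
  rw [del, sub_smul, one_smul, Finset.sum_smul]

variable {q : ℕ} {s : Fin d → ℕ}

theorem LL_lt {i : ℕ} {t : Fin d} (h : t.1 < i) : LL q s i t = 0 := if_pos h
theorem LL_mid {i : ℕ} {t : Fin d} (h : ¬ t.1 < i) (h' : t.1 < q) : LL q s i t = 1 := by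
  rw [LL, if_neg h, if_pos h']
theorem LL_ge {i : ℕ} {t : Fin d} (h : ¬ t.1 < i) (h' : ¬ t.1 < q) : LL q s i t = s t := by
  rw [LL, if_neg h, if_neg h']

theorem LL_zero (hs : ∀ t, 2 ≤ s t) {i : ℕ} {t : Fin d} : LL q s i t = 0 ↔ t.1 < i := by
  have := hs t
  unfold LL
  grind

theorem LL_one (hs : ∀ t, 2 ≤ s t) {i : ℕ} {t : Fin d} : LL q s i t = 1 ↔ ¬ t.1 < i ∧ t.1 < q := by
  have := hs t
  unfold LL
  grind

theorem LL_le_one (hs : ∀ t, 2 ≤ s t) {i : ℕ} (hi : i ≤ q) {t : Fin d} :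
    LL q s i t ≤ 1 ↔ t.1 < q := by
  have := hs t
  unfold LL
  grind

theorem swap_conj (a b x y : Fin d) : Equiv.swap a b * Equiv.swap x y =
    Equiv.swap (Equiv.swap a b x) (Equiv.swap a b y) * Equiv.swap a b := by
  have := Equiv.swap_apply_apply (Equiv.swap a b) x y
  rw [this]
  simp [mul_assoc]

theorem swap_id1 {j j' t : Fin d} (h1 : j ≠ j') (h2 : t ≠ j) (h3 : t ≠ j') :
    Equiv.swap j t * Equiv.swap j' t = Equiv.swap j' t * Equiv.swap j j' := by
  refine Equiv.ext fun x => ?_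
  simp only [Equiv.Perm.mul_apply, Equiv.swap_apply_def]
  grind

theorem swap_id2 {j j' t t' : Fin d} (h1 : j ≠ j') (h2 : t ≠ j) (h3 : t ≠ j') (h4 : t' ≠ j)
    (h5 : t' ≠ j') (h6 : t ≠ t') : Equiv.swap j t' * Equiv.swap j' t =
      Equiv.swap j t * (Equiv.swap j' t' * (Equiv.swap t t' * Equiv.swap j j')) := by
  refine Equiv.ext fun x => ?_
  simp only [Equiv.Perm.mul_apply, Equiv.swap_apply_def]
  grind

theorem chi_zero : chi 0 = -1 := if_pos (Or.inl rfl)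
theorem chi_one : chi 1 = 1 := if_neg (by simp [isOdd])

theorem del_mem (hs : ∀ t, 2 ≤ s t) (j : Fin d) {m : TensorSpace k n d}
    (hm : m ∈ XL k n (LL q s j.1)) : del k n j • m ∈ XL k n (LL q s (j.1 + 1)) := by
  classical
  intro a b hab hL
  have hchi0 : sg k (chi 0) = -1 := by rw [chi_zero, sg_neg_one]
  have step : ∀ a b : Fin d, a ≠ b → a < j → b = j → gg k n d (Equiv.swap a b) • del k n j • m =
      sg k (chi 0) • del k n j • m := by
    intro a b' hab ha hb'
    subst hb'
    rw [hchi0, neg_one_smul, del_smul, smul_sub, Finset.smul_sum, neg_sub]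
    rw [← Finset.add_sum_erase _ _ (Finset.mem_Iio.2 ha), ← Finset.add_sum_erase _ _ (Finset.mem_Iio.2 ha)]
    rw [Equiv.swap_comm a b', ← mul_smul (gg k n d (Equiv.swap b' a)), ← map_mul, Equiv.swap_mul_self, map_one, one_smul]
    have : ∑ x ∈ (Finset.Iio b').erase a, gg k n d (Equiv.swap b' a) • gg k n d (Equiv.swap b' x) • m =
        - ∑ x ∈ (Finset.Iio b').erase a, gg k n d (Equiv.swap b' x) • m := by
      rw [← Finset.sum_neg_distrib]
      refine Finset.sum_congr rfl fun t ht => ?_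
      obtain ⟨h1, h2⟩ := Finset.mem_erase.1 ht
      rw [Finset.mem_Iio] at h2
      have e : Equiv.swap b' a * Equiv.swap b' t = Equiv.swap b' t * Equiv.swap a t := by
        rw [swap_conj b' t a t, Equiv.swap_apply_of_ne_of_ne hab h1.symm, Equiv.swap_apply_right, Equiv.swap_comm a b']
      rw [← mul_smul, ← map_mul, e, map_mul, mul_smul,
        hm a t h1.symm (by rw [LL_lt ha, LL_lt h2]), LL_lt ha, hchi0, neg_one_smul, smul_neg]
    rw [this]
    abel
  have step2 : ∀ a b : Fin d, a ≠ b → a ≠ j → b ≠ j → (a < j ↔ b < j) → LL q s j.1 a = LL q s j.1 b →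
      gg k n d (Equiv.swap a b) • del k n j • m = sg k (chi (LL q s j.1 a)) • del k n j • m := by
    intro a b hab ha hb hj hLL
    rw [del_smul, smul_sub, hm a b hab hLL, smul_sub]
    congr 1
    rw [Finset.smul_sum, Finset.smul_sum]
    refine Finset.sum_equiv (Equiv.swap a b) (fun t => ?_) (fun t ht => ?_)
    · rw [Finset.mem_Iio, Finset.mem_Iio, Equiv.swap_apply_def]
      split_ifs with h1 h2
      · rw [h1, hj]
      · rw [h2, hj]
      · rfl
    · rw [← mul_smul, ← map_mul, swap_conj, Equiv.swap_apply_of_ne_of_ne ha.symm hb.symm, map_mul,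
        mul_smul, hm a b hab hLL, smul_comm]
  by_cases ha : a.1 < j.1 + 1
  · have hb : b.1 < j.1 + 1 := by
      rw [← LL_zero (q := q) hs, ← hL, LL_zero hs]; exact ha
    rw [LL_lt ha]
    by_cases haj : a = j
    · rw [Equiv.swap_comm]
      refine step b a hab.symm ?_ haj
      subst haj
      exact lt_of_le_of_ne (Nat.lt_succ_iff.1 hb) hab.symm
    · have haj' : a < j := lt_of_le_of_ne (Nat.lt_succ_iff.1 ha) haj
      by_cases hbj : b = j
      · exact step a b hab haj' hbj
      · have hbj' : b < j := lt_of_le_of_ne (Nat.lt_succ_iff.1 hb) hbj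
        have := step2 a b hab haj hbj (by simp [haj', hbj']) (by rw [LL_lt haj', LL_lt hbj'])
        rwa [LL_lt haj'] at this
  · have hb : ¬ b.1 < j.1 + 1 := by
      rw [← LL_zero (q := q) hs, ← hL, LL_zero hs]; exact ha
    have e : ∀ x : Fin d, ¬ x.1 < j.1 + 1 → LL q s (j.1 + 1) x = LL q s j.1 x := fun x hx => by
      rw [LL, LL, if_neg hx, if_neg (show ¬ x.1 < j.1 by omega)]
    rw [e a ha]
    rw [e a ha, e b hb] at hL
    refine step2 a b hab (fun h => ha (by rw [h]; omega)) (fun h => hb (by rw [h]; omega)) ?_ hL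
    rw [Fin.lt_def, Fin.lt_def]; omega

theorem del_del (hs : ∀ t, 2 ≤ s t) (j j' : Fin d) (hj' : j'.1 = j.1 + 1) (hq : j'.1 < q)
    {m : TensorSpace k n d} (hm : m ∈ XL k n (LL q s j.1)) :
    del k n j' • del k n j • m = 0 := by
  classical
  have hjj : j ≠ j' := fun h => by rw [← h] at hj'; omega
  set S := gg k n d (Equiv.swap j j') with hS
  have hSm : S • m = m := by
    have h1 : LL q s j.1 j = 1 := LL_mid (lt_irrefl _) (by omega)
    have h2 : LL q s j.1 j' = 1 := LL_mid (by omega) (by omega)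
    rw [hS, hm j j' hjj (by rw [h1, h2]), h1, chi_one, map_one, one_smul]
  have hSS : ∀ x : TensorSpace k n d, S • S • x = x := fun x => by
    rw [← mul_smul, hS, ← map_mul, Equiv.swap_mul_self, map_one, one_smul]
  set A := ∑ t ∈ Finset.Iio j, gg k n d (Equiv.swap j t) with hA
  have hdj : del k n j = 1 - A := rfl
  have htj : ∀ t ∈ Finset.Iio j, t ≠ j ∧ t ≠ j' := fun t ht => by
    rw [Finset.mem_Iio] at ht
    exact ⟨ht.ne, fun h => by rw [h, Fin.lt_def] at ht; omega⟩
  have hdj' : del k n j' = 1 - S - S * A * S := by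
    have : Finset.Iio j' = insert j (Finset.Iio j) := by
      ext x
      rw [Finset.mem_Iio, Finset.mem_insert, Finset.mem_Iio, Fin.lt_def, Fin.lt_def, Fin.ext_iff]
      omega
    rw [del, this, Finset.sum_insert (by simp), sub_add_eq_sub_sub, hS, Equiv.swap_comm j' j]
    congr 1
    rw [hA, Finset.mul_sum, Finset.sum_mul]
    refine Finset.sum_congr rfl fun t ht => ?_
    rw [← map_mul, ← map_mul, swap_conj, Equiv.swap_apply_left,
      Equiv.swap_apply_of_ne_of_ne (htj t ht).1 (htj t ht).2, mul_assoc, Equiv.swap_mul_self, mul_one]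
  have key : A • S • A • m = S • A • m := by
    have e1 : ∀ t ∈ Finset.Iio j, S • gg k n d (Equiv.swap j t) • m = gg k n d (Equiv.swap j' t) • m := by
      intro t ht
      rw [hS, ← mul_smul, ← map_mul, swap_conj, Equiv.swap_apply_left,
        Equiv.swap_apply_of_ne_of_ne (htj t ht).1 (htj t ht).2, map_mul, mul_smul, ← hS, hSm]
    have e2 : S • A • m = ∑ t ∈ Finset.Iio j, gg k n d (Equiv.swap j' t) • m := by
      rw [hA, Finset.sum_smul, Finset.smul_sum]
      exact Finset.sum_congr rfl e1
    have e3 : A • S • A • m = ∑ x ∈ Finset.Iio j ×ˢ Finset.Iio j,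
        gg k n d (Equiv.swap j x.1) • gg k n d (Equiv.swap j' x.2) • m := by
      rw [e2, Finset.sum_product, hA, Finset.sum_smul]
      exact Finset.sum_congr rfl fun t _ => Finset.smul_sum
    rw [e3, ← Finset.diag_union_offDiag, Finset.sum_union (Finset.disjoint_diag_offDiag _), Finset.sum_diag]
    have e4 : ∑ x ∈ (Finset.Iio j).offDiag,
        gg k n d (Equiv.swap j x.1) • gg k n d (Equiv.swap j' x.2) • m = 0 := by
      refine Finset.sum_involution (fun x _ => (x.2, x.1)) ?_ ?_ ?_ ?_
      · rintro ⟨t, t'⟩ hx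
        obtain ⟨h1, h2, h3⟩ := Finset.mem_offDiag.1 hx
        dsimp only at h1 h2 h3 ⊢
        have h1' : t < j := Finset.mem_Iio.1 h1
        have h2' : t' < j := Finset.mem_Iio.1 h2
        have hodd : gg k n d (Equiv.swap t t') • m = - m := by
          rw [hm t t' h3 (by rw [LL_lt h1', LL_lt h2']),
            LL_lt h1', chi_zero, sg_neg_one, neg_one_smul]
        have e := swap_id2 hjj (htj t h1).1 (htj t h1).2 (htj t' h2).1 (htj t' h2).2 h3
        have : gg k n d (Equiv.swap j t') • gg k n d (Equiv.swap j' t) • m =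
            - gg k n d (Equiv.swap j t) • gg k n d (Equiv.swap j' t') • m := by
          rw [← mul_smul, ← map_mul, e, map_mul, map_mul, map_mul, mul_smul, mul_smul, mul_smul, ← hS,
            hSm, hodd, smul_neg, smul_neg, neg_smul]
        rw [this, neg_smul, add_neg_cancel]
      · rintro ⟨t, t'⟩ hx _ heq
        exact (Finset.mem_offDiag.1 hx).2.2 (Prod.mk.inj heq).2
      · rintro ⟨t, t'⟩ hx
        obtain ⟨h1, h2, h3⟩ := Finset.mem_offDiag.1 hx
        exact Finset.mem_offDiag.2 ⟨h2, h1, h3.symm⟩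
      · rintro ⟨t, t'⟩ _; rfl
    rw [e4, add_zero, e2]
    refine Finset.sum_congr rfl fun t ht => ?_
    have e := swap_id1 hjj (htj t ht).1 (htj t ht).2
    rw [← mul_smul, ← map_mul, e, map_mul, mul_smul, ← hS, hSm]
  rw [hdj, hdj']
  simp only [sub_smul, smul_sub, one_smul, mul_smul, hSm, hSS, key]
  abel

end Exact


set_option linter.unusedSectionVars false
section Exact2

variable {k : Type u} [Field k] {n d : ℕ}

theorem std_indep' {ι : Type*} (L : Fin d → ℕ) (A : Finset ι) (z : ι → k)
    (g : ι → Equiv.Perm (Fin d)) (hstd : ∀ α ∈ A, StdW n (L ∘ ⇑(g α)⁻¹))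
    (h : ∀ m ∈ XL k n L, ∑ α ∈ A, z α • gg k n d (g α) • m = 0) (α₀ : ι) (h0 : α₀ ∈ A)
    (huniq : ∀ α ∈ A, L ∘ ⇑(g α)⁻¹ = L ∘ ⇑(g α₀)⁻¹ → α = α₀) : z α₀ = 0 := by
  classical
  let wd : ι → Fin d → ℕ := fun α => L ∘ ⇑(g α)⁻¹
  let r : (Fin d → ℕ) → Equiv.Perm (Fin d) := fun w =>
    if h : ∃ α ∈ A, wd α = w then g h.choose else 1
  have hr : ∀ α ∈ A, L ∘ ⇑(r (wd α))⁻¹ = wd α := fun α hα => by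
    have hex : ∃ α' ∈ A, wd α' = wd α := ⟨α, hα, rfl⟩
    simp only [r, dif_pos hex]
    exact hex.choose_spec.2
  let z' : (Fin d → ℕ) → k := fun w => ∑ α ∈ A with wd α = w, z α * sg k (eps L ((r w)⁻¹ * g α))
  have := std_indep (k := k) (n := n) L (A.image wd) r (fun w hw => by
      obtain ⟨α, hα, rfl⟩ := Finset.mem_image.1 hw
      exact hr α hα) (fun w hw => by
      obtain ⟨α, hα, rfl⟩ := Finset.mem_image.1 hw
      exact hstd α hα) z' (fun m hm => by
      rw [← h m hm, ← Finset.sum_fiberwise_of_maps_to (g := wd) (t := A.image wd)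
        (fun α hα => Finset.mem_image_of_mem _ hα)]
      refine Finset.sum_congr rfl fun w hw => ?_
      rw [Finset.sum_smul]
      refine Finset.sum_congr rfl fun α hα => ?_
      obtain ⟨hα', rfl⟩ := Finset.mem_filter.1 hα
      rw [mul_smul, ← same_word (hr α hα').symm hm]) (wd α₀) (Finset.mem_image_of_mem _ h0)
  have hf : A.filter (fun α => wd α = wd α₀) = {α₀} := by
    ext α
    rw [Finset.mem_filter, Finset.mem_singleton]
    exact ⟨fun h => huniq α h.1 h.2, by rintro rfl; exact ⟨h0, rfl⟩⟩
  simp only [z', hf, Finset.sum_singleton] at this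
  exact (mul_eq_zero.1 this).resolve_right (sg_ne _)

/-- first small letter -/
def FstL (u : Fin d → ℕ) (x : Fin d) : Prop := u x ≤ 1 ∧ ∀ y, y < x → 1 < u y

/-- words whose first small letter is zero -/
def XiF (u : Fin d → ℕ) : Prop := ∃ x, FstL u x ∧ u x = 0

theorem FstL.unique {u : Fin d → ℕ} {x y : Fin d} (h : FstL u x) (h' : FstL u y) : x = y := by
  rcases lt_trichotomy x y with h1 | h1 | h1
  · exact absurd (h'.2 x h1) (not_lt.2 h.1)
  · exact h1
  · exact absurd (h.2 y h1) (not_lt.2 h'.1)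

theorem FstL.congr {u u' : Fin d → ℕ} {x : Fin d} (h : FstL u x) (h' : ∀ y, u y ≤ 1 ↔ u' y ≤ 1) :
    FstL u' x := by
  refine ⟨(h' x).1 h.1, fun y hy => ?_⟩
  have := h.2 y hy
  have := h' y
  omega

theorem exists_FstL {u : Fin d → ℕ} {y : Fin d} (hy : u y ≤ 1) : ∃ x, FstL u x := by
  classical
  let S : Finset (Fin d) := Finset.univ.filter fun x => u x ≤ 1
  have hS : S.Nonempty := ⟨y, by simp [S, hy]⟩
  refine ⟨S.min' hS, (Finset.mem_filter.1 (S.min'_mem hS)).2, fun z hz => ?_⟩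
  by_contra h
  exact absurd (S.min'_le z (by simp [S]; omega)) (not_le.2 hz)

theorem StdC.up {u : Fin d → ℕ} {c : Fin d → Fin n} (h : StdC u c) {x : Fin d} (hx : u x = 0) :
    StdC (Function.update u x 1) c := by
  intro j j' hlt hc
  have := h j j' hlt hc
  unfold okc at *
  simp only [Function.update_apply, isOdd] at *
  grind

theorem StdC.down {u : Fin d → ℕ} {c : Fin d → Fin n} (h : StdC u c) {x : Fin d} (hx : FstL u x)
    (hx1 : u x = 1) : StdC (Function.update u x 0) c := by
  intro j j' hlt hc
  have := h j j' hlt hc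
  have h2 := hx.2
  unfold okc at *
  simp only [Function.update_apply, isOdd] at *
  by_cases h1 : j' = x
  · subst h1
    have := h2 j hlt
    grind
  · grind

variable {q : ℕ} {s : Fin d → ℕ}

theorem LL_step (hs : ∀ t, 2 ≤ s t) {j : Fin d} (hj : j.1 < q) {t : Fin d} (ht : t ≤ j)
    (g : Equiv.Perm (Fin d)) : LL q s j.1 ∘ ⇑(g * Equiv.swap j t)⁻¹ =
      Function.update (LL q s (j.1 + 1) ∘ ⇑g⁻¹) (g t) 1 := by
  ext x
  obtain ⟨y, rfl⟩ := g.surjective x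
  rw [Fin.le_def] at ht
  have e : LL q s j.1 (Equiv.swap j t y) = if y = t then 1 else LL q s (j.1 + 1) y := by
    have h1 := hs t
    rw [Equiv.swap_apply_def]
    unfold LL
    simp only [Fin.ext_iff] at *
    grind
  rw [mul_inv_rev, Equiv.swap_inv, Function.comp_apply, Equiv.Perm.mul_apply,
    show g⁻¹ (g y) = y by simp, e, Function.update_apply, Function.comp_apply, show g⁻¹ (g y) = y by simp]
  simp

theorem gg_del_smul (g : Equiv.Perm (Fin d)) (j : Fin d) (m : TensorSpace k n d) :
    gg k n d g • del k n j • m =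
      ∑ t ∈ Finset.Iic j, (if t = j then (1 : k) else -1) • gg k n d (g * Equiv.swap j t) • m := by
  have : Finset.Iic j = insert j (Finset.Iio j) := by
    ext x; simp [le_iff_lt_or_eq, or_comm]
  rw [this, Finset.sum_insert (by simp), if_pos rfl, one_smul, Equiv.swap_self, del_smul, smul_sub,
    Finset.smul_sum, sub_eq_add_neg, ← Finset.sum_neg_distrib]
  congr 1
  refine Finset.sum_congr rfl fun t ht => ?_
  rw [if_neg (Finset.mem_Iio.1 ht).ne, neg_one_smul, map_mul, mul_smul]

theorem claim2 (hs : ∀ t, 2 ≤ s t) {j : Fin d} (hj : j.1 < q) (W : Finset (Fin d → ℕ))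
    (r : (Fin d → ℕ) → Equiv.Perm (Fin d)) (hr : ∀ u ∈ W, LL q s (j.1 + 1) ∘ ⇑(r u)⁻¹ = u)
    (hstd : ∀ u ∈ W, StdW n u) (hxi : ∀ u ∈ W, XiF u) (z : (Fin d → ℕ) → k)
    (h : ∀ m ∈ XL k n (LL q s j.1), ∑ u ∈ W, z u • gg k n d (r u) • del k n j • m = 0) :
    ∀ u ∈ W, z u = 0 := by
  classical
  intro u₀ hu₀
  obtain ⟨x₀, hx₀, hx₀'⟩ := hxi u₀ hu₀
  have hlet : ∀ u ∈ W, ∀ t, u (r u t) = LL q s (j.1 + 1) t := fun u hu t => by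
    have := congrFun (hr u hu) (r u t)
    rw [← this]; simp
  have hle : ∀ u ∈ W, ∀ t ∈ Finset.Iic j, u (r u t) = 0 := fun u hu t ht => by
    rw [hlet u hu, LL_lt]
    have h1 : t ≤ j := Finset.mem_Iic.1 ht
    rw [Fin.le_def] at h1; omega
  let t₀ := (r u₀)⁻¹ x₀
  have ht₀ : r u₀ t₀ = x₀ := by simp [t₀]
  have ht₀j : t₀ ∈ Finset.Iic j := by
    have h1 := hlet u₀ hu₀ t₀
    rw [ht₀, hx₀'] at h1
    have := (LL_zero hs).1 h1.symm
    rw [Finset.mem_Iic, Fin.le_def]; omega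
  have hwd : ∀ u ∈ W, ∀ t ∈ Finset.Iic j, LL q s j.1 ∘ ⇑(r u * Equiv.swap j t)⁻¹ =
      Function.update u (r u t) 1 := fun u hu t ht => by
    rw [LL_step hs hj (Finset.mem_Iic.1 ht), hr u hu]
  have := std_indep' (k := k) (n := n) (LL q s j.1) (W ×ˢ Finset.Iic j)
    (fun α => z α.1 * (if α.2 = j then 1 else -1)) (fun α => r α.1 * Equiv.swap j α.2)
    (by
      rintro ⟨u, t⟩ hα
      obtain ⟨h1, h2⟩ := Finset.mem_product.1 hα
      dsimp only at h1 h2 ⊢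
      obtain ⟨c, hc⟩ := hstd u h1
      rw [hwd u h1 t h2]
      exact ⟨c, hc.up (hle u h1 t h2)⟩)
    (fun m hm => by
      rw [← h m hm, Finset.sum_product]
      refine Finset.sum_congr rfl fun u hu => ?_
      rw [gg_del_smul, Finset.smul_sum]
      exact Finset.sum_congr rfl fun t _ => mul_smul _ _ _)
    (u₀, t₀) (Finset.mem_product.2 ⟨hu₀, ht₀j⟩)
    (by
      rintro ⟨u, t⟩ hα heq
      obtain ⟨h1, h2⟩ := Finset.mem_product.1 hα
      dsimp only at h1 h2 heq
      rw [hwd u h1 t h2, hwd u₀ hu₀ t₀ ht₀j, ht₀] at heq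
      obtain ⟨x, hx, hx'⟩ := hxi u h1
      have hxx : x = x₀ := by
        refine (hx.congr (u' := Function.update u (r u t) 1) fun y => ?_).unique
          (heq ▸ (hx₀.congr (u' := Function.update u₀ x₀ 1) fun y => ?_))
        · rw [Function.update_apply]
          split_ifs with hy
          · rw [hy, hle u h1 t h2]; simp
          · rfl
        · rw [Function.update_apply]
          split_ifs with hy
          · rw [hy, hx₀']; simp
          · rfl
      subst hxx
      have hrx : r u t = x := by
        by_contra hne
        have := congrFun heq x
        rw [Function.update_self, Function.update_of_ne (Ne.symm hne), hx'] at this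
        exact zero_ne_one this
      have huu : u = u₀ := by
        funext y
        by_cases hy : y = x
        · rw [hy, hx', hx₀']
        · have := congrFun heq y
          rwa [hrx, Function.update_of_ne hy, Function.update_of_ne hy] at this
      subst huu
      rw [Prod.mk.injEq]
      exact ⟨rfl, (r u).injective (hrx.trans ht₀.symm)⟩)
  dsimp only at this
  refine (mul_eq_zero.1 this).resolve_right ?_
  split_ifs <;> simp

theorem claim1 (h2 : (2 : k) ≠ 0) (hs : ∀ t, 2 ≤ s t) {i : ℕ} (hi : i ≤ q) (hq : 1 ≤ q) (hqd : q ≤ d)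
    (N : Submodule k (CC (XL k n (LL q s i))))
    (hN : ∀ (j : Fin d) b, j.1 = i → i < q → CC.mk _ (b * del k n j) ∈ N) (a : LambdaAlgebra k n d) :
    CC.mk (XL k n (LL q s i)) a ∈ N ⊔ Submodule.span k
      ((fun g' => CC.mk (XL k n (LL q s i)) (gg k n d g')) ''
        {g' | StdW n (LL q s i ∘ ⇑g'⁻¹) ∧ XiF (LL q s i ∘ ⇑g'⁻¹)}) := by
  classical
  induction a using lam_induction with
  | h0 => rw [map_zero]; exact Submodule.zero_mem _
  | hadd a b ha hb => rw [map_add]; exact Submodule.add_mem _ ha hb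
  | hs c a ha => rw [CC.mk_ksmul]; exact Submodule.smul_mem _ _ ha
  | hg g =>
  have h0 := std_span (k := k) (n := n) h2 (LL q s i) g
  refine (Submodule.span_le.2 ?_) h0
  rintro _ ⟨g, ⟨c, hc⟩, rfl⟩
  dsimp only
  set u := LL q s i ∘ ⇑g⁻¹ with hu
  have hug : ∀ t, u (g t) = LL q s i t := fun t => by simp [hu]
  obtain ⟨x, hx⟩ : ∃ x, FstL u x := by
    refine exists_FstL (y := g ⟨0, by omega⟩) ?_
    rw [hug, LL_le_one hs hi]
    exact hq
  by_cases hx0 : u x = 0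
  · exact Submodule.mem_sup_right (Submodule.subset_span ⟨g, ⟨⟨c, hc⟩, x, hx, hx0⟩, rfl⟩)
  have hx1 : u x = 1 := by have := hx.1; omega
  obtain ⟨y, rfl⟩ := g.surjective x
  have hy := (LL_one hs).1 ((hug y).symm.trans hx1)
  have hiq : i < q := by omega
  let j : Fin d := ⟨i, by omega⟩
  let g' := g * Equiv.swap j y
  have hg'j : g' j = g y := by simp [g']
  have hword : LL q s (i + 1) ∘ ⇑g'⁻¹ = Function.update u (g y) 0 := by
    ext x
    obtain ⟨w, rfl⟩ := g.surjective x
    have e : LL q s (i + 1) (Equiv.swap j y w) = if w = y then 0 else LL q s i w := by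
      rw [Equiv.swap_apply_def]
      unfold LL
      simp only [Fin.ext_iff, j] at *
      grind
    rw [mul_inv_rev, Equiv.swap_inv, Function.comp_apply, Equiv.Perm.mul_apply,
      show g⁻¹ (g w) = w by simp, e, Function.update_apply, hug]
    simp
  have hsw : CC.mk (XL k n (LL q s i)) (gg k n d g) = CC.mk (XL k n (LL q s i)) (gg k n d g') := by
    rw [CC.mk_eq]
    intro m hm
    by_cases hjy : j = y
    · simp only [g', hjy, Equiv.swap_self]; rfl
    · have h1 : LL q s i j = 1 := LL_mid (lt_irrefl _) hiq
      have h3 : LL q s i y = 1 := LL_mid hy.1 hy.2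
      rw [map_mul, mul_smul, hm j y hjy (h1.trans h3.symm), h1, chi_one, map_one, one_smul]
  have hdec : CC.mk (XL k n (LL q s i)) (gg k n d g) = CC.mk _ (gg k n d g' * del k n j) +
      ∑ t ∈ Finset.Iio j, CC.mk _ (gg k n d (g' * Equiv.swap j t)) := by
    rw [hsw, del, mul_sub, map_sub, mul_one, Finset.mul_sum, map_sum]
    simp only [map_mul]
    abel
  rw [hdec]
  refine Submodule.add_mem _ (Submodule.mem_sup_left (hN j _ rfl hiq)) (Submodule.sum_mem _ fun t ht => ?_)
  rw [Finset.mem_Iio] at ht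
  refine Submodule.mem_sup_right (Submodule.subset_span ⟨_, ?_, rfl⟩)
  have hw := LL_step hs (j := j) hiq ht.le g'
  change LL q s i ∘ _ = Function.update (LL q s (i + 1) ∘ _) _ _ at hw
  rw [Set.mem_ofPred_eq, hw, hword]
  have hgt : g' t ≠ g y := by rw [← hg'j]; exact fun h => ht.ne (g'.injective h)
  have hval : Function.update u (g y) 0 (g' t) = 0 := by
    have := congrFun hword (g' t)
    rw [← this, Function.comp_apply, show g'⁻¹ (g' t) = t by simp]
    have : t.1 < i := ht
    exact LL_lt (by omega)
  refine ⟨⟨c, (hc.down hx hx1).up hval⟩, g y, hx.congr fun w => ?_, ?_⟩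
  · rw [Function.update_apply]
    split_ifs with h
    · have : w ≠ g y := by rw [h]; exact hgt
      rw [Function.update_apply, if_neg (h ▸ this)] at hval
      rw [h]; omega
    · rw [Function.update_apply]
      split_ifs with h'
      · rw [h', hx1]; simp
      · rfl
  · rw [Function.update_of_ne hgt.symm, Function.update_self]

/-- the terms of the complex -/
abbrev KK (k : Type u) [Field k] (n q : ℕ) {d : ℕ} (s : Fin d → ℕ) (i : ℕ) : Type u :=
  CC (XL k n (LL q s i))

theorem del_mem' (hs : ∀ t, 2 ≤ s t) (i : ℕ) : ∀ m ∈ XL k n (LL q s i),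
    (if h : i < d then del k n ⟨i, h⟩ else 0 : LambdaAlgebra k n d) • m ∈ XL k n (LL q s (i + 1)) := by
  intro m hm
  split_ifs with h
  · exact del_mem hs ⟨i, h⟩ hm
  · rw [zero_smul]; exact Submodule.zero_mem _

/-- the differentials -/
noncomputable def dd (k : Type u) [Field k] (n q : ℕ) {d : ℕ} {s : Fin d → ℕ} (hs : ∀ t, 2 ≤ s t)
    (i : ℕ) : KK k n q s (i + 1) →ₗ[LambdaAlgebra k n d] KK k n q s i :=
  CC.rmul _ (del_mem' hs i)

theorem dd_mk (hs : ∀ t, 2 ≤ s t) {i : ℕ} (h : i < d) (a : LambdaAlgebra k n d) :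
    dd k n q hs i (CC.mk _ a) = CC.mk _ (a * del k n ⟨i, h⟩) := by
  rw [dd, CC.rmul_mk, dif_pos h]

theorem dd_inj_xi (hs : ∀ t, 2 ≤ s t) {i : ℕ} (hi : i < q) (hqd : q ≤ d) (x : KK k n q s (i + 1))
    (hx : x ∈ Submodule.span k
      ((fun g' => CC.mk (XL k n (LL q s (i + 1))) (gg k n d g')) ''
        {g' | StdW n (LL q s (i + 1) ∘ ⇑g'⁻¹) ∧ XiF (LL q s (i + 1) ∘ ⇑g'⁻¹)}))
    (h0 : dd k n q hs i x = 0) : x = 0 := by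
  classical
  set L := LL q s (i + 1) with hL
  let j : Fin d := ⟨i, by omega⟩
  let G : Finset (Equiv.Perm (Fin d)) := Finset.univ.filter fun g' => StdW n (L ∘ ⇑g'⁻¹) ∧ XiF (L ∘ ⇑g'⁻¹)
  let wd : Equiv.Perm (Fin d) → Fin d → ℕ := fun g' => L ∘ ⇑g'⁻¹
  let W := G.image wd
  let r : (Fin d → ℕ) → Equiv.Perm (Fin d) := fun w =>
    if h : ∃ g' ∈ G, wd g' = w then h.choose else 1
  have hr : ∀ g' ∈ G, wd (r (wd g')) = wd g' := fun g' hg' => by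
    have hex : ∃ g'' ∈ G, wd g'' = wd g' := ⟨g', hg', rfl⟩
    simp only [r, dif_pos hex]
    exact hex.choose_spec.2
  have hx' : x ∈ Submodule.span k ((fun w => CC.mk (XL k n L) (gg k n d (r w))) '' (W : Set (Fin d → ℕ))) := by
    refine (Submodule.span_le.2 ?_) hx
    rintro _ ⟨g, hg, rfl⟩
    have hgG : g ∈ G := by simp only [G, Finset.mem_filter, Finset.mem_univ, true_and]; exact hg
    have : CC.mk (XL k n L) (gg k n d g) =
        sg k (eps L ((r (wd g))⁻¹ * g)) • CC.mk (XL k n L) (gg k n d (r (wd g))) := by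
      rw [← CC.mk_ksmul, CC.mk_eq]
      intro m hm
      rw [smul_assoc]
      exact same_word (hr g hgG).symm hm
    change CC.mk (XL k n L) (gg k n d g) ∈ _
    rw [this]
    exact Submodule.smul_mem _ _ (Submodule.subset_span ⟨wd g, Finset.mem_coe.2 (Finset.mem_image_of_mem _ hgG), rfl⟩)
  obtain ⟨z, hz⟩ := (Submodule.mem_span_image_finset_iff_exists_fun k).1 hx'
  let z' : (Fin d → ℕ) → k := fun w => if h : w ∈ W then z ⟨w, h⟩ else 0
  have hz' : x = CC.mk (XL k n L) (∑ w ∈ W, z' w • gg k n d (r w)) := by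
    rw [map_sum, ← hz, ← Finset.sum_coe_sort W]
    refine Finset.sum_congr rfl fun w _ => ?_
    rw [CC.mk_ksmul]
    simp only [z', dif_pos w.2, Subtype.coe_eta]
  have hall := claim2 (k := k) (n := n) hs (j := j) hi W r (fun w hw => by
      obtain ⟨g, hg, rfl⟩ := Finset.mem_image.1 hw
      exact hr g hg) (fun w hw => by
      obtain ⟨g, hg, rfl⟩ := Finset.mem_image.1 hw
      exact (Finset.mem_filter.1 hg).2.1) (fun w hw => by
      obtain ⟨g, hg, rfl⟩ := Finset.mem_image.1 hw
      exact (Finset.mem_filter.1 hg).2.2) z' (fun m hm => by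
      rw [hz', dd_mk hs (show i < d by omega), CC.mk_eq_zero] at h0
      rw [← h0 m hm, mul_smul, Finset.sum_smul]
      exact Finset.sum_congr rfl fun w _ => (smul_assoc _ _ _).symm)
  rw [hz', Finset.sum_eq_zero fun w hw => by rw [hall w hw, zero_smul], map_zero]

theorem koszul_exact (h2 : (2 : k) ≠ 0) (hs : ∀ t, 2 ≤ s t) (hq : 2 ≤ q) (hqd : q ≤ d) :
    IsExC (KK k n q s) (dd k n q hs) q where
  pos := hq
  surj := by
    intro x
    obtain ⟨a, rfl⟩ := CC.mk_surj x
    have := claim1 h2 hs (i := 0) (n := n) (by omega) (by omega) hqd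
      ((LinearMap.range (dd k n q hs 0)).restrictScalars k)
      (fun j b hj _ => ⟨CC.mk _ b, by rw [dd_mk hs (show 0 < d by omega)]; congr 3; exact Fin.ext hj.symm⟩) a
    have he : {g' : Equiv.Perm (Fin d) | StdW n (LL q s 0 ∘ ⇑g'⁻¹) ∧ XiF (LL q s 0 ∘ ⇑g'⁻¹)} = ∅ := by
      rw [Set.eq_empty_iff_forall_notMem]
      rintro g ⟨-, x, -, hx⟩
      exact absurd ((LL_zero hs).1 hx) (by omega)
    rw [he, Set.image_empty, Submodule.span_empty, sup_bot_eq] at this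
    exact this
  ex := by
    intro i hi x
    constructor
    · intro h0
      obtain ⟨a, rfl⟩ := CC.mk_surj x
      have := claim1 h2 hs (i := i + 1) (n := n) (by omega) (by omega) hqd
        ((LinearMap.range (dd k n q hs (i + 1))).restrictScalars k)
        (fun j b hj _ => ⟨CC.mk _ b, by rw [dd_mk hs (show i + 1 < d by omega)]; congr; exact hj.symm⟩) a
      obtain ⟨y, ⟨w, rfl⟩, x, hx, hxy⟩ := Submodule.mem_sup.1 this
      refine ⟨w, ?_⟩
      rw [← hxy] at h0 ⊢
      have hdw : dd k n q hs i (dd k n q hs (i + 1) w) = 0 := by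
        obtain ⟨b, rfl⟩ := CC.mk_surj w
        rw [dd_mk hs (show i + 1 < d by omega), dd_mk hs (show i < d by omega), CC.mk_eq_zero]
        intro m hm
        rw [mul_smul, mul_smul, del_del (q := q) (s := s) hs _ _ rfl hi hm, smul_zero]
      rw [map_add, hdw, zero_add] at h0
      rw [dd_inj_xi hs (by omega) hqd x hx h0, add_zero]
    · rintro ⟨y, rfl⟩
      obtain ⟨b, rfl⟩ := CC.mk_surj y
      rw [dd_mk hs (show i + 1 < d by omega), dd_mk hs (show i < d by omega), CC.mk_eq_zero]
      intro m hm
      rw [mul_smul, mul_smul, del_del (q := q) (s := s) hs _ _ rfl hi hm, smul_zero]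
  inj := by
    rw [injective_iff_map_eq_zero]
    intro x h0
    refine dd_inj_xi hs (by omega) hqd x ?_ h0
    obtain ⟨a, rfl⟩ := CC.mk_surj x
    have := claim1 h2 hs (i := q - 1 + 1) (n := n) (by omega) (by omega) hqd ⊥
      (fun j b hj h => by omega) a
    rwa [bot_sup_eq] at this

end Exact2


set_option linter.unusedSectionVars false
section HomExact

variable {k : Type u} [Field k] {n d : ℕ} {q : ℕ} {s : Fin d → ℕ}

/-- minimal position in the block -/
def GoodP (q : ℕ) {n d : ℕ} (j : Fin d) (v : Fin d → Fin n) (t : Fin d) : Prop :=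
  j ≤ t ∧ t.1 < q ∧ ∀ t' : Fin d, t'.1 < q → v t ≤ v t'

/-- the contracting homotopy -/
noncomputable def psiV (q : ℕ) (j : Fin d) (φ : TensorSpace k n d) : TensorSpace k n d := fun v =>
  open Classical in
  if h : ∃ t, GoodP q j v t then φ (v ∘ ⇑(Equiv.swap j h.choose)) else 0

theorem XL_eq_zero (h2 : (2 : k) ≠ 0) {L : Fin d → ℕ} {φ : TensorSpace k n d} (hφ : φ ∈ XL k n L)
    {a b : Fin d} (hab : a ≠ b) (hL : L a = L b) (ho : isOdd (L a)) {v : Fin d → Fin n}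
    (hv : v a = v b) : φ v = 0 := by
  have h1 := congrFun (hφ a b hab hL) v
  rw [gg_smul_apply, ts_smul, chi, if_pos ho, sg_neg_one] at h1
  have : v ∘ ⇑(Equiv.swap a b) = v := by
    ext x
    rw [Function.comp_apply, Equiv.swap_apply_def]
    split_ifs with h1 h2
    · rw [h1, hv]
    · rw [h2, hv]
    · rfl
  rw [this] at h1
  have h3 : 2 * φ v = 0 := by linear_combination h1
  exact (mul_eq_zero.1 h3).resolve_left h2

theorem psiV_eq {j : Fin d} {φ : TensorSpace k n d}
    (hφ : φ ∈ XL k n (LL q s (j.1 + 1))) {v : Fin d → Fin n} {t : Fin d} (ht : GoodP q j v t) :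
    psiV q j φ v = φ (v ∘ ⇑(Equiv.swap j t)) := by
  have hex : ∃ t, GoodP q j v t := ⟨t, ht⟩
  unfold psiV
  rw [dif_pos hex]
  have h' := hex.choose_spec
  generalize hex.choose = t' at h'
  have hv : v t' = v t := le_antisymm (h'.2.2 t ht.2.1) (ht.2.2 t' h'.2.1)
  by_cases htt : t' = t
  · rw [htt]
  by_cases h1 : t' = j
  · congr 1; ext x
    simp only [Function.comp_apply, Equiv.swap_apply_def]
    grind
  by_cases h2 : t = j
  · congr 1; ext x
    simp only [Function.comp_apply, Equiv.swap_apply_def]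
    grind
  have hj1 : j.1 < t'.1 := lt_of_le_of_ne h'.1 (fun h => h1 (Fin.ext h.symm))
  have hj2 : j.1 < t.1 := lt_of_le_of_ne ht.1 (fun h => h2 (Fin.ext h.symm))
  have e1 : LL q s (j.1 + 1) t' = 1 := LL_mid (by omega) h'.2.1
  have e2 : LL q s (j.1 + 1) t = 1 := LL_mid (by omega) ht.2.1
  have h3 := congrFun (hφ t' t htt (e1.trans e2.symm)) (v ∘ ⇑(Equiv.swap j t))
  rw [e1, chi_one, map_one, one_smul, gg_smul_apply] at h3
  rw [← h3]
  congr 1; ext x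
  simp only [Function.comp_apply, Equiv.swap_apply_def]
  grind

theorem psiV_mem (hs : ∀ t, 2 ≤ s t) {j : Fin d} (hj : j.1 < q) {φ : TensorSpace k n d}
    (hφ : φ ∈ XL k n (LL q s (j.1 + 1))) : psiV q j φ ∈ XL k n (LL q s j.1) := by
  intro a b hab hL
  refine ts_ext fun v => ?_
  rw [gg_smul_apply, ts_smul]
  have hq : ∀ x : Fin d, (Equiv.swap a b x).1 < q ↔ x.1 < q := fun x => by
    rw [← LL_le_one hs hj.le, ← LL_le_one (t := x) hs hj.le]
    rw [show LL q s j.1 (Equiv.swap a b x) = LL q s j.1 x from congrFun (keepL_swap hL) x]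
  have hjj : ∀ x : Fin d, j ≤ Equiv.swap a b x ↔ j ≤ x := fun x => by
    have : (Equiv.swap a b x).1 < j.1 ↔ x.1 < j.1 := by
      rw [← LL_zero (q := q) hs, ← LL_zero (q := q) (t := x) hs]
      rw [show LL q s j.1 (Equiv.swap a b x) = LL q s j.1 x from congrFun (keepL_swap hL) x]
    rw [Fin.le_def, Fin.le_def]; omega
  have hg : ∀ t, GoodP q j v t → GoodP q j (v ∘ ⇑(Equiv.swap a b)) (Equiv.swap a b t) := fun t ht => by
    refine ⟨(hjj t).2 ht.1, (hq t).2 ht.2.1, fun t' ht' => ?_⟩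
    rw [Function.comp_apply, Function.comp_apply, Equiv.swap_apply_self]
    exact ht.2.2 _ ((hq t').2 ht')
  by_cases hex : ∃ t, GoodP q j v t
  · obtain ⟨t, ht⟩ := hex
    rw [psiV_eq hφ (hg t ht), psiV_eq hφ ht]
    by_cases hmid : LL q s j.1 a = 1
    · rw [hmid, chi_one, map_one, one_mul]
      have ha := (LL_one hs).1 hmid
      have hb := (LL_one hs).1 (hL ▸ hmid)
      let κ := Equiv.swap j t * Equiv.swap a b * Equiv.swap j (Equiv.swap a b t)
      have hfix : ∀ x : Fin d, (x.1 < j.1 + 1 ∨ ¬ x.1 < q) → κ x = x := by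
        intro x hx
        have h1 := ht.1
        have h2 := ht.2.1
        rw [Fin.le_def] at h1
        by_cases hxj : x = j
        · rw [hxj]; simp [κ]
        · have : x ≠ t ∧ x ≠ a ∧ x ≠ b := by
            refine ⟨?_, ?_, ?_⟩ <;> (rintro rfl; apply hxj; apply Fin.ext; omega)
          have h4 : x ≠ Equiv.swap a b t := fun h => this.1 (by
            rw [← Equiv.swap_apply_self a b t, ← h, Equiv.swap_apply_of_ne_of_ne this.2.1 this.2.2])
          simp only [κ, Equiv.Perm.mul_apply]
          rw [Equiv.swap_apply_of_ne_of_ne hxj h4, Equiv.swap_apply_of_ne_of_ne this.2.1 this.2.2,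
            Equiv.swap_apply_of_ne_of_ne hxj this.1]
      have hkeep : LL q s (j.1 + 1) ∘ κ = LL q s (j.1 + 1) := by
        ext x
        rw [Function.comp_apply]
        by_cases hx : x.1 < j.1 + 1 ∨ ¬ x.1 < q
        · rw [hfix x hx]
        · have hx' : ¬ ((κ x).1 < j.1 + 1 ∨ ¬ (κ x).1 < q) := fun h => hx (by
            have := κ.injective (hfix _ h)
            rwa [this] at h)
          rw [LL_mid (by omega) (by omega), LL_mid (by omega) (by omega)]
      have h3 := congrFun (lemG hkeep hφ) (v ∘ ⇑(Equiv.swap j t))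
      rw [eps_of_fix_odd (fun x hx => ?_) hkeep, map_one, one_smul, gg_smul_apply] at h3
      · rw [← h3]
        congr 1; ext x
        simp [κ]
      · by_cases hx' : x.1 < j.1 + 1 ∨ ¬ x.1 < q
        · exact hfix x hx'
        · rw [LL_mid (by omega) (by omega)] at hx
          simp [isOdd] at hx
    · have hno : ∀ x : Fin d, LL q s j.1 x = LL q s j.1 a → ¬ (j ≤ x ∧ x.1 < q) := by
        intro x hx h
        have h1 := h.1
        rw [Fin.le_def] at h1
        rw [LL_mid (by omega) h.2] at hx
        exact hmid hx.symm
      have hae : LL q s (j.1 + 1) a = LL q s j.1 a := by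
        have h1 := hno a rfl
        rw [Fin.le_def] at h1
        unfold LL; grind
      have hbe : LL q s (j.1 + 1) b = LL q s j.1 b := by
        have h1 := hno b hL.symm
        rw [Fin.le_def] at h1
        unfold LL; grind
      have ht' : t ≠ a ∧ t ≠ b := ⟨by rintro rfl; exact hno t rfl ⟨ht.1, ht.2.1⟩,
        by rintro rfl; exact hno t hL.symm ⟨ht.1, ht.2.1⟩⟩
      have hj' : j ≠ a ∧ j ≠ b := ⟨by rintro rfl; exact hno j rfl ⟨le_rfl, hj⟩,
        by rintro rfl; exact hno j hL.symm ⟨le_rfl, hj⟩⟩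
      have h3 := congrFun (hφ a b hab (by rw [hae, hbe, hL])) (v ∘ ⇑(Equiv.swap j t))
      rw [hae, gg_smul_apply, ts_smul] at h3
      rw [← h3, Equiv.swap_apply_of_ne_of_ne ht'.1 ht'.2, Function.comp_assoc, Function.comp_assoc,
        ← Equiv.Perm.coe_mul, ← Equiv.Perm.coe_mul, swap_conj, Equiv.swap_apply_of_ne_of_ne hj'.1 hj'.2,
        Equiv.swap_apply_of_ne_of_ne ht'.1 ht'.2]
  · have hex' : ¬ ∃ t, GoodP q j (v ∘ ⇑(Equiv.swap a b)) t := by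
      rintro ⟨t, h1, h2, h3⟩
      refine hex ⟨Equiv.swap a b t, (hjj t).2 h1, (hq t).2 h2, fun t' ht' => ?_⟩
      have := h3 (Equiv.swap a b t') ((hq t').2 ht')
      rwa [Function.comp_apply, Function.comp_apply, Equiv.swap_apply_self] at this
    unfold psiV
    rw [dif_neg hex, dif_neg hex', mul_zero]

theorem del_psiV (h2 : (2 : k) ≠ 0) (hs : ∀ t, 2 ≤ s t) {j : Fin d} (hj : j.1 < q) {φ : TensorSpace k n d}
    (hφ : φ ∈ XL k n (LL q s (j.1 + 1)))
    (hd : ∀ j' : Fin d, j'.1 = j.1 + 1 → j'.1 < q → del k n j' • φ = 0) :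
    del k n j • psiV q j φ = φ := by
  classical
  have hF := Submodule.sub_mem _ (del_mem hs j (psiV_mem hs hj hφ)) hφ
  rw [← sub_eq_zero]
  set F := del k n j • psiV q j φ - φ with hFdef
  have hexp : ∀ v, F v = psiV q j φ v - ∑ t ∈ Finset.Iio j, psiV q j φ (v ∘ ⇑(Equiv.swap j t)) - φ v := by
    intro v
    rw [hFdef, del_smul, ts_sub, ts_sub, ts_sum]
    simp only [gg_smul_apply]
  have caseA : ∀ v : Fin d → Fin n, (∀ t' : Fin d, t'.1 < q → v j ≤ v t') → F v = 0 := by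
    intro v hv
    have hgood : GoodP q j v j := ⟨le_rfl, hj, hv⟩
    have h1 : psiV q j φ v = φ v := by
      rw [psiV_eq hφ hgood, Equiv.swap_self]; rfl
    rw [hexp, h1, Finset.sum_eq_zero, sub_zero, sub_self]
    intro t ht
    rw [Finset.mem_Iio] at ht
    by_cases hex : ∃ t', GoodP q j (v ∘ ⇑(Equiv.swap j t)) t'
    · obtain ⟨t', ht'⟩ := hex
      rw [psiV_eq hφ ht']
      have htj : t.1 < j.1 + 1 := by rw [Fin.lt_def] at ht; omega
      refine XL_eq_zero h2 hφ ht.ne (by rw [LL_lt htj, LL_lt (Nat.lt_succ_self _)])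
        (by rw [LL_lt htj]; exact Or.inl rfl) ?_
      have e1 : (v ∘ ⇑(Equiv.swap j t)) t = v j := by simp
      have e2 : (v ∘ ⇑(Equiv.swap j t)) t' = v j := by
        refine le_antisymm ?_ ?_
        · rw [← e1]
          exact ht'.2.2 t (lt_trans ht hj)
        · refine hv _ ?_
          rw [Equiv.swap_apply_def]
          split_ifs
          · exact lt_trans ht hj
          · exact hj
          · exact ht'.2.1
      rw [Function.comp_apply, Equiv.swap_apply_of_ne_of_ne ht.ne (ht.trans_le ht'.1).ne, e1,
        Function.comp_apply, Equiv.swap_apply_left, e2]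
    · unfold psiV
      rw [dif_neg hex]
  refine ts_ext fun v => ?_
  rw [ts_zero]
  obtain ⟨t₀, ht₀, hmin⟩ := Finset.exists_min_image (Finset.univ.filter fun t : Fin d => t.1 < q) v
    ⟨j, by simp [hj]⟩
  simp only [Finset.mem_filter, Finset.mem_univ, true_and] at ht₀ hmin
  by_cases hlt : t₀.1 < j.1
  · have htj : t₀ ≠ j := fun h => by rw [h] at hlt; exact lt_irrefl _ hlt
    have h1 := congrFun (hF t₀ j htj (by rw [LL_lt (by omega), LL_lt (by omega)])) v
    rw [gg_smul_apply, ts_smul] at h1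
    rw [caseA] at h1
    · exact (mul_eq_zero.1 h1.symm).resolve_left (sg_ne _)
    · intro t' ht'
      rw [Function.comp_apply, Equiv.swap_apply_right, Function.comp_apply]
      refine hmin _ ?_
      rw [Equiv.swap_apply_def]
      split_ifs
      · exact hj
      · exact ht₀
      · exact ht'
  by_cases heq : t₀ = j
  · subst heq
    exact caseA v hmin
  have hgt : j.1 < t₀.1 := lt_of_le_of_ne (not_lt.1 hlt) (fun h => heq (Fin.ext h.symm))
  let j' : Fin d := ⟨j.1 + 1, by omega⟩
  have hj' : j'.1 < q := lt_of_le_of_lt hgt ht₀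
  have hd' := congrFun (hd j' rfl hj') (v ∘ ⇑(Equiv.swap j' t₀))
  rw [del_smul, ts_sub, ts_sum, ts_zero] at hd'
  simp only [gg_smul_apply] at hd'
  have hIio : Finset.Iio j' = insert j (Finset.Iio j) := by
    ext x
    rw [Finset.mem_Iio, Finset.mem_insert, Finset.mem_Iio, Fin.lt_def, Fin.lt_def, Fin.ext_iff]
    change x.1 < j.1 + 1 ↔ _
    omega
  rw [hIio, Finset.sum_insert (by simp)] at hd'
  have hsym : ∀ w : Fin d → Fin n, φ (w ∘ ⇑(Equiv.swap j' t₀)) = φ w := by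
    intro w
    by_cases hjt : j' = t₀
    · rw [hjt, Equiv.swap_self]; rfl
    · have e1 : LL q s (j.1 + 1) j' = 1 := LL_mid (lt_irrefl _) hj'
      have e2 : LL q s (j.1 + 1) t₀ = 1 := LL_mid (by omega) ht₀
      have := congrFun (hφ j' t₀ hjt (e1.trans e2.symm)) w
      rwa [gg_smul_apply, e1, chi_one, map_one, one_smul] at this
  have hjj' : j ≠ j' := fun h => by have := congrArg Fin.val h; simp [j'] at this
  have hgood : GoodP q j v t₀ := ⟨hgt.le, ht₀, hmin⟩
  have e0 : φ ((v ∘ ⇑(Equiv.swap j' t₀)) ∘ ⇑(Equiv.swap j' j)) = φ (v ∘ ⇑(Equiv.swap j t₀)) := by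
    rw [← hsym (v ∘ ⇑(Equiv.swap j t₀))]
    congr 1; ext x
    simp only [Function.comp_apply, Equiv.swap_apply_def]
    grind
  have e1 : ∀ t ∈ Finset.Iio j, φ ((v ∘ ⇑(Equiv.swap j' t₀)) ∘ ⇑(Equiv.swap j' t)) =
      - psiV q j φ (v ∘ ⇑(Equiv.swap j t)) := by
    intro t ht
    rw [Finset.mem_Iio] at ht
    have htj : t.1 < j.1 := ht
    have hne1 : t ≠ t₀ := fun h => by rw [h] at htj; omega
    have hne2 : t ≠ j' := fun h => by rw [h] at htj; simp [j'] at htj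
    have hne3 : j ≠ t₀ := fun h => heq h.symm
    rw [psiV_eq (t := t₀) hφ]
    · have h3 := congrFun (hφ j t ht.ne' (by rw [LL_lt (by omega), LL_lt (by omega)]))
        ((v ∘ ⇑(Equiv.swap j t)) ∘ ⇑(Equiv.swap j t₀))
      rw [gg_smul_apply, ts_smul, LL_lt (by omega), chi_zero, sg_neg_one, neg_one_mul] at h3
      rw [← h3, ← hsym]
      congr 1; ext x
      simp only [Function.comp_apply, Equiv.swap_apply_def]
      grind
    · refine ⟨hgt.le, ht₀, fun t' ht' => ?_⟩
      rw [Function.comp_apply, Equiv.swap_apply_of_ne_of_ne heq hne1.symm, Function.comp_apply]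
      refine hmin _ ?_
      rw [Equiv.swap_apply_def]
      split_ifs
      · omega
      · exact hj
      · exact ht'
  rw [hsym, e0, Finset.sum_congr rfl e1, Finset.sum_neg_distrib] at hd'
  rw [hexp, psiV_eq hφ hgood]
  linear_combination -hd'

/-- the Hom condition for maps into tensor space -/
theorem hom_exact (h2 : (2 : k) ≠ 0) (hs : ∀ t, 2 ≤ s t) (hqd : q ≤ d) {m : ℕ} (hm : m < q)
    (f : KK k n q s (m + 1) →ₗ[LambdaAlgebra k n d] TensorSpace k n d)
    (hf : m + 1 < q → f ∘ₗ dd k n q hs (m + 1) = 0) :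
    ∃ g : KK k n q s m →ₗ[LambdaAlgebra k n d] TensorSpace k n d, g ∘ₗ dd k n q hs m = f := by
  have hφ := CC.hom_mem f
  let j : Fin d := ⟨m, by omega⟩
  have h1 := del_psiV h2 hs (j := j) hm hφ (fun j' hj' hjq => by
    have hj'' : j'.1 = m + 1 := hj'
    have h3 := LinearMap.congr_fun (hf (by omega)) (CC.mk _ 1)
    rw [LinearMap.comp_apply, dd_mk hs (show m + 1 < d by omega), one_mul, CC.mk_smul_one, map_smul,
      LinearMap.zero_apply] at h3
    have : j' = ⟨m + 1, by omega⟩ := Fin.ext hj''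
    rw [this]; exact h3)
  refine ⟨CC.toM _ (psiV_mem hs (j := j) hm hφ), CC.hom_ext ?_⟩
  rw [LinearMap.comp_apply, dd_mk hs (show m < d by omega), one_mul, CC.toM_mk]
  exact h1

end HomExact


/-! ### Projectivity and retracts -/

section Proj

variable {k : Type u} [Field k] {n d : ℕ}

/-- stabilizer of a label -/
def KL {γ : Type*} [DecidableEq γ] (L : Fin d → γ) : Finset (Equiv.Perm (Fin d)) :=
  Finset.univ.filter fun κ => L ∘ κ = L

theorem mem_KL {γ : Type*} [DecidableEq γ] {L : Fin d → γ} {κ : Equiv.Perm (Fin d)} :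
    κ ∈ KL L ↔ L ∘ κ = L := by
  simp [KL]

theorem KL_card {γ : Type*} [DecidableEq γ] (L : Fin d → γ) : (KL L).card =
    ∏ i ∈ Finset.univ.image L, (Fintype.card ({a // L a = i})).factorial := by
  rw [← DomMulAct.stabilizer_card', Fintype.card_subtype]
  rfl

/-- symmetrizer -/
noncomputable def EL (k : Type u) [Field k] (n : ℕ) {d : ℕ} (L : Fin d → ℕ) : LambdaAlgebra k n d :=
  ∑ κ ∈ KL L, sg k (eps L κ) • gg k n d κ

theorem EL_smul (L : Fin d → ℕ) (m : TensorSpace k n d) :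
    EL k n L • m = ∑ κ ∈ KL L, sg k (eps L κ) • gg k n d κ • m := by
  rw [EL, Finset.sum_smul]
  exact Finset.sum_congr rfl fun κ _ => smul_assoc _ _ _

theorem EL_mem (L : Fin d → ℕ) (m : TensorSpace k n d) : EL k n L • m ∈ XL k n L := by
  refine mem_XL_of_keep fun κ hκ => ?_
  rw [EL_smul, Finset.smul_sum, Finset.smul_sum]
  refine Finset.sum_bij (fun τ _ => κ * τ) (fun τ hτ => ?_) (fun a _ b _ h => mul_left_cancel h)
    (fun τ hτ => ⟨κ⁻¹ * τ, ?_, by simp⟩) (fun τ hτ => ?_)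
  · exact mem_KL.2 (keepL_mul hκ (mem_KL.1 hτ))
  · exact mem_KL.2 (keepL_mul (keepL_inv hκ) (mem_KL.1 hτ))
  · rw [eps_mul hκ (mem_KL.1 hτ), map_mul (sg k), map_mul (gg k n d), mul_smul, smul_comm, ← mul_smul (sg k (eps L κ)),
      sg_sq, one_smul, mul_smul]

theorem EL_fix {L : Fin d → ℕ} {m : TensorSpace k n d} (hm : m ∈ XL k n L) :
    EL k n L • m = ((KL L).card : k) • m := by
  rw [EL_smul]
  have : ∀ κ ∈ KL L, sg k (eps L κ) • gg k n d κ • m = m := fun κ hκ => by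
    rw [lemG (mem_KL.1 hκ) hm, ← mul_smul, sg_sq, one_smul]
  rw [Finset.sum_congr rfl this, Finset.sum_const, Nat.cast_smul_eq_nsmul]

/-- idempotent -/
noncomputable def eL (k : Type u) [Field k] (n : ℕ) {d : ℕ} (L : Fin d → ℕ) : LambdaAlgebra k n d :=
  ((KL L).card : k)⁻¹ • EL k n L

theorem eL_mem (L : Fin d → ℕ) (m : TensorSpace k n d) : eL k n L • m ∈ XL k n L := by
  rw [eL, smul_assoc]
  exact Submodule.smul_mem _ _ (EL_mem L m)

theorem eL_fix {L : Fin d → ℕ} (h : ((KL L).card : k) ≠ 0) {m : TensorSpace k n d}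
    (hm : m ∈ XL k n L) : eL k n L • m = m := by
  rw [eL, smul_assoc, EL_fix hm, ← mul_smul, inv_mul_cancel₀ h, one_smul]

/-- the idempotent preserves invariant subspaces -/
theorem eL_inv {L L' : Fin d → ℕ} (h : ∀ κ : Equiv.Perm (Fin d), L ∘ κ = L →
    ∀ a b, a ≠ b → L' a = L' b → κ a = a ∧ κ b = b) {m : TensorSpace k n d} (hm : m ∈ XL k n L') :
    eL k n L • m ∈ XL k n L' := by
  rw [eL, smul_assoc, EL_smul]
  refine Submodule.smul_mem _ _ (Submodule.sum_mem _ fun κ hκ => Submodule.smul_mem _ _ ?_)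
  intro a b hab hL
  obtain ⟨h1, h2⟩ := h κ (mem_KL.1 hκ) a b hab hL
  have e : Equiv.swap a b * κ = κ * Equiv.swap a b := by
    have := Equiv.swap_apply_apply κ a b
    rw [h1, h2] at this
    conv_lhs => rw [this]
    simp
  rw [← mul_smul, ← map_mul, e, map_mul (gg k n d), mul_smul, hm a b hab hL, smul_comm]

theorem card_ne_zero {p : ℕ} (hp : p.Prime) [CharP k p] {γ : Type*} [DecidableEq γ] {L : Fin d → γ}
    (h : ∀ i, Fintype.card {a // L a = i} < p) : ((KL L).card : k) ≠ 0 := by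
  rw [Ne, CharP.cast_eq_zero_iff k p, KL_card, Prime.dvd_finsetProd_iff hp.prime]
  rintro ⟨i, -, hi⟩
  rw [hp.dvd_factorial] at hi
  exact absurd (h i) (by omega)

/-- comparison of labels along a permutation -/
theorem XL_perm {L L' : Fin d → ℕ} (g : Equiv.Perm (Fin d))
    (h : ∀ a b, a ≠ b → L' (g a) = L' (g b) → L a = L b ∧ (isOdd (L a) ↔ isOdd (L' (g a))))
    {m : TensorSpace k n d} (hm : m ∈ XL k n L) : gg k n d g • m ∈ XL k n L' := by
  intro a b hab hL
  obtain ⟨a, rfl⟩ := g.surjective a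
  obtain ⟨b, rfl⟩ := g.surjective b
  have hab' : a ≠ b := fun h => hab (by rw [h])
  obtain ⟨h1, h2⟩ := h a b hab' hL
  have e : Equiv.swap (g a) (g b) * g = g * Equiv.swap a b := by
    rw [Equiv.swap_apply_apply]; simp
  rw [← mul_smul, ← map_mul, e, map_mul (gg k n d), mul_smul, hm a b hab' h1, smul_comm]
  simp only [chi, h2]

theorem EV_perm {L L' : Fin d → ℕ} (g : Equiv.Perm (Fin d))
    (h : ∀ a b, a ≠ b → (L' (g a) = L' (g b) ↔ L a = L b) ∧
      (L a = L b → (isOdd (L a) ↔ isOdd (L' (g a)))))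
    {Y : Type u} [AddCommGroup Y] [Module (LambdaAlgebra k n d) Y] {t : ℕ}
    (he : EV (LambdaAlgebra k n d) t (CC (XL k n L)) Y) :
    EV (LambdaAlgebra k n d) t (CC (XL k n L')) Y := by
  refine EV.of_retract
    (CC.rmul (gg k n d g) fun m hm => XL_perm g (fun a b hab hL => ?_) hm)
    (CC.rmul (gg k n d g⁻¹) fun m hm => XL_perm g⁻¹ (fun a b hab hL => ?_) hm) (fun x => ?_) he
  · have := h a b hab
    exact ⟨this.1.1 hL, this.2 (this.1.1 hL)⟩
  · have := h (g⁻¹ a) (g⁻¹ b) (fun h => hab (g⁻¹.injective h))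
    simp only [show ∀ x, g (g⁻¹ x) = x by simp] at this
    exact ⟨this.1.2 hL, (this.2 hL).symm⟩
  · obtain ⟨a, rfl⟩ := CC.mk_surj x
    rw [CC.rmul_mk, CC.rmul_mk, mul_assoc, ← map_mul, mul_inv_cancel, map_one, mul_one]

end Proj

section Spec

variable {k : Type u} [Field k] {p : ℕ}

/-- labels of the second half -/
def sz {d : ℕ} : Fin d → ℕ := fun t => t.1 + 4
def so {d : ℕ} : Fin d → ℕ := fun _ => 2
def se {d : ℕ} : Fin d → ℕ := fun _ => 3
theorem sz_ge {d : ℕ} (t : Fin d) : 2 ≤ sz t := by unfold sz; omega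
theorem so_ge {d : ℕ} (t : Fin d) : 2 ≤ so t := le_refl 2
theorem se_ge {d : ℕ} (t : Fin d) : 2 ≤ se t := by unfold se; omega

/-- label free on the first half -/
def Lz (p : ℕ) {d : ℕ} (c : ℕ) : Fin d → ℕ := fun t => if t.1 < p then t.1 + 4 else c

/-- exchange of the halves -/
def hsw (p : ℕ) : Equiv.Perm (Fin (2 * p)) :=
  Function.Involutive.toPerm (fun t => if h : t.1 < p then ⟨t.1 + p, by omega⟩ else ⟨t.1 - p, by omega⟩)
    (fun t => by
      apply Fin.ext
      have := t.2
      dsimp only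
      split_ifs <;> grind)

theorem hsw_val (t : Fin (2 * p)) : (hsw p t).1 = if t.1 < p then t.1 + p else t.1 - p := by
  show (if h : t.1 < p then (⟨t.1 + p, by omega⟩ : Fin (2 * p)) else ⟨t.1 - p, by omega⟩).1 = _
  split_ifs <;> rfl

theorem card_fiber_lt {d : ℕ} {γ : Type*} {L : Fin d → γ} {j : γ} [Fintype {a // L a = j}] (lo hi : ℕ) (h : hi - lo < p)
    (hL : ∀ a, L a = j → lo ≤ a.1 ∧ a.1 < hi) : Fintype.card {a // L a = j} < p := by
  refine lt_of_le_of_lt (Fintype.card_le_of_injective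
    (fun a : {a // L a = j} => (⟨a.1.1 - lo, by have := hL a.1 a.2; omega⟩ : Fin (hi - lo))) ?_) (by simpa using h)
  rintro ⟨a, ha⟩ ⟨b, hb⟩ hab
  have h1 := hL a ha
  have h2 := hL b hb
  have h3 := congrArg Fin.val hab
  apply Subtype.ext
  apply Fin.ext
  dsimp only at h3 ⊢
  omega

theorem KL_sz (hp : p.Prime) [CharP k p] {d : ℕ} {i : ℕ} (hi : 1 ≤ i) (hip : i < p) :
    ((KL (LL p (sz (d := d)) i)).card : k) ≠ 0 := by
  refine card_ne_zero hp fun j => ?_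
  have hp2 := hp.two_le
  rcases Nat.lt_or_ge j 2 with hj | hj
  · obtain rfl | rfl : j = 0 ∨ j = 1 := by omega
    · exact card_fiber_lt 0 i (by omega) (fun a ha => ⟨by omega, (LL_zero sz_ge).1 ha⟩)
    · refine card_fiber_lt i p (by omega) (fun a ha => ?_)
      have := (LL_one sz_ge).1 ha
      omega
  · refine card_fiber_lt (j - 4) (j - 3) (by omega) (fun a ha => ?_)
    unfold LL sz at ha
    grind

theorem EV_sz_mid (hp : p.Prime) [CharP k p] {n d : ℕ} {i : ℕ} (hi : 1 ≤ i) (hip : i < p)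
    {Y : Type u} [AddCommGroup Y] [Module (LambdaAlgebra k n d) Y] {t : ℕ} (ht : 1 ≤ t) :
    EV (LambdaAlgebra k n d) t (KK k n p (sz (d := d)) i) Y :=
  CC.EV_of_proj ht (eL k n _) (eL_mem _) (fun _ hm => eL_fix (KL_sz hp hi hip) hm)

theorem EV_mid_retract (hp : p.Prime) [CharP k p] {n d : ℕ} {i : ℕ} (hi : 1 ≤ i) (hip : i < p)
    {c : ℕ} (hc : c = 2 ∨ c = 3)
    {Y : Type u} [AddCommGroup Y] [Module (LambdaAlgebra k n d) Y] {t : ℕ}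
    (he : EV (LambdaAlgebra k n d) t (CC (XL k n (Lz p (d := d) c))) Y) :
    EV (LambdaAlgebra k n d) t (KK k n p (fun _ : Fin d => c) i) Y := by
  have hsub : ∀ m ∈ XL k n (LL p (fun _ : Fin d => c) i), m ∈ XL k n (LL p (sz (d := d)) i) := by
    intro m hm a b hab hL
    have h1 : LL p (fun _ : Fin d => c) i a = LL p (fun _ : Fin d => c) i b ∧
      LL p (fun _ : Fin d => c) i a = LL p (sz (d := d)) i a := by
      have : a.1 ≠ b.1 := fun h => hab (Fin.ext h)
      unfold LL sz at *
      grind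
    rw [hm a b hab h1.1, h1.2]
  refine CC.EV_of_retract (eL k n (LL p (sz (d := d)) i)) ?_ ?_ ?_ he
  · intro m hm a b hab hL
    have h1 : LL p (fun _ : Fin d => c) i a = LL p (fun _ : Fin d => c) i b ∧
      LL p (fun _ : Fin d => c) i a = Lz p c a := by
      have : a.1 ≠ b.1 := fun h => hab (Fin.ext h)
      unfold LL Lz at *
      grind
    rw [hm a b hab h1.1, h1.2]
  · intro m hm
    have h1 := eL_mem (LL p (sz (d := d)) i) m
    have h2 : eL k n (LL p (sz (d := d)) i) • m ∈ XL k n (Lz p c) := by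
      refine eL_inv (fun κ hκ a b hab hL => ?_) hm
      have h3 : ∀ a : Fin d, ¬ a.1 < p → κ a = a := fun a ha => by
        have := congrFun hκ a
        apply Fin.ext
        simp only [Function.comp_apply] at this
        unfold LL sz at this
        grind
      have : a.1 ≠ b.1 := fun h => hab (Fin.ext h)
      unfold Lz at hL
      exact ⟨h3 a (by grind), h3 b (by grind)⟩
    intro a b hab hL
    by_cases ha : a.1 < p
    · have : LL p (sz (d := d)) i a = LL p (sz (d := d)) i b ∧
        LL p (fun _ : Fin d => c) i a = LL p (sz (d := d)) i a := by
        unfold LL sz at *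
        grind
      rw [h1 a b hab this.1, this.2]
    · have : Lz p c a = Lz p c b ∧ LL p (fun _ : Fin d => c) i a = Lz p c a := by
        unfold LL Lz at *
        grind
      rw [h2 a b hab this.1, this.2]
  · exact fun m hm => eL_fix (KL_sz hp hi hip) (hsub m hm)

theorem EV_se_mid (hp : p.Prime) [CharP k p] {n : ℕ} {i : ℕ} (hi : 1 ≤ i) (hip : i < p)
    {Y : Type u} [AddCommGroup Y] [Module (LambdaAlgebra k n (2 * p)) Y] {t : ℕ}
    (he : EV (LambdaAlgebra k n (2 * p)) t (KK k n p (sz (d := 2 * p)) 0) Y) :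
    EV (LambdaAlgebra k n (2 * p)) t (KK k n p (se (d := 2 * p)) i) Y := by
  refine EV_mid_retract hp hi hip (Or.inr rfl) (EV_perm (hsw p) (fun a b hab => ?_) he)
  have h1 := hsw_val a
  have h2 := hsw_val b
  have h3 : a.1 ≠ b.1 := fun h => hab (Fin.ext h)
  have h4 := a.2
  have h5 := b.2
  unfold Lz LL sz isOdd
  grind

theorem EV_so_mid (hp : p.Prime) [CharP k p] {n : ℕ} {i : ℕ} (hi : 1 ≤ i) (hip : i < p)
    {Y : Type u} [AddCommGroup Y] [Module (LambdaAlgebra k n (2 * p)) Y] {t : ℕ}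
    (he : EV (LambdaAlgebra k n (2 * p)) t (KK k n p (sz (d := 2 * p)) p) Y) :
    EV (LambdaAlgebra k n (2 * p)) t (KK k n p (so (d := 2 * p)) i) Y := by
  refine EV_mid_retract hp hi hip (Or.inl rfl) (EV_perm (hsw p) (fun a b hab => ?_) he)
  have h1 := hsw_val a
  have h2 := hsw_val b
  have h3 : a.1 ≠ b.1 := fun h => hab (Fin.ext h)
  have h4 := a.2
  have h5 := b.2
  unfold Lz LL sz isOdd
  grind

theorem EV_se_p {n : ℕ}
    {Y : Type u} [AddCommGroup Y] [Module (LambdaAlgebra k n (2 * p)) Y] {t : ℕ}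
    (he : EV (LambdaAlgebra k n (2 * p)) t (KK k n p (so (d := 2 * p)) 0) Y) :
    EV (LambdaAlgebra k n (2 * p)) t (KK k n p (se (d := 2 * p)) p) Y := by
  refine EV_perm (hsw p) (fun a b hab => ?_) he
  have h1 := hsw_val a
  have h2 := hsw_val b
  have h3 : a.1 ≠ b.1 := fun h => hab (Fin.ext h)
  have h4 := a.2
  have h5 := b.2
  unfold LL so se isOdd
  grind

/-- the Garnir type relation coming from having only `p` colors -/
theorem garnir (h2 : (2 : k) ≠ 0) {L : Fin (2 * p) → ℕ} (T : Finset (Fin (2 * p))) (hT : p ≤ T.card)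
    {o : ℕ} (ho : isOdd o) (hL : ∀ t ∈ T, L t = o) {m : TensorSpace k p (2 * p)}
    (hm : m ∈ XL k p L) {c : Fin (2 * p)} (hc : c ∉ T) :
    ∑ t ∈ T, gg k p (2 * p) (Equiv.swap t c) • m = m := by
  classical
  refine ts_ext fun v => ?_
  rw [ts_sum]
  simp only [gg_smul_apply]
  have hz : ∀ a b : Fin (2 * p), a ∈ T → b ∈ T → a ≠ b → ∀ w : Fin (2 * p) → Fin p, w a = w b → m w = 0 :=
    fun a b ha hb hab w hw => XL_eq_zero h2 hm hab (by rw [hL a ha, hL b hb])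
      (by rw [hL a ha]; exact ho) hw
  by_cases hv : ∃ a ∈ T, ∃ b ∈ T, a ≠ b ∧ v a = v b
  · obtain ⟨a, ha, b, hb, hab, hvab⟩ := hv
    rw [hz a b ha hb hab v hvab, Finset.sum_eq_add_of_mem a b ha hb hab]
    · have e : v ∘ ⇑(Equiv.swap b c) = (v ∘ ⇑(Equiv.swap a c)) ∘ ⇑(Equiv.swap a b) := by
        have h1 : a ≠ c := fun h => hc (h ▸ ha)
        have h2 : b ≠ c := fun h => hc (h ▸ hb)
        ext x
        simp only [Function.comp_apply, Equiv.swap_apply_def]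
        grind
      have h1 := congrFun (hm a b hab (by rw [hL a ha, hL b hb])) (v ∘ ⇑(Equiv.swap a c))
      rw [gg_smul_apply, ← e, ts_smul, hL a ha, chi, if_pos ho, sg_neg_one] at h1
      rw [h1]; ring
    · intro t ht hne
      refine hz a b ha hb hab _ ?_
      have h1 : a ≠ c := fun h => hc (h ▸ ha)
      have h2 : b ≠ c := fun h => hc (h ▸ hb)
      rw [Function.comp_apply, Function.comp_apply, Equiv.swap_apply_of_ne_of_ne hne.1.symm h1,
        Equiv.swap_apply_of_ne_of_ne hne.2.symm h2, hvab]
  · push Not at hv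
    have hinj : Set.InjOn v T := fun a ha b hb hab => by
      by_contra hne
      exact hv a ha b hb hne hab
    have himg : T.image v = Finset.univ := by
      apply Finset.eq_univ_of_card
      rw [Finset.card_image_of_injOn hinj, Fintype.card_fin]
      apply le_antisymm _ hT
      rw [← Finset.card_image_of_injOn hinj]
      exact (Finset.card_le_univ _).trans (by simp)
    obtain ⟨t0, ht0, hvt⟩ := Finset.mem_image.1 (himg ▸ Finset.mem_univ (v c))
    rw [Finset.sum_eq_single_of_mem t0 ht0]
    · congr 1
      ext x
      simp only [Function.comp_apply, Equiv.swap_apply_def]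
      grind
    · intro t ht hne
      refine hz t t0 ht ht0 hne _ ?_
      have h1 : t0 ≠ c := fun h => hc (h ▸ ht0)
      rw [Function.comp_apply, Function.comp_apply, Equiv.swap_apply_left,
        Equiv.swap_apply_of_ne_of_ne hne.symm h1, hvt]

theorem EV_sz_p (hp : p.Prime) [CharP k p] (h2 : (2 : k) ≠ 0) 
    {Y : Type u} [AddCommGroup Y] [Module (LambdaAlgebra k p (2 * p)) Y] {t : ℕ} (ht : 1 ≤ t) :
    EV (LambdaAlgebra k p (2 * p)) t (KK k p p (sz (d := 2 * p)) p) Y := by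
  have hp2 := hp.two_le
  obtain ⟨r, hpr⟩ : ∃ r, p = r + 1 := ⟨p - 1, by omega⟩
  let j : Fin (2 * p) := ⟨r, by omega⟩
  let c : Fin (2 * p) := ⟨p, by omega⟩
  have hjc : j ≠ c := fun h => by have := congrArg Fin.val h; simp only [j, c] at this; omega
  refine CC.EV_of_proj ht (del k p j * (gg k p (2 * p) (Equiv.swap j c) * eL k p (LL p sz r))) ?_ ?_
  · intro m
    rw [mul_smul]
    have hjp : p = j.1 + 1 := hpr
    suffices h : (gg k p (2 * p) (Equiv.swap j c) * eL k p (LL p sz r)) • m ∈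
        XL k p (LL p (sz (d := 2 * p)) j.1) by
      have := del_mem sz_ge j h
      rwa [← hjp] at this
    rw [mul_smul]
    refine XL_perm _ (fun a b hab hL => ?_) (eL_mem _ m)
    have h3 : a.1 ≠ b.1 := fun h => hab (Fin.ext h)
    have hj : j.1 = r := rfl
    have hc : c.1 = p := rfl
    have e : ∀ x, (Equiv.swap j c x).1 = if x.1 = r then p else if x.1 = p then r else x.1 := by
      intro x
      rw [Equiv.swap_apply_def]
      simp only [Fin.ext_iff, hj, hc]
      grind
    have e1 := e a
    have e2 := e b
    unfold LL sz isOdd at *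
    grind
  · intro m hm
    have hm' : m ∈ XL k p (LL p (sz (d := 2 * p)) r) := by
      intro a b hab hL
      have h1 : LL p (sz (d := 2 * p)) p a = LL p (sz (d := 2 * p)) p b ∧
        LL p (sz (d := 2 * p)) p a = LL p (sz (d := 2 * p)) r a := by
        have : a.1 ≠ b.1 := fun h => hab (Fin.ext h)
        unfold LL sz at *
        grind
      rw [hm a b hab h1.1, h1.2]
    rw [mul_smul, mul_smul, eL_fix (KL_sz hp (by omega) (by omega)) hm', del_smul]
    have hmem : ∀ t : Fin (2 * p), t ∈ Finset.Iio j → t.1 < r := fun t ht => (show t < j from Finset.mem_Iio.1 ht)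
    have h1 : ∀ t ∈ Finset.Iio j, gg k p (2 * p) (Equiv.swap j t) • gg k p (2 * p) (Equiv.swap j c) • m =
        - gg k p (2 * p) (Equiv.swap t c) • m := by
      intro t ht
      have htr := hmem t ht
      have htj : t ≠ j := fun h => by rw [h] at htr; exact absurd htr (lt_irrefl _)
      have htc : t ≠ c := fun h => by rw [h] at htr; simp only [c] at htr; omega
      have e : Equiv.swap j t * Equiv.swap j c = Equiv.swap t c * Equiv.swap j t := by
        rw [swap_conj, Equiv.swap_apply_left, Equiv.swap_apply_of_ne_of_ne hjc.symm htc.symm]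
      have hL1 : LL p (sz (d := 2 * p)) p j = 0 := LL_lt (show r < p by omega)
      have hL2 : LL p (sz (d := 2 * p)) p t = 0 := LL_lt (by omega)
      rw [← mul_smul, ← map_mul, e, map_mul (gg k p (2 * p)), mul_smul, hm j t htj.symm (by rw [hL1, hL2]),
        hL1, chi_zero, sg_neg_one, neg_one_smul, smul_neg, neg_smul]
    rw [Finset.sum_congr rfl h1]
    simp only [neg_smul]
    rw [Finset.sum_neg_distrib, sub_neg_eq_add]
    have h3 := garnir h2 (Finset.Iic j) (by simp [j]; omega) (Or.inl rfl) (fun t ht => LL_lt (by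
      have : t.1 ≤ r := (show t ≤ j from Finset.mem_Iic.1 ht)
      omega)) hm (c := c) (by
        intro h
        have : p ≤ r := (show c ≤ j from Finset.mem_Iic.1 h)
        omega)
    rw [← Finset.Iio_insert, Finset.sum_insert (by simp)] at h3
    exact h3

end Spec


/-! ### Decomposition of tensor space -/

section Decomp

variable {k : Type u} [Field k] {n d : ℕ}

/-- orbit of a label -/
noncomputable def OL (L : Fin d → ℕ) : Finset (Fin d → ℕ) :=
  open Classical in Finset.univ.image fun g : Equiv.Perm (Fin d) => L ∘ ⇑g⁻¹

theorem mem_OL {L ℓ : Fin d → ℕ} : ℓ ∈ OL L ↔ ∃ g : Equiv.Perm (Fin d), L ∘ ⇑g⁻¹ = ℓ := by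
  simp [OL]

/-- chosen representatives -/
noncomputable def rL (L ℓ : Fin d → ℕ) : Equiv.Perm (Fin d) :=
  open Classical in if h : ∃ g : Equiv.Perm (Fin d), L ∘ ⇑g⁻¹ = ℓ then h.choose else 1

theorem rL_spec {L ℓ : Fin d → ℕ} (h : ℓ ∈ OL L) : L ∘ ⇑(rL L ℓ)⁻¹ = ℓ := by
  have h := mem_OL.1 h
  rw [rL, dif_pos h]
  exact h.choose_spec

theorem comp_inv_mul {γ : Type*} (L : Fin d → γ) (a b : Equiv.Perm (Fin d)) :
    L ∘ ⇑(a * b)⁻¹ = (L ∘ ⇑b⁻¹) ∘ ⇑a⁻¹ := by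
  rw [mul_inv_rev, Equiv.Perm.coe_mul, Function.comp_assoc]

theorem coset_sum {A : Type*} [AddCommMonoid A] {L : Fin d → ℕ} (F : Equiv.Perm (Fin d) → A)
    (hF : ∀ g g' : Equiv.Perm (Fin d), L ∘ ⇑g⁻¹ = L ∘ ⇑g'⁻¹ → F g = F g') (τ : Equiv.Perm (Fin d)) :
    ∑ ℓ ∈ OL L, F (τ * rL L ℓ) = ∑ ℓ ∈ OL L, F (rL L ℓ) := by
  have key : ∀ (τ : Equiv.Perm (Fin d)) (ℓ), ℓ ∈ OL L → ℓ ∘ ⇑τ⁻¹ ∈ OL L := by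
    intro τ ℓ hℓ
    obtain ⟨g, rfl⟩ := mem_OL.1 hℓ
    exact mem_OL.2 ⟨τ * g, comp_inv_mul L τ g⟩
  refine Finset.sum_bij (fun ℓ _ => ℓ ∘ ⇑τ⁻¹) (fun ℓ hℓ => key τ ℓ hℓ) ?_ ?_ ?_
  · intro a _ b _ hab
    have := congrArg (fun w => w ∘ ⇑τ) hab
    ext x
    simpa using congrFun this x
  · intro b hb
    refine ⟨b ∘ ⇑τ, by simpa using key τ⁻¹ b hb, ?_⟩
    ext x; simp
  · intro ℓ hℓ
    refine hF _ _ ?_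
    rw [comp_inv_mul, rL_spec hℓ, rL_spec (key τ ℓ hℓ)]

theorem orbit_count {L : Fin d → ℕ} {v : Fin d → Fin n} (hLv : ∀ a b, L a = L b → v a = v b) :
    ((OL L).filter fun ℓ => v ∘ ⇑(rL L ℓ)⁻¹ = v).card * (KL L).card = (KL v).card := by
  classical
  have hfac : ∀ g g' : Equiv.Perm (Fin d), L ∘ ⇑g = L ∘ ⇑g' → v ∘ ⇑g = v ∘ ⇑g' := fun g g' h => by
    ext x
    rw [Function.comp_apply, Function.comp_apply, hLv (g x) (g' x) (congrFun h x)]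
  have hinv : ∀ g : Equiv.Perm (Fin d), v ∘ ⇑g⁻¹ = v → v ∘ ⇑g = v := fun g h => by
    conv_lhs => rw [← h]
    ext x; simp
  have hKL : ∀ κ ∈ KL v, L ∘ ⇑κ⁻¹ ∈ (OL L).filter fun ℓ => v ∘ ⇑(rL L ℓ)⁻¹ = v := by
    intro κ hκ
    have h1 : L ∘ ⇑κ⁻¹ ∈ OL L := mem_OL.2 ⟨κ, rfl⟩
    refine Finset.mem_filter.2 ⟨h1, ?_⟩
    rw [hfac _ _ (rL_spec h1)]
    exact hinv κ⁻¹ (by rw [inv_inv]; exact mem_KL.1 hκ)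
  rw [Finset.card_eq_sum_card_fiberwise (f := fun κ : Equiv.Perm (Fin d) => L ∘ ⇑κ⁻¹) hKL, Finset.sum_const_nat]
  intro ℓ hℓ
  obtain ⟨h1, h2⟩ := Finset.mem_filter.1 hℓ
  symm
  refine Finset.card_bij (fun κ _ => rL L ℓ * κ) ?_ (fun a _ b _ h => mul_left_cancel h) ?_
  · intro κ hκ
    have h3 := mem_KL.1 hκ
    have h4 : L ∘ ⇑(rL L ℓ * κ)⁻¹ = ℓ := by
      rw [comp_inv_mul, keepL_inv h3, rL_spec h1]
    refine Finset.mem_filter.2 ⟨mem_KL.2 (hinv _ ?_), h4⟩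
    rw [hfac _ _ (h4.trans (rL_spec h1).symm), h2]
  · intro g hg
    obtain ⟨h3, h4⟩ := Finset.mem_filter.1 hg
    refine ⟨(rL L ℓ)⁻¹ * g, mem_KL.2 ?_, by simp⟩
    rw [Equiv.Perm.coe_mul, ← Function.comp_assoc, rL_spec h1, ← h4]
    ext x; simp

theorem decomp {p : ℕ} (hp : p.Prime) [CharP k p] {L : Fin d → ℕ} {v : Fin d → Fin n}
    (hLv : ∀ a b, L a = L b → v a = v b) (hev : ∀ a b, a ≠ b → L a = L b → ¬ isOdd (L a))
    (hpv : padicValNat p (KL v).card = padicValNat p (KL L).card) :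
    ∃ (a : TensorSpace k n d →ₗ[LambdaAlgebra k n d] CC (XL k n L))
      (b : CC (XL k n L) →ₗ[LambdaAlgebra k n d] TensorSpace k n d), ∀ f u,
      ((∃ τ : Equiv.Perm (Fin d), u = v ∘ ⇑τ⁻¹) → b (a f) u = f u) ∧
      ((¬ ∃ τ : Equiv.Perm (Fin d), u = v ∘ ⇑τ⁻¹) → b (a f) u = 0) := by
  classical
  have : Fact p.Prime := ⟨hp⟩
  have hfac : ∀ g g' : Equiv.Perm (Fin d), L ∘ ⇑g = L ∘ ⇑g' → v ∘ ⇑g = v ∘ ⇑g' := fun g g' h => by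
    ext x
    rw [Function.comp_apply, Function.comp_apply, hLv (g x) (g' x) (congrFun h x)]
  have hN := orbit_count hLv
  set N := ((OL L).filter fun ℓ => v ∘ ⇑(rL L ℓ)⁻¹ = v).card with hNdef
  have hpos : ∀ {γ : Type} [DecidableEq γ] (w : Fin d → γ), (KL w).card ≠ 0 := fun w => by
    rw [Ne, Finset.card_eq_zero]
    exact Finset.Nonempty.ne_empty ⟨1, mem_KL.2 rfl⟩
  have hN0 : (N : k) ≠ 0 := by
    have h1 : N ≠ 0 := fun h => hpos v (by rw [← hN, h, zero_mul])
    rw [← hN, padicValNat.mul h1 (hpos L)] at hpv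
    rw [Ne, CharP.cast_eq_zero_iff k p]
    intro h
    have := one_le_padicValNat_of_dvd h1 h
    omega
  have hm0 : ∀ g g' : Equiv.Perm (Fin d), L ∘ ⇑g⁻¹ = L ∘ ⇑g'⁻¹ → CC.mk (XL k n L) (gg k n d g) =
      CC.mk (XL k n L) (gg k n d g') := by
    intro g g' h
    rw [CC.mk_eq]
    intro m hm
    have e1 : L ∘ ⇑(g'⁻¹ * g) = L := by
      rw [Equiv.Perm.coe_mul, ← Function.comp_assoc, ← h]
      ext x; simp
    have e2 : eps L (g'⁻¹ * g) = 1 := by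
      refine eps_of_fix_odd (fun x hx => ?_) e1
      by_contra hne
      have := congrFun e1 x
      exact hev _ _ hne this (by rw [show L ((g'⁻¹ * g) x) = L x from this]; exact hx)
    rw [same_word h hm, e2, map_one, one_smul]
  let F : TensorSpace k n d → Equiv.Perm (Fin d) → CC (XL k n L) := fun f g =>
    f (v ∘ ⇑g⁻¹) • CC.mk (XL k n L) (gg k n d g)
  have hF : ∀ f (g g' : Equiv.Perm (Fin d)), L ∘ ⇑g⁻¹ = L ∘ ⇑g'⁻¹ → F f g = F f g' := by
    intro f g g' h
    simp only [F]
    rw [hfac _ _ h, hm0 _ _ h]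
  let A : TensorSpace k n d → CC (XL k n L) := fun f => ∑ ℓ ∈ OL L, F f (rL L ℓ)
  have hAadd : ∀ f f', A (f + f') = A f + A f' := fun f f' => by
    simp only [A, F, ts_add, add_smul, Finset.sum_add_distrib]
  have hAk : ∀ (c : k) f, A (c • f) = c • A f := fun c f => by
    simp only [A, F, ts_smul, mul_smul, Finset.smul_sum]
  have hAg : ∀ τ f, A (gg k n d τ • f) = gg k n d τ • A f := fun τ f => by
    simp only [A]
    rw [← coset_sum _ (hF _) τ, Finset.smul_sum]
    refine Finset.sum_congr rfl fun ℓ _ => ?_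
    simp only [F]
    rw [gg_smul_apply, comp_inv_mul, smul_comm, map_mul, ← smul_eq_mul, map_smul]
    congr 2
    ext x; simp
  let a : TensorSpace k n d →ₗ[LambdaAlgebra k n d] CC (XL k n L) :=
    { toFun := fun f => A f
      map_add' := hAadd
      map_smul' := fun x f => by
        simp only [RingHom.id_apply]
        induction x using lam_induction with
        | hg g => exact hAg g f
        | h0 => rw [zero_smul, zero_smul]; simpa using hAk 0 f
        | hadd x y hx hy => rw [add_smul, hAadd, hx, hy, add_smul]
        | hs c x hx => rw [smul_assoc, hAk, hx, smul_assoc] }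
  let m0 : TensorSpace k n d := fun u => if u = v then (N : k)⁻¹ else 0
  have hm0X : m0 ∈ XL k n L := by
    intro x y hxy hL
    refine ts_ext fun u => ?_
    rw [gg_smul_apply, ts_smul, chi, if_neg (hev x y hxy hL), map_one, one_mul]
    have e : v ∘ ⇑(Equiv.swap x y) = v := by
      ext z
      simp only [Function.comp_apply, Equiv.swap_apply_def]
      have := hLv x y hL
      grind
    have : u ∘ ⇑(Equiv.swap x y) = v ↔ u = v := by
      constructor
      · intro h
        have h3 : (u ∘ ⇑(Equiv.swap x y)) ∘ ⇑(Equiv.swap x y) = u := by ext z; simp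
        rw [h, e] at h3
        exact h3.symm
      · rintro rfl; exact e
    simp only [m0, this]
  refine ⟨a, CC.toM m0 hm0X, fun f u => ?_⟩
  have hval : CC.toM m0 hm0X (a f) u = (N : k)⁻¹ * f u *
      ∑ ℓ ∈ OL L, if v ∘ ⇑(rL L ℓ)⁻¹ = u then 1 else 0 := by
    show CC.toM m0 hm0X (∑ ℓ ∈ OL L, F f (rL L ℓ)) u = _
    rw [map_sum, ts_sum, Finset.mul_sum]
    refine Finset.sum_congr rfl fun ℓ _ => ?_
    refine (congrFun (linear_k (k := k) (CC.toM m0 hm0X) (f (v ∘ ⇑(rL L ℓ)⁻¹))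
      (CC.mk (XL k n L) (gg k n d (rL L ℓ)))) u).trans ?_
    rw [CC.toM_mk, ts_smul, gg_smul_apply]
    have : u ∘ ⇑(rL L ℓ) = v ↔ v ∘ ⇑(rL L ℓ)⁻¹ = u := by
      constructor
      · rintro rfl; ext z; simp
      · rintro rfl; ext z; simp
    simp only [m0, this]
    split_ifs with h
    · rw [h]; ring
    · ring
  rw [hval]
  constructor
  · rintro ⟨τ, rfl⟩
    have h1 := coset_sum (L := L) (fun g => if v ∘ ⇑g⁻¹ = v ∘ ⇑τ⁻¹ then (1 : k) else 0)
      (fun g g' h => by simp only [hfac _ _ h]) τ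
    rw [← h1]
    have h2 : ∀ ℓ, (v ∘ ⇑(τ * rL L ℓ)⁻¹ = v ∘ ⇑τ⁻¹) ↔ v ∘ ⇑(rL L ℓ)⁻¹ = v := fun ℓ => by
      rw [comp_inv_mul]
      constructor
      · intro h
        have := congrArg (fun w => w ∘ ⇑τ) h
        ext x
        simpa using congrArg Fin.val (congrFun this x)
      · intro h; rw [h]
    simp only [h2]
    rw [Finset.sum_boole, ← hNdef]
    field_simp
  · intro h
    rw [Finset.sum_eq_zero, mul_zero]
    intro ℓ _
    rw [if_neg]
    intro h'
    exact h ⟨_, h'.symm⟩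

theorem padic_KL {p : ℕ} (hp : p.Prime) (hd : d < p ^ 2) {γ : Type*} [DecidableEq γ] (L : Fin d → γ) :
    padicValNat p (KL L).card = ∑ i ∈ Finset.univ.image L, Fintype.card {a // L a = i} / p := by
  have : Fact p.Prime := ⟨hp⟩
  have hprod : ∀ s : Finset γ, padicValNat p (∏ i ∈ s, (Fintype.card {a // L a = i}).factorial) =
      ∑ i ∈ s, padicValNat p (Fintype.card {a // L a = i}).factorial := by
    intro s
    induction s using Finset.induction_on with
    | empty => simp
    | insert i s hi ih =>
      rw [Finset.prod_insert hi, Finset.sum_insert hi, padicValNat.mul (Nat.factorial_ne_zero _)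
        (Finset.prod_ne_zero_iff.2 fun _ _ => Nat.factorial_ne_zero _), ih]
  rw [KL_card, hprod]
  refine Finset.sum_congr rfl fun i _ => ?_
  have hc : Fintype.card {a // L a = i} < p ^ 2 := by
    refine lt_of_le_of_lt ((Fintype.card_subtype_le _).trans ?_) hd
    simp
  rw [padicValNat_factorial (b := 2) (Nat.log_lt_of_lt_pow' (by norm_num) hc)]
  simp

end Decomp


section DecompSpec

variable {k : Type u} [Field k] {p : ℕ}

/-- first half -/
def H1 (p : ℕ) : Finset (Fin (2 * p)) := Finset.univ.filter fun a => a.1 < p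
/-- second half -/
def H2 (p : ℕ) : Finset (Fin (2 * p)) := Finset.univ.filter fun a => ¬ a.1 < p

theorem mem_H1 {a : Fin (2 * p)} : a ∈ H1 p ↔ a.1 < p := by simp [H1]
theorem mem_H2 {a : Fin (2 * p)} : a ∈ H2 p ↔ ¬ a.1 < p := by simp [H2]

theorem H1_card : (H1 p).card = p := by
  have : H1 p = Finset.univ.map (Fin.castLEEmb (show p ≤ 2 * p by omega)) := by
    ext a
    rw [mem_H1, Finset.mem_map]
    constructor
    · intro h
      exact ⟨⟨a.1, h⟩, Finset.mem_univ _, rfl⟩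
    · rintro ⟨b, -, rfl⟩
      exact b.2
  rw [this, Finset.card_map, Finset.card_univ, Fintype.card_fin]

theorem H2_card : (H2 p).card = p := by
  have h := Finset.card_filter_add_card_filter_not (s := (Finset.univ : Finset (Fin (2 * p)))) (fun a => a.1 < p)
  have h1 := H1_card (p := p)
  unfold H1 at h1
  unfold H2
  rw [h1, Finset.card_univ, Fintype.card_fin] at h
  omega

theorem padic_sum {γ : Type*} [DecidableEq γ] (hp : p.Prime) (hp3 : 3 ≤ p) (w : Fin (2 * p) → γ) :
    padicValNat p (KL w).card = ∑ i ∈ Finset.univ.image w, (Finset.univ.filter fun a => w a = i).card / p := by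
  rw [padic_KL hp (by nlinarith)]
  refine Finset.sum_congr rfl fun i _ => ?_
  rw [Fintype.card_subtype]

theorem padic_two {γ : Type*} [DecidableEq γ] (hp : p.Prime) (hp3 : 3 ≤ p) (w : Fin (2 * p) → γ)
    (c1 c2 : γ) (h1 : ∀ a, a.1 < p → w a = c1) (h2 : ∀ a, ¬ a.1 < p → w a = c2) :
    padicValNat p (KL w).card = 2 := by
  rw [padic_sum hp hp3]
  have hm1 : c1 ∈ Finset.univ.image w := Finset.mem_image.2 ⟨⟨0, by omega⟩, Finset.mem_univ _, h1 _ (by simp; omega)⟩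
  have hm2 : c2 ∈ Finset.univ.image w := Finset.mem_image.2 ⟨⟨p, by omega⟩, Finset.mem_univ _, h2 _ (by simp)⟩
  by_cases hc : c1 = c2
  · rw [Finset.sum_eq_single_of_mem c1 hm1]
    · rw [Finset.filter_true_of_mem, Finset.card_univ, Fintype.card_fin, Nat.mul_div_cancel _ (by omega)]
      intro a _
      by_cases ha : a.1 < p
      · exact h1 a ha
      · rw [h2 a ha, hc]
    · intro b hb hne
      obtain ⟨a, -, rfl⟩ := Finset.mem_image.1 hb
      exfalso
      by_cases ha : a.1 < p
      · exact hne (h1 a ha)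
      · exact hne (by rw [h2 a ha, hc])
  · rw [Finset.sum_eq_add_of_mem c1 c2 hm1 hm2 hc]
    · have e1 : (Finset.univ.filter fun a => w a = c1) = H1 p := by
        ext a
        rw [Finset.mem_filter, mem_H1]
        have := h1 a
        have := h2 a
        grind
      have e2 : (Finset.univ.filter fun a => w a = c2) = H2 p := by
        ext a
        rw [Finset.mem_filter, mem_H2]
        have := h1 a
        have := h2 a
        grind
      rw [e1, e2, H1_card, H2_card, Nat.div_self (by omega)]
    · intro b hb hne
      obtain ⟨a, -, rfl⟩ := Finset.mem_image.1 hb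
      exfalso
      by_cases ha : a.1 < p
      · exact hne.1 (h1 a ha)
      · exact hne.2 (h2 a ha)

theorem padic_one {γ : Type*} [DecidableEq γ] (hp : p.Prime) (hp3 : 3 ≤ p) (w : Fin (2 * p) → γ)
    (c1 : γ) (h1 : ∀ a, a.1 < p → w a = c1)
    (h2 : ¬ ∃ c2, ∀ a, ¬ a.1 < p → w a = c2) :
    padicValNat p (KL w).card = 1 := by
  rw [padic_sum hp hp3]
  have hm1 : c1 ∈ Finset.univ.image w := Finset.mem_image.2 ⟨⟨0, by omega⟩, Finset.mem_univ _, h1 _ (by simp; omega)⟩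
  rw [Finset.sum_eq_single_of_mem c1 hm1]
  · have hge : p ≤ (Finset.univ.filter fun a => w a = c1).card := by
      conv_lhs => rw [← H1_card (p := p)]
      refine Finset.card_le_card fun a ha => ?_
      exact Finset.mem_filter.2 ⟨Finset.mem_univ _, h1 a (mem_H1.1 ha)⟩
    have hlt : (Finset.univ.filter fun a => w a = c1).card < 2 * p := by
      by_contra hcon
      have := Finset.eq_univ_of_card (Finset.univ.filter fun a => w a = c1) (by
        rw [Fintype.card_fin]
        refine le_antisymm ((Finset.card_le_univ _).trans (by simp)) (by omega))
      refine h2 ⟨c1, fun a _ => ?_⟩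
      have ha := Finset.mem_univ a
      rw [← this] at ha
      exact (Finset.mem_filter.1 ha).2
    rw [Nat.div_eq_iff (by omega)]
    omega
  · intro b _ hne
    refine Nat.div_eq_of_lt ?_
    by_contra hcon
    have hsub : (Finset.univ.filter fun a => w a = b) ⊆ H2 p := fun a ha => by
      rw [mem_H2]
      intro h
      exact hne ((Finset.mem_filter.1 ha).2.symm.trans (h1 a h))
    have := Finset.eq_of_subset_of_card_le hsub (by rw [H2_card]; omega)
    refine h2 ⟨b, fun a ha => ?_⟩
    have ha' := mem_H2.2 ha
    rw [← this] at ha'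
    exact (Finset.mem_filter.1 ha').2

theorem padic_zero {γ : Type*} [DecidableEq γ] (hp : p.Prime) (hp3 : 3 ≤ p) (w : Fin (2 * p) → γ)
    (h : ∀ c, (Finset.univ.filter fun a => w a = c).card < p) :
    padicValNat p (KL w).card = 0 := by
  rw [padic_sum hp hp3]
  exact Finset.sum_eq_zero fun i _ => Nat.div_eq_of_lt (h i)

theorem arrange (v : Fin (2 * p) → Fin p) (c : Fin p) (h : p ≤ (Finset.univ.filter fun a => v a = c).card) :
    ∃ τ : Equiv.Perm (Fin (2 * p)), ∀ a, a.1 < p → v (τ a) = c := by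
  obtain ⟨S, hS, hc⟩ := Finset.exists_subset_card_eq h
  have e : {x : Fin (2 * p) // x ∈ H1 p} ≃ {x : Fin (2 * p) // x ∈ S} :=
    Fintype.equivOfCardEq (by rw [Fintype.card_coe, Fintype.card_coe, H1_card, hc])
  refine ⟨e.extendSubtype, fun a ha => ?_⟩
  have := e.extendSubtype_mem a (mem_H1.2 ha)
  exact (Finset.mem_filter.1 (hS this)).2

theorem EV_orbit (hp : p.Prime) [CharP k p] (hp3 : 3 ≤ p)
    {Y : Type u} [AddCommGroup Y] [Module (LambdaAlgebra k p (2 * p)) Y] {t : ℕ} (ht : 1 ≤ t)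
    (he1 : EV (LambdaAlgebra k p (2 * p)) t (KK k p p (sz (d := 2 * p)) 0) Y)
    (he2 : EV (LambdaAlgebra k p (2 * p)) t (KK k p p (se (d := 2 * p)) 0) Y)
    (v : Fin (2 * p) → Fin p) :
    ∃ L : Fin (2 * p) → ℕ, EV (LambdaAlgebra k p (2 * p)) t (CC (XL k p L)) Y ∧
      ∃ (a : TensorSpace k p (2 * p) →ₗ[LambdaAlgebra k p (2 * p)] CC (XL k p L))
      (b : CC (XL k p L) →ₗ[LambdaAlgebra k p (2 * p)] TensorSpace k p (2 * p)), ∀ f u,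
      ((∃ τ : Equiv.Perm (Fin (2 * p)), u = v ∘ ⇑τ⁻¹) → b (a f) u = f u) ∧
      ((¬ ∃ τ : Equiv.Perm (Fin (2 * p)), u = v ∘ ⇑τ⁻¹) → b (a f) u = 0) := by
  have conv : ∀ (σ : Equiv.Perm (Fin (2 * p))) (u : Fin (2 * p) → Fin p),
      (∃ τ : Equiv.Perm (Fin (2 * p)), u = (v ∘ ⇑σ) ∘ ⇑τ⁻¹) ↔
      (∃ τ : Equiv.Perm (Fin (2 * p)), u = v ∘ ⇑τ⁻¹) := by
    intro σ u
    constructor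
    · rintro ⟨τ, rfl⟩
      exact ⟨τ * σ⁻¹, by ext x; simp⟩
    · rintro ⟨τ, rfl⟩
      exact ⟨τ * σ, by ext x; simp⟩
  by_cases hA : ∀ c, (Finset.univ.filter fun a => v a = c).card < p
  · refine ⟨fun t => t.1 + 4, ?_, ?_⟩
    · refine CC.EV_of_proj ht 1 (fun m a b hab hL => ?_) (fun m _ => one_smul _ m)
      exact absurd (Fin.ext (by simpa using hL)) hab
    · refine decomp hp (fun a b hL => ?_) (fun a b hab hL => ?_) ?_
      · rw [Fin.ext (show a.1 = b.1 by simpa using hL)]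
      · exact absurd (Fin.ext (by simpa using hL)) hab
      · rw [padic_zero hp hp3 v hA, padic_zero hp hp3]
        intro c
        refine lt_of_le_of_lt (Finset.card_le_one.2 ?_) (show 1 < p by omega)
        intro a ha b hb
        have h1 := (Finset.mem_filter.1 ha).2
        have h2 := (Finset.mem_filter.1 hb).2
        exact Fin.ext (by omega)
  · push Not at hA
    obtain ⟨c, hc⟩ := hA
    obtain ⟨σ, hσ⟩ := arrange v c hc
    simp only [← conv σ]
    by_cases hB : ∃ c2, ∀ a : Fin (2 * p), ¬ a.1 < p → (v ∘ ⇑σ) a = c2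
    · obtain ⟨c2, hc2⟩ := hB
      refine ⟨_, he2, decomp hp (fun a b hL => ?_) (fun a b hab hL => ?_) ?_⟩
      · have h1 := hσ a
        have h2 := hσ b
        have h3 := hc2 a
        have h4 := hc2 b
        unfold LL se at hL
        simp only [Function.comp_apply] at *
        grind
      · unfold LL se isOdd
        grind
      · rw [padic_two hp hp3 (v ∘ ⇑σ) c c2 hσ hc2, padic_two hp hp3 _ 1 3]
        · intro a ha; exact LL_mid (by omega) ha
        · intro a ha; exact LL_ge (by omega) ha
    · refine ⟨_, he1, decomp hp (fun a b hL => ?_) (fun a b hab hL => ?_) ?_⟩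
      · have h1 := hσ a
        have h2 := hσ b
        have h3 : a.1 = b.1 → a = b := Fin.ext
        unfold LL sz at hL
        simp only [Function.comp_apply] at *
        grind
      · unfold LL sz isOdd
        grind
      · rw [padic_one hp hp3 (v ∘ ⇑σ) c hσ hB, padic_one hp hp3 _ 1]
        · intro a ha; exact LL_mid (by omega) ha
        · rintro ⟨c2, h⟩
          have h1 := h ⟨p, by omega⟩ (by simp)
          have h2 := h ⟨p + 1, by omega⟩ (by simp)
          unfold LL sz at h1 h2
          simp at h1 h2
          omega

/-- orbit relation on words -/
def orbS (n d : ℕ) : Setoid (Fin d → Fin n) where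
  r u v := ∃ τ : Equiv.Perm (Fin d), u = v ∘ ⇑τ⁻¹
  iseqv := ⟨fun u => ⟨1, by ext x; simp⟩, fun {u v} ⟨τ, h⟩ => ⟨τ⁻¹, by rw [h]; ext x; simp⟩,
    fun {u v w} ⟨τ, h⟩ ⟨σ, h'⟩ => ⟨τ * σ, by rw [h, h']; ext x; simp⟩⟩

theorem EV_M (hp : p.Prime) [CharP k p] (hp3 : 3 ≤ p)
    {Y : Type u} [AddCommGroup Y] [Module (LambdaAlgebra k p (2 * p)) Y] {t : ℕ} (ht : 1 ≤ t)
    (he1 : EV (LambdaAlgebra k p (2 * p)) t (KK k p p (sz (d := 2 * p)) 0) Y)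
    (he2 : EV (LambdaAlgebra k p (2 * p)) t (KK k p p (se (d := 2 * p)) 0) Y) :
    EV (LambdaAlgebra k p (2 * p)) t (TensorSpace k p (2 * p)) Y := by
  classical
  choose L hL a b hab using EV_orbit hp hp3 ht he1 he2
  have : Fintype (Quotient (orbS p (2 * p))) := Fintype.ofFinite _
  refine EV.of_sum (ι := Quotient (orbS p (2 * p))) (fun q => CC (XL k p (L q.out)))
    (fun q => a q.out) (fun q => b q.out) (fun f => ts_ext fun u => ?_) (fun q => hL _)
  rw [ts_sum, Finset.sum_eq_single (Quotient.mk (orbS p (2 * p)) u)]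
  · exact (hab _ f u).1 ((orbS p (2 * p)).symm (Quotient.mk_out (s := orbS p (2 * p)) u))
  · intro q _ hne
    refine (hab _ f u).2 fun h => hne ?_
    rw [← Quotient.out_eq q]
    exact Quotient.sound ((orbS p (2 * p)).symm h)
  · intro h; exact absurd (Finset.mem_univ _) h

end DecompSpec


/-! ### Vanishing of homomorphisms and the final assembly -/

set_option linter.unusedSectionVars false
section Final

variable {k : Type u} [Field k] {p : ℕ}

/-- the functional attached to a homomorphism -/
noncomputable def th {L L' : Fin (2 * p) → ℕ}
    (f : CC (XL k p L) →ₗ[LambdaAlgebra k p (2 * p)]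
      Dl k (LambdaAlgebra k p (2 * p)) (CC (XL k p L')))
    (g : Equiv.Perm (Fin (2 * p))) : k :=
  (f (CC.mk _ 1)).ev (CC.mk _ (gg k p (2 * p) g))

theorem th_eq_zero {L L' : Fin (2 * p) → ℕ}
    (f : CC (XL k p L) →ₗ[LambdaAlgebra k p (2 * p)]
      Dl k (LambdaAlgebra k p (2 * p)) (CC (XL k p L')))
    (h : ∀ g, th f g = 0) : f = 0 := by
  refine CC.hom_ext (Dl.ext' fun y => ?_)
  obtain ⟨a, rfl⟩ := CC.mk_surj y
  have : (f (CC.mk _ 1)).ev (CC.mk _ a) = 0 := by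
    refine lam_induction (P := fun a => (f (CC.mk _ 1)).ev (CC.mk _ a) = 0) a ?_ ?_ ?_ ?_
    · exact h
    · rw [map_zero, map_zero]
    · intro a b ha hb
      rw [map_add, map_add, ha, hb, add_zero]
    · intro c a ha
      rw [CC.mk_ksmul, map_smul, ha, smul_zero]
  rw [this]; rfl

theorem th_gg {L L' : Fin (2 * p) → ℕ}
    (f : CC (XL k p L) →ₗ[LambdaAlgebra k p (2 * p)]
      Dl k (LambdaAlgebra k p (2 * p)) (CC (XL k p L'))) (h g : Equiv.Perm (Fin (2 * p))) :
    th f (h * g) = (f (CC.mk _ (gg k p (2 * p) h⁻¹))).ev (CC.mk _ (gg k p (2 * p) g)) := by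
  rw [CC.mk_smul_one (gg k p (2 * p) h⁻¹), map_smul, Dl.smul_ev, s_gg, inv_inv, ← map_smul, smul_eq_mul,
    ← map_mul (gg k p (2 * p))]
  rfl

theorem th_left {L L' : Fin (2 * p) → ℕ}
    (f : CC (XL k p L) →ₗ[LambdaAlgebra k p (2 * p)]
      Dl k (LambdaAlgebra k p (2 * p)) (CC (XL k p L'))) (g : Equiv.Perm (Fin (2 * p)))
    {a b : Fin (2 * p)} (hab : a ≠ b) (h : L a = L b) (he : ¬ isOdd (L a)) :
    th f (Equiv.swap a b * g) = th f g := by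
  rw [th_gg, Equiv.swap_inv, th]
  have : CC.mk (XL k p L) (gg k p (2 * p) (Equiv.swap a b)) = CC.mk _ 1 := by
    rw [CC.mk_eq]
    intro m hm
    rw [mem_XL_iff.1 hm a b hab h, chi, if_neg he, map_one, one_smul, one_smul]
  rw [this]

theorem th_right {L L' : Fin (2 * p) → ℕ}
    (f : CC (XL k p L) →ₗ[LambdaAlgebra k p (2 * p)]
      Dl k (LambdaAlgebra k p (2 * p)) (CC (XL k p L'))) (g : Equiv.Perm (Fin (2 * p)))
    {a b : Fin (2 * p)} (hab : a ≠ b) (h : L' (g⁻¹ a) = L' (g⁻¹ b)) (he : isOdd (L' (g⁻¹ a))) :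
    th f (Equiv.swap a b * g) = - th f g := by
  have e : Equiv.swap a b * g = g * Equiv.swap (g⁻¹ a) (g⁻¹ b) := by
    rw [Equiv.mul_swap_eq_swap_mul]; simp
  rw [e, th, th, ← map_neg]
  congr 1
  rw [← map_neg, CC.mk_eq]
  intro m hm
  rw [map_mul, mul_smul, mem_XL_iff.1 hm _ _ (fun h => hab (g⁻¹.injective h)) h, chi, if_pos he, sg_neg_one,
    neg_one_smul, smul_neg, neg_smul]

theorem th_garnir (h2 : (2 : k) ≠ 0) {L L' : Fin (2 * p) → ℕ}
    (f : CC (XL k p L) →ₗ[LambdaAlgebra k p (2 * p)]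
      Dl k (LambdaAlgebra k p (2 * p)) (CC (XL k p L'))) (g : Equiv.Perm (Fin (2 * p)))
    (T : Finset (Fin (2 * p))) (hT : p ≤ T.card)
    {o : ℕ} (ho : isOdd o) (hL : ∀ t ∈ T, L t = o) {c : Fin (2 * p)} (hc : c ∉ T) :
    ∑ t ∈ T, th f (Equiv.swap t c * g) = th f g := by
  simp only [th_gg, Equiv.swap_inv]
  have : CC.mk (XL k p L) (∑ t ∈ T, gg k p (2 * p) (Equiv.swap t c)) = CC.mk _ 1 := by
    rw [CC.mk_eq]
    intro m hm
    rw [Finset.sum_smul, garnir h2 T hT ho hL hm hc, one_smul]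
  rw [th, ← this, map_sum, map_sum]
  let F : Dl k (LambdaAlgebra k p (2 * p)) (CC (XL k p L')) →+ k :=
    { toFun := fun θ => θ.ev (CC.mk (XL k p L') (gg k p (2 * p) g))
      map_zero' := rfl
      map_add' := fun _ _ => rfl }
  exact (map_sum F _ T).symm

theorem QL_eq {a b : Fin (2 * p)} (h : a.1 < p ↔ b.1 < p) :
    LL p (so (d := 2 * p)) p a = LL p (so (d := 2 * p)) p b ∧ isOdd (LL p (so (d := 2 * p)) p a) := by
  unfold LL so isOdd
  grind

abbrev QQ (k : Type u) [Field k] (p : ℕ) := Dl k (LambdaAlgebra k p (2 * p)) (KK k p p (so (d := 2 * p)) p)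

theorem th_pair (h2 : (2 : k) ≠ 0) {L : Fin (2 * p) → ℕ}
    (f : CC (XL k p L) →ₗ[LambdaAlgebra k p (2 * p)] QQ k p) (g : Equiv.Perm (Fin (2 * p)))
    {a b : Fin (2 * p)} (hab : a ≠ b) (h : L a = L b) (he : ¬ isOdd (L a))
    (hg : (g⁻¹ a).1 < p ↔ (g⁻¹ b).1 < p) : th f g = 0 := by
  have h1 := th_left f g hab h he
  have h3 := th_right f g hab (QL_eq hg).1 (QL_eq hg).2
  rw [h1] at h3
  have : 2 * th f g = 0 := by linear_combination h3
  exact (mul_eq_zero.1 this).resolve_left h2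

theorem hom_zero_three (h2 : (2 : k) ≠ 0) {L : Fin (2 * p) → ℕ}
    (f : CC (XL k p L) →ₗ[LambdaAlgebra k p (2 * p)] QQ k p)
    {a b c : Fin (2 * p)} (hab : a ≠ b) (hac : a ≠ c) (hbc : b ≠ c) (h : L a = L b) (h' : L a = L c)
    (he : ¬ isOdd (L a)) : f = 0 := by
  refine th_eq_zero f fun g => ?_
  by_cases h3 : (g⁻¹ a).1 < p ↔ (g⁻¹ b).1 < p
  · exact th_pair h2 f g hab h he h3
  by_cases h4 : (g⁻¹ a).1 < p ↔ (g⁻¹ c).1 < p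
  · exact th_pair h2 f g hac h' he h4
  · exact th_pair h2 f g hbc (h ▸ h') (h ▸ he) (by tauto)

theorem hom_zero_two (h2 : (2 : k) ≠ 0) [CharP k p] {L : Fin (2 * p) → ℕ}
    (f : CC (XL k p L) →ₗ[LambdaAlgebra k p (2 * p)] QQ k p)
    {a b : Fin (2 * p)} (hab : a ≠ b) (h : L a = L b)
    (he : ¬ isOdd (L a)) (T : Finset (Fin (2 * p))) (hT : T.card = p) (hL : ∀ t ∈ T, L t = 2) : f = 0 := by
  refine th_eq_zero f fun g => ?_
  have ho : isOdd 2 := Or.inr rfl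
  have key : ∀ c c' : Fin (2 * p), c ≠ c' → L c = L c' → ¬ isOdd (L c) →
      ¬ ((g⁻¹ c).1 < p ↔ (g⁻¹ c').1 < p) →
      th f g = - ((T.filter fun t => ((g⁻¹ t).1 < p ↔ (g⁻¹ c).1 < p)).card : k) * th f g := by
    intro c c' hcc hl hc hg
    have hcT : c ∉ T := fun hh => hc (by rw [hL c hh]; exact ho)
    have hcT' : c' ∉ T := fun hh => hc (by rw [hl, hL c' hh]; exact ho)
    have h1 := th_garnir h2 f g T hT.ge ho hL hcT
    have h3 : ∀ t ∈ T, th f (Equiv.swap t c * g) =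
        if ((g⁻¹ t).1 < p ↔ (g⁻¹ c).1 < p) then - th f g else 0 := by
      intro t ht
      have htc : t ≠ c := fun hh => hcT (hh ▸ ht)
      have htc' : t ≠ c' := fun hh => hcT' (hh ▸ ht)
      split_ifs with hs
      · exact th_right f g htc (QL_eq hs).1 (QL_eq hs).2
      · refine th_pair h2 f _ hcc hl hc ?_
        rw [mul_inv_rev, Equiv.swap_inv, Equiv.Perm.mul_apply, Equiv.Perm.mul_apply, Equiv.swap_apply_right,
          Equiv.swap_apply_of_ne_of_ne htc'.symm hcc.symm]
        tauto
    rw [Finset.sum_congr rfl h3, ← Finset.sum_filter, Finset.sum_const, nsmul_eq_mul] at h1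
    rw [neg_mul, ← mul_neg]; exact h1.symm
  by_cases hg : (g⁻¹ a).1 < p ↔ (g⁻¹ b).1 < p
  · exact th_pair h2 f g hab h he hg
  have k1 := key a b hab h he hg
  have k2 := key b a hab.symm h.symm (h ▸ he) (fun hh => hg hh.symm)
  have k3 : ((T.filter fun t => ((g⁻¹ t).1 < p ↔ (g⁻¹ a).1 < p)).card : k) +
      ((T.filter fun t => ((g⁻¹ t).1 < p ↔ (g⁻¹ b).1 < p)).card : k) = 0 := by
    have h5 := Finset.card_filter_add_card_filter_not (s := T) (fun t => ((g⁻¹ t).1 < p ↔ (g⁻¹ a).1 < p))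
    have h6 : (T.filter fun t => ¬ ((g⁻¹ t).1 < p ↔ (g⁻¹ a).1 < p)) =
        T.filter fun t => ((g⁻¹ t).1 < p ↔ (g⁻¹ b).1 < p) :=
      Finset.filter_congr fun t _ => by tauto
    rw [h6, hT] at h5
    have h7 := congrArg (Nat.cast : ℕ → k) h5
    rw [Nat.cast_add, CharP.cast_eq_zero k p] at h7
    exact h7
  have : 2 * th f g = 0 := by linear_combination k1 + k2 - k3 * th f g
  exact (mul_eq_zero.1 this).resolve_left h2

theorem hom_zero_se (h2 : (2 : k) ≠ 0) (hp3 : 3 ≤ p) {i : ℕ} (hi : i ≤ p)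
    (f : KK k p p (se (d := 2 * p)) i →ₗ[LambdaAlgebra k p (2 * p)] QQ k p) : f = 0 := by
  have e : ∀ t : Fin (2 * p), p ≤ t.1 → LL p (se (d := 2 * p)) i t = 3 := by
    intro t ht; unfold LL se; grind
  have := e ⟨p, by omega⟩ le_rfl
  have := e ⟨p + 1, by omega⟩ (by simp)
  have := e ⟨p + 2, by omega⟩ (by simp)
  refine hom_zero_three h2 f (a := ⟨p, by omega⟩) (b := ⟨p + 1, by omega⟩) (c := ⟨p + 2, by omega⟩)
    (by simp) (by simp) (by simp) (by simp [*]) (by simp [*]) (by simp [*, isOdd])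

theorem hom_zero_so (h2 : (2 : k) ≠ 0) [CharP k p] (hp3 : 3 ≤ p) {i : ℕ} (hi : i + 2 ≤ p)
    (f : KK k p p (so (d := 2 * p)) i →ₗ[LambdaAlgebra k p (2 * p)] QQ k p) : f = 0 := by
  have e : ∀ t : Fin (2 * p), i ≤ t.1 → t.1 < p → LL p (so (d := 2 * p)) i t = 1 := by
    intro t ht _; unfold LL; grind
  have h0 := e ⟨i, by omega⟩ le_rfl (by simp; omega)
  have h1 := e ⟨i + 1, by omega⟩ (by simp) (by simp; omega)
  by_cases hi3 : i + 3 ≤ p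
  · have h3 := e ⟨i + 2, by omega⟩ (by simp) (by simp; omega)
    exact hom_zero_three h2 f (a := ⟨i, by omega⟩) (b := ⟨i + 1, by omega⟩) (c := ⟨i + 2, by omega⟩)
      (by simp) (by simp) (by simp) (by rw [h0, h1]) (by rw [h0, h3]) (by rw [h0]; simp [isOdd])
  · refine hom_zero_two h2 f (a := ⟨i, by omega⟩) (b := ⟨i + 1, by omega⟩) (by simp) (by rw [h0, h1])
      (by rw [h0]; simp [isOdd]) (H2 p) H2_card ?_
    intro t ht
    have := mem_H2.1 ht
    unfold LL so; grind


theorem two_ne (hp : p.Prime) [CharP k p] (hp3 : 3 ≤ p) : (2 : k) ≠ 0 := by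
  intro h
  have h1 : ((2 : ℕ) : k) = 0 := by exact_mod_cast h
  have h2 := Nat.le_of_dvd (by norm_num) ((CharP.cast_eq_zero_iff k p 2).1 h1)
  omega

section Steps

variable (hp : p.Prime) [CharP k p] (hp3 : 3 ≤ p)

include hp hp3 in
theorem step1 {m : ℕ} (hm : 1 ≤ m) :
    EV (LambdaAlgebra k p (2 * p)) m (KK k p p (sz (d := 2 * p)) 0) (QQ k p) := by
  have h2 : (2 : k) ≠ 0 := two_ne hp hp3
  rw [EV.dual_iff hm, (koszul_exact h2 so_ge (by omega) (by omega)).lemB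
    (fun t i ht hi hip => EV_so_mid hp hi hip (EV_sz_p hp h2 ht)) hm, EV.dual_iff (by omega),
    ← (koszul_exact h2 sz_ge (by omega) (by omega)).lemB
    (fun t i ht hi hip => EV_sz_mid hp hi hip ht) hm]
  exact EV_sz_p hp h2 hm

include hp hp3 in
theorem step2 {m : ℕ} (hm : 1 ≤ m) (hm' : m + 3 ≤ p) :
    EV (LambdaAlgebra k p (2 * p)) m (KK k p p (so (d := 2 * p)) 0) (QQ k p) := by
  have h2 : (2 : k) ≠ 0 := two_ne hp hp3
  refine (koszul_exact h2 so_ge (by omega) (by omega)).lemA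
    (fun t i ht hi hip => EV_so_mid hp hi hip (EV_sz_p hp h2 ht)) hm (by omega) ?_
  intro f _
  exact ⟨0, by rw [hom_zero_so h2 hp3 (by omega) f, LinearMap.zero_comp]⟩

include hp hp3 in
theorem step3 {m : ℕ} (hm : 1 ≤ m) (hm' : m + 4 ≤ 2 * p) :
    EV (LambdaAlgebra k p (2 * p)) m (KK k p p (se (d := 2 * p)) 0) (QQ k p) := by
  have h2 : (2 : k) ≠ 0 := two_ne hp hp3
  have hK := koszul_exact (k := k) (n := p) (d := 2 * p) h2 se_ge (show 2 ≤ p by omega) (by omega)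
  by_cases h : m < p
  · refine hK.lemA (fun t i ht hi hip => EV_se_mid hp hi hip (step1 hp hp3 ht)) hm h ?_
    intro f _
    exact ⟨0, by rw [hom_zero_se h2 hp3 (by omega) f, LinearMap.zero_comp]⟩
  · have := (hK.lemB (m := m - (p - 1)) (fun t i ht hi hip => EV_se_mid hp hi hip (step1 hp hp3 ht))
      (by omega)).1 (EV_se_p (step2 hp hp3 (by omega) (by omega)))
    rwa [Nat.sub_add_cancel (by omega)] at this

include hp hp3 in
theorem step4 {m : ℕ} (hm : 1 ≤ m) (hm' : m + 4 ≤ 2 * p) :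
    EV (LambdaAlgebra k p (2 * p)) m (KK k p p (so (d := 2 * p)) p) (TensorSpace k p (2 * p)) :=
  EV.of_equiv_right (tsDual k p (2 * p))
    ((EV.dual_iff hm).1 (EV_M hp hp3 hm (step1 hp hp3 hm) (step3 hp hp3 hm hm')))

include hp hp3 in
theorem step5 {m : ℕ} (hm : 1 ≤ m) :
    EV (LambdaAlgebra k p (2 * p)) m (KK k p p (sz (d := 2 * p)) 0) (TensorSpace k p (2 * p)) := by
  have h2 : (2 : k) ≠ 0 := two_ne hp hp3
  have hK := koszul_exact (k := k) (n := p) (d := 2 * p) h2 sz_ge (show 2 ≤ p by omega) (by omega)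
  by_cases h : m < p
  · exact hK.lemA (fun t i ht hi hip => EV_sz_mid hp hi hip ht) hm h
      (fun f hf => hom_exact h2 sz_ge (by omega) h f hf)
  · have := (hK.lemB (m := m - (p - 1)) (fun t i ht hi hip => EV_sz_mid hp hi hip ht)
      (by omega)).1 (EV_sz_p (Y := TensorSpace k p (2 * p)) hp h2 (by omega))
    rwa [Nat.sub_add_cancel (by omega)] at this

include hp hp3 in
theorem step6 {m : ℕ} (hm : 1 ≤ m) (hm' : m + 5 ≤ 3 * p) :
    EV (LambdaAlgebra k p (2 * p)) m (KK k p p (so (d := 2 * p)) 0) (TensorSpace k p (2 * p)) := by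
  have h2 : (2 : k) ≠ 0 := two_ne hp hp3
  have hK := koszul_exact (k := k) (n := p) (d := 2 * p) h2 so_ge (show 2 ≤ p by omega) (by omega)
  by_cases h : m < p
  · exact hK.lemA (fun t i ht hi hip => EV_so_mid hp hi hip (EV_sz_p hp h2 ht)) hm h
      (fun f hf => hom_exact h2 so_ge (by omega) h f hf)
  · have := (hK.lemB (m := m - (p - 1)) (fun t i ht hi hip => EV_so_mid hp hi hip (EV_sz_p hp h2 ht))
      (by omega)).1 (step4 hp hp3 (by omega) (by omega))
    rwa [Nat.sub_add_cancel (by omega)] at this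

include hp hp3 in
theorem step7 {m : ℕ} (hm : 1 ≤ m) (hm' : m + 6 ≤ 4 * p) :
    EV (LambdaAlgebra k p (2 * p)) m (KK k p p (se (d := 2 * p)) 0) (TensorSpace k p (2 * p)) := by
  have h2 : (2 : k) ≠ 0 := two_ne hp hp3
  have hK := koszul_exact (k := k) (n := p) (d := 2 * p) h2 se_ge (show 2 ≤ p by omega) (by omega)
  by_cases h : m < p
  · exact hK.lemA (fun t i ht hi hip => EV_se_mid hp hi hip (step5 hp hp3 ht)) hm h
      (fun f hf => hom_exact h2 se_ge (by omega) h f hf)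
  · have := (hK.lemB (m := m - (p - 1)) (fun t i ht hi hip => EV_se_mid hp hi hip (step5 hp hp3 ht))
      (by omega)).1 (EV_se_p (step6 hp hp3 (by omega) (by omega)))
    rwa [Nat.sub_add_cancel (by omega)] at this

include hp hp3 in
theorem step8 {m : ℕ} (hm : 1 ≤ m) (hm' : m + 6 ≤ 4 * p) :
    EV (LambdaAlgebra k p (2 * p)) m (TensorSpace k p (2 * p)) (TensorSpace k p (2 * p)) :=
  EV_M hp hp3 hm (step5 hp hp3 hm) (step7 hp hp3 hm hm')

end Steps

end Final

/-- Let `k` be an algebraically closed field of prime characteristic `p ≥ 3`. Then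
`Ext^l_{Λ_k(p,2p)}(V^{⊗2p}, V^{⊗2p}) = 0` for all `1 ≤ l ≤ 4(p-1) - 2`. -/
theorem ext_tensorSpace_tensorSpace_isZero (k : Type u) [Field k] [IsAlgClosed k] (p : ℕ)
    (hp : p.Prime) [CharP k p] (hp3 : 3 ≤ p) :
    ∀ l : ℕ, 1 ≤ l → l ≤ 4 * (p - 1) - 2 →
      ExtIsZero k (LambdaAlgebra k p (2 * p)) (TensorSpace k p (2 * p))
        (TensorSpace k p (2 * p)) l := by
  intro l hl hl'
  exact extIsZero_of_abelianExt k _ _ _ l hl (step8 hp hp3 hl (by omega))
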